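/- Let K be a compact subgroup of the orthogonal group O(m,ℝ) acting on ℝ^m by matrix multiplication, and let σ₁,…,σ_N be polynomials in m real variables (elements of MvPolynomial (Fin m) ℝ) such that each σ_i is K-invariant (σ_i(g·x) = σ_i(x) for all g ∈ K, x ∈ ℝ^m) and such that every K-invariant polynomial in m variables lies in the ℝ-subalgebra generated by σ₁,…,σ_N. Then for every C^∞ function f : ℝ^m → ℝ that is K-invariant (f(g·x) = f(x) for all g ∈ K, x ∈ ℝ^m) there exists a C^∞ function F : ℝ^N → ℝ with f(x) = F(σ₁(x),…,σ_N(x)) for all x ∈ ℝ^m. -/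

import Mathlib

namespace Schwarz

open scoped ContDiff Topology

set_option linter.all false
set_option linter.unusedSectionVars false
set_option linter.style.haveILetI false
set_option linter.unusedSimpArgs false

/-! ### Part A: polynomial functions -/

section PolyBasics

variable {W : Type} [NormedAddCommGroup W] [NormedSpace ℝ W]

/-- The algebra of polynomial functions on a normed space. -/
def Poly (W : Type) [NormedAddCommGroup W] [NormedSpace ℝ W] : Subalgebra ℝ (W → ℝ) :=
  Algebra.adjoin ℝ (Set.range (fun l : W →L[ℝ] ℝ => (l : W → ℝ)))

/-- Homogeneous functions of degree `e`. -/
def IsHom (e : ℕ) (p : W → ℝ) : Prop := ∀ (t : ℝ) (x : W), p (t • x) = t ^ e * p x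

lemma poly_clm (l : W →L[ℝ] ℝ) : (l : W → ℝ) ∈ Poly W :=
  Algebra.subset_adjoin ⟨l, rfl⟩

lemma poly_const (c : ℝ) : (fun _ : W => c) ∈ Poly W := (Poly W).algebraMap_mem c

lemma poly_induction {C : (p : W → ℝ) → p ∈ Poly W → Prop}
    (hl : ∀ l : W →L[ℝ] ℝ, C l (poly_clm l))
    (hc : ∀ c : ℝ, C (fun _ => c) (poly_const c))
    (ha : ∀ p q (hp : p ∈ Poly W) (hq : q ∈ Poly W), C p hp → C q hq →
      C (fun x => p x + q x) ((Poly W).add_mem hp hq))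
    (hm : ∀ p q (hp : p ∈ Poly W) (hq : q ∈ Poly W), C p hp → C q hq →
      C (fun x => p x * q x) ((Poly W).mul_mem hp hq))
    {p : W → ℝ} (hp : p ∈ Poly W) : C p hp := by
  refine Algebra.adjoin_induction (p := fun x hx => C x hx) ?_ ?_ ?_ ?_ hp
  · rintro _ ⟨l, rfl⟩; exact hl l
  · exact fun r => hc r
  · exact fun x y hx hy h1 h2 => ha x y hx hy h1 h2
  · exact fun x y hx hy h1 h2 => hm x y hx hy h1 h2

lemma poly_add {p q : W → ℝ} (hp : p ∈ Poly W) (hq : q ∈ Poly W) :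
    (fun x => p x + q x) ∈ Poly W := (Poly W).add_mem hp hq

lemma poly_mul {p q : W → ℝ} (hp : p ∈ Poly W) (hq : q ∈ Poly W) :
    (fun x => p x * q x) ∈ Poly W := (Poly W).mul_mem hp hq

lemma poly_sub {p q : W → ℝ} (hp : p ∈ Poly W) (hq : q ∈ Poly W) :
    (fun x => p x - q x) ∈ Poly W := (Poly W).sub_mem hp hq

lemma poly_cmul (c : ℝ) {p : W → ℝ} (hp : p ∈ Poly W) :
    (fun x => c * p x) ∈ Poly W := poly_mul (poly_const c) hp

lemma poly_sum {ι : Type*} (s : Finset ι) {p : ι → W → ℝ} (hp : ∀ i ∈ s, p i ∈ Poly W) :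
    (fun x => ∑ i ∈ s, p i x) ∈ Poly W := by
  have := (Poly W).sum_mem hp
  convert this using 1
  ext x; simp

lemma poly_prod {ι : Type*} (s : Finset ι) {p : ι → W → ℝ} (hp : ∀ i ∈ s, p i ∈ Poly W) :
    (fun x => ∏ i ∈ s, p i x) ∈ Poly W := by
  have := (Poly W).prod_mem hp
  convert this using 1
  ext x; simp

lemma poly_contDiff {p : W → ℝ} (hp : p ∈ Poly W) {n : WithTop ℕ∞} : ContDiff ℝ n p := by
  induction hp using poly_induction with
  | hl l => exact l.contDiff
  | hc c => exact contDiff_const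
  | ha p q _ _ h1 h2 => exact h1.add h2
  | hm p q _ _ h1 h2 => exact h1.mul h2

lemma poly_continuous {p : W → ℝ} (hp : p ∈ Poly W) : Continuous p :=
  (poly_contDiff hp (n := 0)).continuous

lemma poly_differentiable {p : W → ℝ} (hp : p ∈ Poly W) : Differentiable ℝ p :=
  (poly_contDiff hp (n := 1)).differentiable one_ne_zero

lemma poly_comp {W' : Type} [NormedAddCommGroup W'] [NormedSpace ℝ W'] {T : W → W'}
    (hT : ∀ l : W' →L[ℝ] ℝ, (fun x => l (T x)) ∈ Poly W) {p : W' → ℝ} (hp : p ∈ Poly W') :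
    (fun x => p (T x)) ∈ Poly W := by
  induction hp using poly_induction with
  | hl l => exact hT l
  | hc c => exact poly_const c
  | ha p q _ _ h1 h2 => exact poly_add h1 h2
  | hm p q _ _ h1 h2 => exact poly_mul h1 h2

lemma poly_comp_clm {W' : Type} [NormedAddCommGroup W'] [NormedSpace ℝ W'] (T : W →L[ℝ] W')
    {p : W' → ℝ} (hp : p ∈ Poly W') : (fun x => p (T x)) ∈ Poly W :=
  poly_comp (fun l => poly_clm (l.comp T)) hp

lemma poly_comp_affine {W' : Type} [NormedAddCommGroup W'] [NormedSpace ℝ W'] (a : W')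
    (T : W →L[ℝ] W') {p : W' → ℝ} (hp : p ∈ Poly W') : (fun x => p (a + T x)) ∈ Poly W :=
  poly_comp (fun l => by
    simp only [map_add]
    exact poly_add (poly_const _) (poly_clm (l.comp T))) hp

lemma poly_fderiv {p : W → ℝ} (hp : p ∈ Poly W) (w : W) :
    (fun x => fderiv ℝ p x w) ∈ Poly W := by
  induction hp using poly_induction with
  | hl l => simpa using poly_const (l w)
  | hc c => simpa using poly_const (0 : ℝ)
  | ha p q hp hq h1 h2 =>
    have : (fun x => fderiv ℝ (fun x => p x + q x) x w)
        = fun x => fderiv ℝ p x w + fderiv ℝ q x w := by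
      ext x
      rw [fderiv_fun_add (poly_differentiable hp x) (poly_differentiable hq x)]; rfl
    rw [this]; exact poly_add h1 h2
  | hm p q hp hq h1 h2 =>
    have : (fun x => fderiv ℝ (fun x => p x * q x) x w)
        = fun x => p x * fderiv ℝ q x w + q x * fderiv ℝ p x w := by
      ext x
      rw [fderiv_fun_mul (poly_differentiable hp x) (poly_differentiable hq x)]; rfl
    rw [this]; exact poly_add (poly_mul hp h2) (poly_mul hq h1)

/-- Hadamard's lemma for polynomials. -/
lemma poly_hadamard {p : W → ℝ} (hp : p ∈ Poly W) :
    ∃ u : ℝ × W × W → ℝ, Continuous u ∧ (∀ t a y, p (a + t • y) = p a + t * u (t, a, y)) ∧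
      ∀ a y, u (0, a, y) = fderiv ℝ p a y := by
  induction hp using poly_induction with
  | hl l =>
    refine ⟨fun z => l z.2.2, by fun_prop, fun t a y => by simp, fun a y => by simp⟩
  | hc c => exact ⟨fun _ => 0, by fun_prop, by simp, by simp⟩
  | ha p q hp hq h1 h2 =>
    obtain ⟨u, hu, hu1, hu2⟩ := h1
    obtain ⟨v, hv, hv1, hv2⟩ := h2
    refine ⟨fun z => u z + v z, by fun_prop, fun t a y => ?_, fun a y => ?_⟩
    · beta_reduce; rw [hu1, hv1]; ring
    · rw [fderiv_fun_add (poly_differentiable hp a) (poly_differentiable hq a)]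
      simp [hu2, hv2]
  | hm p q hp hq h1 h2 =>
    obtain ⟨u, hu, hu1, hu2⟩ := h1
    obtain ⟨v, hv, hv1, hv2⟩ := h2
    have hpc := poly_continuous hp
    have hqc := poly_continuous hq
    refine ⟨fun z => p z.2.1 * v z + q z.2.1 * u z + z.1 * (u z * v z), by fun_prop,
      fun t a y => ?_, fun a y => ?_⟩
    · beta_reduce; rw [hu1, hv1]; ring
    · rw [fderiv_fun_mul (poly_differentiable hp a) (poly_differentiable hq a)]
      simp [hu2, hv2]

lemma mem_adjoin_iff {ι X : Type*} (σ : ι → X → ℝ) (p : X → ℝ) :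
    p ∈ Algebra.adjoin ℝ (Set.range σ) ↔
      ∃ B : MvPolynomial ι ℝ, ∀ x, p x = MvPolynomial.eval (fun i => σ i x) B := by
  rw [Algebra.adjoin_range_eq_range_aeval]
  have key : ∀ (B : MvPolynomial ι ℝ) x,
      MvPolynomial.aeval σ B x = MvPolynomial.eval (fun i => σ i x) B := by
    intro B x
    induction B using MvPolynomial.induction_on with
    | C a => simp
    | add p q h1 h2 => simp [h1, h2]
    | mul_X p i h => simp [h]
  constructor
  · rintro ⟨B, rfl⟩
    exact ⟨B, fun x => key B x⟩
  · rintro ⟨B, hB⟩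
    exact ⟨B, by ext x; rw [hB]; exact key B x⟩

lemma weighted_eval {ι : Type*} [Fintype ι] {w : ι → ℕ} {n : ℕ} {B : MvPolynomial ι ℝ}
    (hB : MvPolynomial.IsWeightedHomogeneous w B n) (t : ℝ) (y : ι → ℝ) :
    MvPolynomial.eval (fun i => t ^ (w i) * y i) B = t ^ n * MvPolynomial.eval y B := by
  rw [MvPolynomial.eval_eq', MvPolynomial.eval_eq', Finset.mul_sum]
  refine Finset.sum_congr rfl fun d hd => ?_
  have h1 := hB (MvPolynomial.mem_support_iff.1 hd)
  rw [← h1, Finsupp.weight_apply, Finsupp.sum_fintype _ _ (by simp)]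
  simp only [mul_pow, Finset.prod_mul_distrib, ← pow_mul, Finset.prod_pow_eq_pow_sum]
  simp only [smul_eq_mul, mul_comm]
  ring

lemma weighted_decomp {ι : Type*} (w : ι → ℕ) (B : MvPolynomial ι ℝ) :
    ∃ n : ℕ, B = ∑ j ∈ Finset.range n, MvPolynomial.weightedHomogeneousComponent w j B := by
  have hfin := MvPolynomial.weightedHomogeneousComponent_finsupp (w := w) B
  obtain ⟨n, hn⟩ := hfin.bddAbove
  refine ⟨n + 1, ?_⟩
  conv_lhs => rw [← MvPolynomial.sum_weightedHomogeneousComponent w B]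
  refine finsum_eq_sum_of_support_subset _ ?_
  intro j hj
  have := hn hj
  simp; omega

/-- two polynomials in one variable agreeing have same coefficients -/
lemma coeff_unique {n : ℕ} {a b : ℕ → ℝ}
    (h : ∀ t : ℝ, ∑ j ∈ Finset.range n, t ^ j * a j = ∑ j ∈ Finset.range n, t ^ j * b j) :
    ∀ j < n, a j = b j := by
  intro j hj
  have h1 : (∑ j ∈ Finset.range n, Polynomial.C (a j) * Polynomial.X ^ j : Polynomial ℝ)
      = ∑ j ∈ Finset.range n, Polynomial.C (b j) * Polynomial.X ^ j := by
    refine Polynomial.funext fun t => ?_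
    simp only [Polynomial.eval_finsetSum, Polynomial.eval_mul, Polynomial.eval_C,
      Polynomial.eval_pow, Polynomial.eval_X]
    simpa [mul_comm] using h t
  have h2 := congrArg (fun q => Polynomial.coeff q j) h1
  simpa [Polynomial.finsetSum_coeff, Polynomial.coeff_C_mul, Polynomial.coeff_X_pow, hj] using h2

lemma coeff_unique_hom {n : ℕ} {a : ℕ → ℝ} {e : ℕ} {c : ℝ}
    (h : ∀ t : ℝ, ∑ j ∈ Finset.range n, t ^ j * a j = t ^ e * c) :
    (e < n → c = a e) ∧ (n ≤ e → c = 0) := by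
  have := coeff_unique (n := max n (e + 1)) (a := fun j => if j < n then a j else 0)
    (b := fun j => if j = e then c else 0) (fun t => by
      have e1 : ∑ j ∈ Finset.range (max n (e+1)), t ^ j * (if j < n then a j else 0)
          = ∑ j ∈ Finset.range n, t ^ j * a j := by
        rw [← Finset.sum_subset (Finset.range_subset_range.2 (le_max_left n (e+1)))]
        · refine Finset.sum_congr rfl fun j hj => ?_
          rw [if_pos (Finset.mem_range.1 hj)]
        · intro j _ hj
          rw [if_neg (by simpa using hj)]; simp
      rw [e1, h]
      simp)
  have h3 := this e (by simp)
  constructor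
  · intro he; simpa [he] using h3.symm
  · intro he; simpa [not_lt.2 he] using h3.symm

end PolyBasics

section PolyFin

variable {W : Type} [NormedAddCommGroup W] [NormedSpace ℝ W] [FiniteDimensional ℝ W]

/-- coordinates -/
noncomputable def crd (W : Type) [NormedAddCommGroup W] [NormedSpace ℝ W] [FiniteDimensional ℝ W]
    (i : Fin (Module.finrank ℝ W)) : W →L[ℝ] ℝ :=
  LinearMap.toContinuousLinearMap ((Module.finBasis ℝ W).coord i)

lemma crd_expand (l : W →L[ℝ] ℝ) (x : W) :
    l x = ∑ i, l (Module.finBasis ℝ W i) * crd W i x := by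
  conv_lhs => rw [← (Module.finBasis ℝ W).sum_repr x]
  rw [map_sum]
  simp [crd, mul_comm]

lemma vec_expand (x : W) : x = ∑ i, crd W i x • Module.finBasis ℝ W i := by
  simpa [crd] using ((Module.finBasis ℝ W).sum_repr x).symm

lemma poly_eq_adjoin_crd :
    Poly W = Algebra.adjoin ℝ (Set.range (fun i => (crd W i : W → ℝ))) := by
  apply le_antisymm
  · refine Algebra.adjoin_le ?_
    rintro _ ⟨l, rfl⟩
    have : (l : W → ℝ) = ∑ i, l (Module.finBasis ℝ W i) • (crd W i : W → ℝ) := by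
      ext x; rw [crd_expand l x]; simp
    show (l : W → ℝ) ∈ Algebra.adjoin ℝ (Set.range (fun i => (crd W i : W → ℝ)))
    rw [this]
    refine Subalgebra.sum_mem _ fun i _ => Subalgebra.smul_mem _ ?_ _
    exact Algebra.subset_adjoin (Set.mem_range_self i)
  · refine Algebra.adjoin_mono ?_
    rintro _ ⟨i, rfl⟩
    exact ⟨crd W i, rfl⟩

instance poly_noeth : IsNoetherianRing (Poly W) := by
  refine isNoetherianRing_of_fg ?_
  rw [poly_eq_adjoin_crd]
  exact ⟨(Set.finite_range (fun i => (crd W i : W → ℝ))).toFinset, by simp⟩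

lemma poly_iff_eval (p : W → ℝ) : p ∈ Poly W ↔
    ∃ B : MvPolynomial (Fin (Module.finrank ℝ W)) ℝ,
      ∀ x, p x = MvPolynomial.eval (fun i => crd W i x) B := by
  rw [poly_eq_adjoin_crd, mem_adjoin_iff]

lemma poly_eval {ι : Type*} {σ : ι → W → ℝ} (hσ : ∀ i, σ i ∈ Poly W) (B : MvPolynomial ι ℝ) :
    (fun x => MvPolynomial.eval (fun i => σ i x) B) ∈ Poly W := by
  have h : Algebra.adjoin ℝ (Set.range σ) ≤ Poly W := Algebra.adjoin_le (by rintro _ ⟨i, rfl⟩; exact hσ i)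
  exact h ((mem_adjoin_iff σ _).2 ⟨B, fun _ => rfl⟩)

lemma crd_hom (i) (t : ℝ) (x : W) : crd W i (t • x) = t ^ 1 * crd W i x := by simp

lemma isHom_component (B : MvPolynomial (Fin (Module.finrank ℝ W)) ℝ) {j : ℕ}
    (hB : MvPolynomial.IsWeightedHomogeneous (fun _ => 1) B j) :
    IsHom j (fun x : W => MvPolynomial.eval (fun i => crd W i x) B) := by
  intro t x
  have := weighted_eval hB t (fun i => crd W i x)
  simpa using this

/-- Homogeneous decomposition of a polynomial function. -/
lemma poly_decomp {p : W → ℝ} (hp : p ∈ Poly W) :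
    ∃ (n : ℕ) (c : ℕ → W → ℝ), (∀ j, c j ∈ Poly W) ∧ (∀ j, IsHom j (c j)) ∧
      ∀ x, p x = ∑ j ∈ Finset.range n, c j x := by
  obtain ⟨B, hB⟩ := (poly_iff_eval p).1 hp
  obtain ⟨n, hn⟩ := weighted_decomp (fun _ => 1) B
  refine ⟨n, fun j x => MvPolynomial.eval (fun i => crd W i x)
    (MvPolynomial.weightedHomogeneousComponent (fun _ => 1) j B), fun j => ?_, fun j => ?_,
    fun x => ?_⟩
  · exact poly_eval (fun i => poly_clm (crd W i)) _
  · exact isHom_component _ (MvPolynomial.weightedHomogeneousComponent_isWeightedHomogeneous _ _)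
  · rw [hB, ← map_sum, ← hn]

/-- The space of homogeneous polynomials of degree `e`. -/
def HomPoly (W : Type) [NormedAddCommGroup W] [NormedSpace ℝ W] (e : ℕ) : Submodule ℝ (W → ℝ) where
  carrier := {p | p ∈ Poly W ∧ IsHom e p}
  add_mem' := by
    rintro p q ⟨h1, h2⟩ ⟨h3, h4⟩
    exact ⟨(Poly W).add_mem h1 h3, fun t x => by simp [h2 t x, h4 t x]; ring⟩
  zero_mem' := ⟨(Poly W).zero_mem, fun t x => by simp⟩
  smul_mem' := by
    rintro c p ⟨h1, h2⟩
    exact ⟨(Poly W).smul_mem h1 c, fun t x => by simp [h2 t x]; ring⟩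

lemma homPoly_finite (e : ℕ) : FiniteDimensional ℝ (HomPoly W e) := by
  let ev : MvPolynomial (Fin (Module.finrank ℝ W)) ℝ →ₗ[ℝ] (W → ℝ) :=
    (MvPolynomial.aeval (fun i => (crd W i : W → ℝ))).toLinearMap
  have hfg := MvPolynomial.weightedHomogeneousSubmodule_fg (R := ℝ)
    (σ := Fin (Module.finrank ℝ W)) (fun _ => 1) (by simp) e
  have hfg2 : (Submodule.map ev (MvPolynomial.weightedHomogeneousSubmodule ℝ
    (fun _ : Fin (Module.finrank ℝ W) => 1) e)).FG := hfg.map ev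
  have hle : HomPoly W e ≤ Submodule.map ev (MvPolynomial.weightedHomogeneousSubmodule ℝ
    (fun _ : Fin (Module.finrank ℝ W) => 1) e) := by
    rintro p ⟨hp, hh⟩
    obtain ⟨B, hB⟩ := (poly_iff_eval p).1 hp
    obtain ⟨n, hn⟩ := weighted_decomp (fun _ => 1) B
    have hev : ∀ (B : MvPolynomial (Fin (Module.finrank ℝ W)) ℝ) x,
        ev B x = MvPolynomial.eval (fun i => crd W i x) B := by
      intro B x
      induction B using MvPolynomial.induction_on with
      | C a => simp [ev]
      | add p q h1 h2 => simp [h1, h2]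
      | mul_X p i h =>
        simp only [ev, AlgHom.toLinearMap_apply, map_mul, Pi.mul_apply, MvPolynomial.aeval_X,
          MvPolynomial.eval_X] at h ⊢
        rw [h]
    have hx : ∀ x, (e < n → p x = MvPolynomial.eval (fun i => crd W i x)
        (MvPolynomial.weightedHomogeneousComponent (fun _ => 1) e B)) ∧ (n ≤ e → p x = 0) := by
      intro x
      refine coeff_unique_hom (a := fun j => MvPolynomial.eval (fun i => crd W i x)
        (MvPolynomial.weightedHomogeneousComponent (fun _ => 1) j B)) fun t => ?_
      rw [← hh t x, hB]
      conv_rhs => rw [hn]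
      rw [map_sum]
      refine Finset.sum_congr rfl fun j _ => ?_
      exact (isHom_component _
        (MvPolynomial.weightedHomogeneousComponent_isWeightedHomogeneous _ _) t x).symm
    by_cases he : e < n
    · refine ⟨MvPolynomial.weightedHomogeneousComponent (fun _ => 1) e B,
        MvPolynomial.weightedHomogeneousComponent_isWeightedHomogeneous _ _, ?_⟩
      ext x
      rw [hev, (hx x).1 he]
    · refine ⟨0, Submodule.zero_mem _, ?_⟩
      ext x
      rw [(hx x).2 (not_lt.1 he)]; simp
  haveI : FiniteDimensional ℝ (Submodule.map ev (MvPolynomial.weightedHomogeneousSubmodule ℝ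
    (fun _ : Fin (Module.finrank ℝ W) => 1) e)) := Module.Finite.iff_fg.2 hfg2
  exact Submodule.finiteDimensional_of_le hle

/-- Stone–Weierstrass for polynomial functions. -/
lemma poly_approx {K : Set W} (hK : IsCompact K) {u : W → ℝ} (hu : Continuous u) {ε : ℝ}
    (hε : 0 < ε) : ∃ h ∈ Poly W, ∀ x ∈ K, |h x - u x| < ε := by
  haveI : CompactSpace K := isCompact_iff_compactSpace.1 hK
  let A : Subalgebra ℝ C(K, ℝ) :=
    { carrier := {c | ∃ h ∈ Poly W, ∀ x : K, c x = h x}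
      mul_mem' := by
        rintro a b ⟨h, hh, h1⟩ ⟨k, hk, h2⟩
        exact ⟨_, poly_mul hh hk, fun x => by simp [h1, h2]⟩
      add_mem' := by
        rintro a b ⟨h, hh, h1⟩ ⟨k, hk, h2⟩
        exact ⟨_, poly_add hh hk, fun x => by simp [h1, h2]⟩
      algebraMap_mem' := fun r => ⟨_, poly_const r, fun x => by simp⟩ }
  have hsep : A.SeparatesPoints := by
    intro x y hxy
    have hne : (x : W) ≠ y := fun h => hxy (Subtype.ext h)
    obtain ⟨f, hf⟩ := SeparatingDual.exists_separating_of_ne (R := ℝ) hne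
    refine ⟨fun z => f z, ⟨⟨fun z : K => f z, by fun_prop⟩, ⟨f, poly_clm f, fun _ => rfl⟩, rfl⟩, hf⟩
  obtain ⟨g, hg⟩ := ContinuousMap.exists_mem_subalgebra_near_continuous_of_separatesPoints A hsep
    (fun x : K => u x) (by fun_prop) ε hε
  obtain ⟨h, hh, hgh⟩ := g.2
  refine ⟨h, hh, fun x hx => ?_⟩
  have := hg ⟨x, hx⟩
  rw [hgh] at this
  simpa using this

/-- Matrix coefficients expansion. -/
lemma poly_expand {p : W → ℝ} (hp : p ∈ Poly W) :
    ∃ (r : ℕ) (c : Fin r → (W →L[ℝ] W) → ℝ) (b : Fin r → W → ℝ), (∀ i, Continuous (c i)) ∧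
      (∀ i, b i ∈ Poly W) ∧ ∀ T x, p (T x) = ∑ i, c i T * b i x := by
  suffices H : ∃ (ι : Type) (_ : Fintype ι) (c : ι → (W →L[ℝ] W) → ℝ) (b : ι → W → ℝ),
      (∀ i, Continuous (c i)) ∧ (∀ i, b i ∈ Poly W) ∧ ∀ T x, p (T x) = ∑ i, c i T * b i x by
    obtain ⟨ι, _, c, b, hc, hb, h⟩ := H
    let e := (Fintype.equivFin ι).symm
    refine ⟨Fintype.card ι, fun i => c (e i), fun i => b (e i), fun i => hc _, fun i => hb _,
      fun T x => ?_⟩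
    rw [h, ← e.sum_comp]
  induction hp using poly_induction with
  | hl l =>
    refine ⟨Fin (Module.finrank ℝ W), inferInstance, fun i T => l (T (Module.finBasis ℝ W i)),
      fun i => crd W i, fun i => by fun_prop, fun i => poly_clm _, fun T x => ?_⟩
    exact crd_expand (l.comp T) x
  | hc c =>
    exact ⟨Unit, inferInstance, fun _ _ => c, fun _ _ => 1, fun _ => by fun_prop,
      fun _ => poly_const 1, by simp⟩
  | ha p q _ _ h1 h2 =>
    obtain ⟨ι, _, c, b, hc, hb, h⟩ := h1
    obtain ⟨κ, _, c', b', hc', hb', h'⟩ := h2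
    refine ⟨ι ⊕ κ, inferInstance, Sum.elim c c', Sum.elim b b', ?_, ?_, ?_⟩
    · rintro (i | i); exacts [hc i, hc' i]
    · rintro (i | i); exacts [hb i, hb' i]
    · intro T x; simp [h, h']
  | hm p q _ _ h1 h2 =>
    obtain ⟨ι, _, c, b, hc, hb, h⟩ := h1
    obtain ⟨κ, _, c', b', hc', hb', h'⟩ := h2
    refine ⟨ι × κ, inferInstance, fun i T => c i.1 T * c' i.2 T, fun i x => b i.1 x * b' i.2 x,
      ?_, ?_, ?_⟩
    · intro i; exact (hc _).mul (hc' _)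
    · intro i; exact poly_mul (hb _) (hb' _)
    · intro T x
      beta_reduce
      rw [h, h', Finset.sum_mul_sum, Fintype.sum_prod_type]
      refine Finset.sum_congr rfl fun i _ => Finset.sum_congr rfl fun j _ => ?_
      ring

end PolyFin

end Schwarz

namespace Schwarz

open scoped ContDiff Topology

set_option linter.all false
set_option linter.unusedSectionVars false
set_option linter.style.haveILetI false
set_option linter.unusedSimpArgs false

/-! ### Part B: averaging, Hilbert's theorem, separation of orbits -/

section Mean

variable {G : Type} [Group G] [TopologicalSpace G] [IsTopologicalGroup G] [CompactSpace G]

open MeasureTheory in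
lemma exists_mean (G : Type) [Group G] [TopologicalSpace G] [IsTopologicalGroup G]
    [CompactSpace G] : ∃ A : (G → ℝ) → ℝ,
      (∀ φ ψ, Continuous φ → Continuous ψ → A (fun g => φ g + ψ g) = A φ + A ψ) ∧
      (∀ (c : ℝ) φ, A (fun g => c * φ g) = c * A φ) ∧
      (∀ c, A (fun _ => c) = c) ∧
      (∀ φ ψ, Continuous φ → Continuous ψ → (∀ g, φ g ≤ ψ g) → A φ ≤ A ψ) ∧
      (∀ φ h, Continuous φ → A (fun g => φ (g * h)) = A φ) ∧
      (∀ φ, Continuous φ → (∀ g, 0 ≤ φ g) → 0 < φ 1 → 0 < A φ) := by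
  letI : MeasurableSpace G := borel G
  haveI : BorelSpace G := ⟨rfl⟩
  let μ : Measure G := Measure.haarMeasure ⊤
  haveI : IsProbabilityMeasure μ := ⟨by
    have := Measure.haarMeasure_self (K₀ := (⊤ : TopologicalSpace.PositiveCompacts G))
    simpa using this⟩
  have hintegr : ∀ φ : G → ℝ, Continuous φ → Integrable (fun g => φ g⁻¹) μ := fun φ hφ =>
    (hφ.comp continuous_inv).integrable_of_hasCompactSupport (HasCompactSupport.of_compactSpace _)
  refine ⟨fun φ => ∫ g, φ g⁻¹ ∂μ, ?_, ?_, ?_, ?_, ?_, ?_⟩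
  · intro φ ψ hφ hψ
    exact integral_add (hintegr φ hφ) (hintegr ψ hψ)
  · intro c φ
    exact integral_const_mul c _
  · intro c; simp
  · intro φ ψ hφ hψ h
    exact integral_mono (hintegr φ hφ) (hintegr ψ hψ) fun g => h _
  · intro φ h hφ
    have := integral_mul_left_eq_self (μ := μ) (fun g => φ g⁻¹) h⁻¹
    simpa using this
  · intro φ hφ h0 h1
    refine Continuous.integral_pos_of_hasCompactSupport_nonneg_nonzero (x := 1)
      (hφ.comp continuous_inv) (HasCompactSupport.of_compactSpace _) (fun g => h0 _) ?_
    simpa using h1.ne'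

/-- Averaging over the compact group. -/
noncomputable def av (φ : G → ℝ) : ℝ := (exists_mean G).choose φ

lemma av_add {φ ψ : G → ℝ} (h1 : Continuous φ) (h2 : Continuous ψ) :
    av (fun g => φ g + ψ g) = av φ + av ψ := (exists_mean G).choose_spec.1 φ ψ h1 h2

lemma av_cmul (c : ℝ) (φ : G → ℝ) : av (fun g => c * φ g) = c * av φ :=
  (exists_mean G).choose_spec.2.1 c φ

lemma av_mulc (c : ℝ) (φ : G → ℝ) : av (fun g => φ g * c) = av φ * c := by
  rw [mul_comm, ← av_cmul]; simp only [mul_comm]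

lemma av_const (c : ℝ) : av (fun _ : G => c) = c := (exists_mean G).choose_spec.2.2.1 c

lemma av_mono {φ ψ : G → ℝ} (h1 : Continuous φ) (h2 : Continuous ψ) (h : ∀ g, φ g ≤ ψ g) :
    av φ ≤ av ψ := (exists_mean G).choose_spec.2.2.2.1 φ ψ h1 h2 h

lemma av_right {φ : G → ℝ} (h1 : Continuous φ) (h : G) : av (fun g => φ (g * h)) = av φ :=
  (exists_mean G).choose_spec.2.2.2.2.1 φ h h1

lemma av_pos {φ : G → ℝ} (h1 : Continuous φ) (h : ∀ g, 0 ≤ φ g) (h2 : 0 < φ 1) : 0 < av φ :=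
  (exists_mean G).choose_spec.2.2.2.2.2 φ h1 h h2

lemma av_sum {ι : Type*} (s : Finset ι) {φ : ι → G → ℝ} (h : ∀ i ∈ s, Continuous (φ i)) :
    av (fun g => ∑ i ∈ s, φ i g) = ∑ i ∈ s, av (φ i) := by
  classical
  induction s using Finset.induction_on with
  | empty => simpa using av_const (G := G) 0
  | insert a s ha ih =>
    simp only [Finset.sum_insert ha]
    rw [av_add (h a (by simp)) (continuous_finset_sum _ fun i hi => h i (by simp [hi])),
      ih fun i hi => h i (by simp [hi])]

lemma av_sub {φ ψ : G → ℝ} (h1 : Continuous φ) (h2 : Continuous ψ) :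
    av (fun g => φ g - ψ g) = av φ - av ψ := by
  have := av_add h1 (ψ := fun g => (-1) * ψ g) (by fun_prop)
  rw [av_cmul] at this
  have e : (fun g => φ g - ψ g) = fun g => φ g + (-1) * ψ g := by ext; ring
  rw [e, this]; ring

lemma av_abs_le {φ : G → ℝ} (h1 : Continuous φ) {C : ℝ} (h : ∀ g, |φ g| ≤ C) : |av φ| ≤ C := by
  rw [abs_le]
  constructor
  · rw [← av_const (G := G) (-C)]
    exact av_mono (by fun_prop) h1 fun g => (abs_le.1 (h g)).1
  · rw [← av_const (G := G) C]
    exact av_mono h1 (by fun_prop) fun g => (abs_le.1 (h g)).2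

/-- Parametrized averages are continuous. -/
lemma av_continuous {X : Type*} [TopologicalSpace X] {φ : X → G → ℝ}
    (h : Continuous fun q : X × G => φ q.1 q.2) : Continuous fun x => av (φ x) := by
  have hc : ∀ x, Continuous (φ x) := fun x => h.comp (by fun_prop : Continuous fun g => (x, g))
  rw [continuous_iff_continuousAt]
  intro x0
  rw [ContinuousAt, Metric.tendsto_nhds]
  intro ε hε
  have hev : ∀ᶠ x in 𝓝 x0, ∀ g ∈ (Set.univ : Set G), |φ x g - φ x0 g| < ε / 2 := by
    refine isCompact_univ.eventually_forall_of_forall_eventually fun g _ => ?_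
    have h2 : Continuous fun q : X × G => |φ q.1 q.2 - φ x0 q.2| :=
      (h.sub ((hc x0).comp continuous_snd)).abs
    have := h2.tendsto (x0, g)
    simp only [sub_self, abs_zero] at this
    exact this.eventually (gt_mem_nhds (by linarith))
  filter_upwards [hev] with x hx
  rw [Real.dist_eq, ← av_sub (hc x) (hc x0)]
  refine lt_of_le_of_lt (av_abs_le ((hc x).sub (hc x0)) (C := ε / 2) fun g => ?_) (by linarith)
  exact (hx g trivial).le

end Mean

section Action

variable {G : Type} [Group G] [TopologicalSpace G] [IsTopologicalGroup G] [CompactSpace G]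
variable {W : Type} [NormedAddCommGroup W] [InnerProductSpace ℝ W] [FiniteDimensional ℝ W]

/-- Continuity of an orthogonal representation. -/
def CtsRep (ρ : G →* (W →ₗᵢ[ℝ] W)) : Prop := Continuous fun q : G × W => ρ q.1 q.2

/-- Invariant functions. -/
def Inv (ρ : G →* (W →ₗᵢ[ℝ] W)) (f : W → ℝ) : Prop := ∀ g x, f (ρ g x) = f x

variable {ρ : G →* (W →ₗᵢ[ℝ] W)}

lemma rep_mul (g h : G) (x : W) : ρ (g * h) x = ρ g (ρ h x) := by rw [map_mul]; rfl
lemma rep_one (x : W) : ρ 1 x = x := by rw [map_one]; rfl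
lemma rep_inv (g : G) (x : W) : ρ g⁻¹ (ρ g x) = x := by rw [← rep_mul]; simp [rep_one]
lemma rep_inv' (g : G) (x : W) : ρ g (ρ g⁻¹ x) = x := by rw [← rep_mul]; simp [rep_one]

lemma CtsRep.cont (hρ : CtsRep ρ) {X : Type*} [TopologicalSpace X] {a : X → G} {b : X → W}
    (ha : Continuous a) (hb : Continuous b) : Continuous fun x => ρ (a x) (b x) :=
  (show Continuous fun q : G × W => ρ q.1 q.2 from hρ).comp (ha.prodMk hb)

lemma CtsRep.cont_op (hρ : CtsRep ρ) :
    Continuous fun g : G => (ρ g).toContinuousLinearMap := by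
  rw [continuous_clm_apply]
  intro x
  exact hρ.cont continuous_id continuous_const

lemma avg_poly (hρ : CtsRep ρ) {p : W → ℝ} (hp : p ∈ Poly W) :
    (fun x => av (fun g => p (ρ g x))) ∈ Poly W := by
  obtain ⟨r, c, b, hc, hb, h⟩ := poly_expand hp
  have : (fun x => av (fun g => p (ρ g x)))
      = fun x => ∑ i, av (fun g => c i (ρ g).toContinuousLinearMap) * b i x := by
    ext x
    have e : (fun g => p (ρ g x)) = fun g => ∑ i, c i (ρ g).toContinuousLinearMap * b i x := by
      ext g; exact h (ρ g).toContinuousLinearMap x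
    have hcc : ∀ i, Continuous fun g => c i (ρ g).toContinuousLinearMap :=
      fun i => (hc i).comp hρ.cont_op
    rw [e, av_sum _ (φ := fun i g => c i (ρ g).toContinuousLinearMap * b i x)
      fun i _ => (hcc i).mul continuous_const]
    simp only [av_mulc]
  rw [this]
  exact poly_sum _ fun i _ => poly_cmul _ (hb i)

lemma avg_inv (hρ : CtsRep ρ) {p : W → ℝ} (hp : Continuous p) :
    Inv ρ (fun x => av (fun g => p (ρ g x))) := by
  intro h x
  have := av_right (φ := fun g => p (ρ g x)) (hp.comp (hρ.cont continuous_id continuous_const)) h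
  simpa [rep_mul] using this

lemma avg_hom {p : W → ℝ} {e : ℕ} (hp : IsHom e p) :
    IsHom e (fun x => av (fun g => p (ρ g x))) := by
  intro t x
  simp only [map_smul, hp t]
  exact av_cmul _ _

lemma avg_of_inv {p : W → ℝ} (hp : Inv ρ p) (x : W) : av (fun g => p (ρ g x)) = p x := by
  have : (fun g => p (ρ g x)) = fun _ => p x := by ext g; exact hp g x
  rw [this, av_const]

lemma inv_decomp {p : W → ℝ} (hp : p ∈ Poly W) (hi : Inv ρ p) :
    ∃ (n : ℕ) (c : ℕ → W → ℝ), (∀ j, c j ∈ Poly W) ∧ (∀ j, IsHom j (c j)) ∧ (∀ j, Inv ρ (c j)) ∧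
      ∀ x, p x = ∑ j ∈ Finset.range n, c j x := by
  obtain ⟨n, c, hc, hh, hs⟩ := poly_decomp hp
  refine ⟨n, fun j => if j < n then c j else fun _ => 0, fun j => ?_, fun j => ?_, fun j => ?_, ?_⟩
  · dsimp only; split_ifs; exacts [hc j, poly_const 0]
  · dsimp only; split_ifs; exacts [hh j, fun t x => by simp]
  · dsimp only; split_ifs with hj
    · intro g x
      refine coeff_unique (n := n) (a := fun j => c j (ρ g x)) (b := fun j => c j x) (fun t => ?_)
        j hj
      have h1 : ∀ y, ∑ j ∈ Finset.range n, t ^ j * c j y = p (t • y) := by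
        intro y; rw [hs]; exact Finset.sum_congr rfl fun j _ => (hh j t y).symm
      rw [h1, h1, ← map_smul, hi]
    · intro g x; rfl
  · intro x; rw [hs]
    refine Finset.sum_congr rfl fun j hj => ?_
    simp [Finset.mem_range.1 hj]

lemma poly_decomp' {p : W → ℝ} (hp : p ∈ Poly W) :
    ∃ (n : ℕ) (c : ℕ → W → ℝ), (∀ j, c j ∈ Poly W) ∧ (∀ j, IsHom j (c j)) ∧
      ∀ M, n ≤ M → ∀ x, p x = ∑ j ∈ Finset.range M, c j x := by
  obtain ⟨n, c, hc, hh, hs⟩ := poly_decomp hp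
  refine ⟨n, fun j => if j < n then c j else fun _ => 0, fun j => ?_, fun j => ?_, ?_⟩
  · dsimp only; split_ifs; exacts [hc j, poly_const 0]
  · dsimp only; split_ifs; exacts [hh j, fun t x => by simp]
  · intro M hM x; rw [hs]
    rw [← Finset.sum_subset (Finset.range_subset_range.2 hM)]
    · refine Finset.sum_congr rfl fun j hj => ?_
      simp [Finset.mem_range.1 hj]
    · intro j _ hj
      show (if j < n then c j else fun _ => 0) x = 0
      rw [if_neg (by simpa using hj)]

/-- Component of an ideal expression. -/
lemma ideal_component {ι : Type*} [Fintype ι] {t : ι → W → ℝ} {d : ι → ℕ}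
    (hd : ∀ i, IsHom (d i) (t i)) {a : ι → W → ℝ} (ha : ∀ i, a i ∈ Poly W) {p : W → ℝ} {e : ℕ}
    (hp : IsHom e p) (h : ∀ x, p x = ∑ i, a i x * t i x) :
    ∃ b : ι → W → ℝ, (∀ i, b i ∈ Poly W) ∧
      (∀ i, (d i ≤ e → IsHom (e - d i) (b i)) ∧ (¬ d i ≤ e → b i = fun _ => 0)) ∧
      ∀ x, p x = ∑ i, b i x * t i x := by
  choose n c hc hh hs using fun i => poly_decomp' (ha i)
  refine ⟨fun i => if d i ≤ e then c i (e - d i) else fun _ => 0, fun i => ?_, fun i => ⟨?_, ?_⟩,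
    fun x => ?_⟩
  · dsimp only; split_ifs; exacts [hc _ _, poly_const 0]
  · intro h; simp only [h, if_true]; exact hh _ _
  · intro h; simp only [h, if_false]
  · have key := coeff_unique_hom (n := (∑ i, d i) + (∑ i, n i) + e + 1) (e := e) (c := p x)
      (a := fun k => ∑ i, (if d i ≤ k then c i (k - d i) x else 0) * t i x) (fun s => by
        rw [← hp s x, h]
        simp_rw [Finset.mul_sum]
        rw [Finset.sum_comm]
        refine Finset.sum_congr rfl fun i _ => ?_
        have hdi : d i ≤ ∑ i, d i := Finset.single_le_sum (f := d) (fun _ _ => Nat.zero_le _) (Finset.mem_univ i)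
        have hni : n i ≤ ∑ i, n i := Finset.single_le_sum (f := n) (fun _ _ => Nat.zero_le _) (Finset.mem_univ i)
        obtain ⟨M, hM⟩ : ∃ M, (∑ i, d i) + (∑ i, n i) + e + 1 = d i + M :=
          ⟨_, (Nat.add_sub_cancel' (by omega)).symm⟩
        rw [hM, Finset.sum_range_add, hs i M (by omega) (s • x), hd i s x, Finset.sum_mul]
        rw [Finset.sum_eq_zero, zero_add]
        · refine Finset.sum_congr rfl fun j _ => ?_
          simp only [le_add_iff_nonneg_right, zero_le, if_true, Nat.add_sub_cancel_left]
          rw [hh i j s x]; ring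
        · intro k hk
          rw [if_neg (by simpa using hk)]; simp)
    rw [key.1 (by omega)]
    refine Finset.sum_congr rfl fun i _ => ?_
    dsimp only
    split_ifs <;> rfl

/-- A homogeneous Hilbert basis, one of whose elements is the squared norm. -/
structure HGen (ρ : G →* (W →ₗᵢ[ℝ] W)) {ι : Type} (σ : ι → W → ℝ) (d : ι → ℕ) (i0 : ι) : Prop where
  poly : ∀ i, σ i ∈ Poly W
  inv : ∀ i, Inv ρ (σ i)
  hom : ∀ i, IsHom (d i) (σ i)
  pos : ∀ i, 1 ≤ d i
  gen : ∀ p, p ∈ Poly W → Inv ρ p →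
    ∃ B : MvPolynomial ι ℝ, ∀ x, p x = MvPolynomial.eval (fun i => σ i x) B
  sq : ∀ x, σ i0 x = ‖x‖ ^ 2
  d0 : d i0 = 2

lemma norm_sq_poly : (fun x : W => ‖x‖ ^ 2) ∈ Poly W := by
  have : (fun x : W => ‖x‖ ^ 2) = fun x => ∑ i, (innerSL ℝ (stdOrthonormalBasis ℝ W i)) x *
      (innerSL ℝ (stdOrthonormalBasis ℝ W i)) x := by
    ext x
    rw [← (stdOrthonormalBasis ℝ W).sum_sq_norm_inner_right x]
    refine Finset.sum_congr rfl fun i _ => ?_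
    simp [sq]
  rw [this]
  exact poly_sum _ fun i _ => poly_mul (poly_clm _) (poly_clm _)

lemma hilbert (hρ : CtsRep ρ) : ∃ (ι : Type) (_ : Fintype ι) (σ : ι → W → ℝ) (d : ι → ℕ) (i0 : ι),
    HGen ρ σ d i0 := by
  classical
  let S : Set (Poly W) := {p | Inv ρ p ∧ ∃ e, 1 ≤ e ∧ IsHom e (p : W → ℝ)}
  have hfg : (Submodule.span (Poly W) S).FG := IsNoetherian.noetherian _
  obtain ⟨T, hTS, hT⟩ := (Submodule.fg_span_iff_fg_span_finset_subset S).1 hfg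
  choose d hd1 hd2 using fun t : T => (hTS t.2).2
  have hmem : ∀ e : ℕ, ∀ p ∈ Poly W, Inv ρ p → IsHom e p → ∃ B : MvPolynomial (Option T) ℝ,
      ∀ x, p x = MvPolynomial.eval (fun i => (Option.elim i (fun x => ‖x‖ ^ 2)
        (fun t => (t.1 : W → ℝ)) : W → ℝ) x) B := by
    intro e
    induction e using Nat.strong_induction_on with
    | _ e ih =>
    intro p hp hi hh
    rcases Nat.eq_zero_or_pos e with he | he
    · subst he
      refine ⟨MvPolynomial.C (p 0), fun x => ?_⟩
      have := hh 0 x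
      simp at this
      simp [this]
    · have h1 : (⟨p, hp⟩ : Poly W) ∈ Submodule.span (Poly W) (T : Set (Poly W)) := by
        rw [← hT]; exact Submodule.subset_span ⟨hi, e, he, hh⟩
      obtain ⟨a, ha⟩ := (Submodule.mem_span_finset' (s := T)).1 h1
      have ha' : ∀ x, p x = ∑ t : T, (a t : W → ℝ) x * (t.1 : W → ℝ) x := by
        intro x
        have := congrArg (fun q : Poly W => (q : W → ℝ) x) ha
        simp only at this
        rw [← this]
        simp
      obtain ⟨b, hb1, hb2, hb3⟩ := ideal_component (t := fun t : T => (t.1 : W → ℝ)) (d := d) hd2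
        (fun t => (a t).2) hh ha'
      have hb4 : ∀ x, p x = ∑ t : T, av (fun g => b t (ρ g x)) * (t.1 : W → ℝ) x := by
        intro x
        rw [← avg_of_inv hi x]
        have hcb : ∀ t, Continuous fun g => b t (ρ g x) := fun t =>
          (poly_continuous (hb1 t)).comp (hρ.cont continuous_id continuous_const)
        have e1 : (fun g => p (ρ g x)) = fun g => ∑ t : T, b t (ρ g x) * (t.1 : W → ℝ) x := by
          ext g; rw [hb3]
          refine Finset.sum_congr rfl fun t _ => ?_
          rw [(hTS t.2).1 g x]
        rw [e1, av_sum _ (φ := fun t g => b t (ρ g x) * (t.1 : W → ℝ) x)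
          fun t _ => (hcb t).mul continuous_const]
        simp only [av_mulc]
      have hB : ∀ t : T, ∃ B : MvPolynomial (Option T) ℝ,
          ∀ x, av (fun g => b t (ρ g x)) = MvPolynomial.eval (fun i => (Option.elim i
            (fun x => ‖x‖ ^ 2) (fun t => (t.1 : W → ℝ)) : W → ℝ) x) B := by
        intro t
        by_cases hte : d t ≤ e
        · exact ih (e - d t) (by have := hd1 t; omega) _ (avg_poly hρ (hb1 t))
            (avg_inv hρ (poly_continuous (hb1 t))) (avg_hom ((hb2 t).1 hte))
        · refine ⟨0, fun x => ?_⟩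
          rw [(hb2 t).2 hte]; simp [av_const]
      choose B hB using hB
      refine ⟨∑ t : T, B t * MvPolynomial.X (some t), fun x => ?_⟩
      rw [hb4, map_sum]
      refine Finset.sum_congr rfl fun t _ => ?_
      rw [hB]; simp
  refine ⟨Option T, inferInstance, fun i => Option.elim i (fun x => ‖x‖ ^ 2)
        (fun t => (t.1 : W → ℝ)), fun i => Option.elim i 2 d, none, ?_, ?_, ?_, ?_, ?_, ?_, ?_⟩
  · rintro (_ | t)
    · exact norm_sq_poly
    · exact t.1.2
  · rintro (_ | t)
    · intro g x; simp
    · exact (hTS t.2).1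
  · rintro (_ | t)
    · intro s x; simp [norm_smul, mul_pow]
    · exact hd2 t
  · rintro (_ | t)
    · simp
    · exact hd1 t
  · intro p hp hi
    obtain ⟨n, c, hc, hh, hci, hs⟩ := inv_decomp hp hi
    choose B hB using fun j => hmem j (c j) (hc j) (hci j) (hh j)
    refine ⟨∑ j ∈ Finset.range n, B j, fun x => ?_⟩
    rw [hs, map_sum]
    exact Finset.sum_congr rfl fun j _ => hB j x
  · intro x; rfl
  · rfl

/-- Homogeneous invariants are weighted homogeneous in the generators. -/
lemma HGen.gen_hom {ι : Type} [Fintype ι] {σ : ι → W → ℝ} {d : ι → ℕ} {i0 : ι} (H : HGen ρ σ d i0)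
    {p : W → ℝ} (hp : p ∈ Poly W) (hi : Inv ρ p) {e : ℕ} (he : IsHom e p) :
    ∃ B : MvPolynomial ι ℝ, MvPolynomial.IsWeightedHomogeneous d B e ∧
      ∀ x, p x = MvPolynomial.eval (fun i => σ i x) B := by
  obtain ⟨B, hB⟩ := H.gen p hp hi
  obtain ⟨n, hn⟩ := weighted_decomp d B
  have hx : ∀ x, (e < n → p x = MvPolynomial.eval (fun i => σ i x)
      (MvPolynomial.weightedHomogeneousComponent d e B)) ∧ (n ≤ e → p x = 0) := by
    intro x
    refine coeff_unique_hom (a := fun j => MvPolynomial.eval (fun i => σ i x)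
      (MvPolynomial.weightedHomogeneousComponent d j B)) fun t => ?_
    rw [← he t x, hB]
    conv_rhs => rw [hn]
    rw [map_sum]
    refine Finset.sum_congr rfl fun j _ => ?_
    simp only [H.hom _ t x]
    exact (weighted_eval
      (MvPolynomial.weightedHomogeneousComponent_isWeightedHomogeneous _ _) t _).symm
  by_cases he : e < n
  · exact ⟨_, MvPolynomial.weightedHomogeneousComponent_isWeightedHomogeneous e B,
      fun x => (hx x).1 he⟩
  · refine ⟨0, MvPolynomial.isWeightedHomogeneous_zero _ _ _, fun x => ?_⟩
    rw [(hx x).2 (not_lt.1 he)]; simp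

lemma HGen.continuous {ι : Type} [Fintype ι] {σ : ι → W → ℝ} {d : ι → ℕ} {i0 : ι}
    (H : HGen ρ σ d i0) : Continuous fun x i => σ i x :=
  continuous_pi fun i => poly_continuous (H.poly i)

lemma HGen.proper {ι : Type} [Fintype ι] {σ : ι → W → ℝ} {d : ι → ℕ} {i0 : ι}
    (H : HGen ρ σ d i0) : IsProperMap fun x i => σ i x := by
  rw [isProperMap_iff_isCompact_preimage]
  refine ⟨H.continuous, fun K hK => ?_⟩
  refine Metric.isCompact_of_isClosed_isBounded (hK.isClosed.preimage H.continuous) ?_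
  obtain ⟨C, hC⟩ := hK.isBounded.exists_norm_le
  refine isBounded_iff_forall_norm_le.2 ⟨C + 1, fun x hx => ?_⟩
  have h1 := (norm_le_pi_norm (fun i => σ i x) i0).trans (hC _ hx)
  rw [H.sq, Real.norm_eq_abs, abs_of_nonneg (by positivity)] at h1
  nlinarith [sq_nonneg (‖x‖ - 1), norm_nonneg x]

lemma orbit_sep (hρ : CtsRep ρ) {x θ : W} (h : ∀ g, ρ g x ≠ θ) :
    ∃ P ∈ Poly W, Inv ρ P ∧ P x ≠ P θ := by
  have hoc : ∀ y : W, IsCompact (Set.range fun g => ρ g y) := fun y =>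
    isCompact_range (hρ.cont continuous_id continuous_const)
  let O := Set.range fun g => ρ g θ
  have hOne : O.Nonempty := ⟨θ, 1, rep_one θ⟩
  have hginf : ∀ g y, Metric.infDist (ρ g y) O = Metric.infDist y O := by
    have hle : ∀ g y, Metric.infDist (ρ g y) O ≤ Metric.infDist y O := by
      intro g y
      refine (Metric.le_infDist hOne).2 ?_
      rintro _ ⟨k, rfl⟩
      refine (Metric.infDist_le_dist_of_mem (s := O) (y := ρ g (ρ k θ))
        (⟨g * k, rep_mul _ _ _⟩ : _ ∈ Set.range fun g => ρ g θ)).trans ?_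
      exact ((ρ g).isometry.dist_eq _ _).le
    intro g y
    refine le_antisymm (hle g y) ?_
    have := hle g⁻¹ (ρ g y)
    rwa [rep_inv] at this
  set c := Metric.infDist x O with hc
  have hcpos : 0 < c := by
    refine ((hoc θ).isClosed.notMem_iff_infDist_pos hOne).1 ?_
    rintro ⟨g, hg⟩
    refine h g⁻¹ ?_
    dsimp only at hg
    rw [← hg, rep_inv]
  obtain ⟨q, hq, hqa⟩ := poly_approx ((hoc x).union (hoc θ))
    (Metric.continuous_infDist_pt O) (ε := c / 3) (by linarith)
  have hqc : ∀ y, Continuous fun g => q (ρ g y) := fun y =>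
    (poly_continuous hq).comp (hρ.cont continuous_id continuous_const)
  refine ⟨_, avg_poly hρ hq, avg_inv hρ (poly_continuous hq), ?_⟩
  have h1 : |av (fun g => q (ρ g x) - c)| ≤ c / 3 := by
    refine av_abs_le ((hqc x).sub continuous_const) fun g => ?_
    have := hqa (ρ g x) (Or.inl ⟨g, rfl⟩)
    rw [hginf] at this
    exact this.le
  have h2 : |av (fun g => q (ρ g θ))| ≤ c / 3 := by
    refine av_abs_le (hqc θ) fun g => ?_
    have := hqa (ρ g θ) (Or.inr ⟨g, rfl⟩)
    rw [hginf, Metric.infDist_zero_of_mem (s := O) (⟨1, rep_one θ⟩ : _ ∈ Set.range fun g => ρ g θ), sub_zero] at this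
    exact this.le
  rw [av_sub (hqc x) continuous_const, av_const] at h1
  intro heq
  rw [heq] at h1
  have := abs_le.1 h1
  have := abs_le.1 h2
  linarith

lemma HGen.sep (hρ : CtsRep ρ) {ι : Type} [Fintype ι] {σ : ι → W → ℝ} {d : ι → ℕ} {i0 : ι}
    (H : HGen ρ σ d i0) {x θ : W} (h : ∀ i, σ i x = σ i θ) : ∃ g, ρ g x = θ := by
  by_contra hcon
  push Not at hcon
  obtain ⟨P, hP, hPi, hne⟩ := orbit_sep hρ hcon
  obtain ⟨B, hB⟩ := H.gen P hP hPi
  apply hne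
  rw [hB, hB]
  simp only [h]

lemma HGen.near (hρ : CtsRep ρ) {ι : Type} [Fintype ι] {σ : ι → W → ℝ} {d : ι → ℕ} {i0 : ι}
    (H : HGen ρ σ d i0) (θ : W) {ε : ℝ} (hε : 0 < ε) :
    ∀ᶠ y in 𝓝 (fun i => σ i θ), ∀ x, (fun i => σ i x) = y → ∃ g, ‖ρ g x - θ‖ < ε := by
  let C : Set W := ⋂ g, {x | ε ≤ ‖ρ g x - θ‖}
  have hC : IsClosed C := isClosed_iInter fun g =>
    isClosed_le continuous_const
      (((hρ.cont continuous_const continuous_id).sub continuous_const).norm)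
  have hcl := H.proper.isClosedMap C hC
  have hnot : (fun i => σ i θ) ∈ ((fun x i => σ i x) '' C)ᶜ := by
    rintro ⟨x, hx, hxe⟩
    obtain ⟨g, hg⟩ := H.sep hρ (fun i => congrFun hxe i)
    have := Set.mem_iInter.1 hx g
    simp only [Set.mem_setOf_eq, hg, sub_self, norm_zero] at this
    linarith
  filter_upwards [hcl.isOpen_compl.mem_nhds hnot] with y hy x hxy
  by_contra hcon
  push Not at hcon
  exact hy ⟨x, Set.mem_iInter.2 hcon, hxy⟩

end Action

end Schwarz

namespace Schwarz

open scoped ContDiff Topology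

set_option linter.all false
set_option linter.unusedSectionVars false
set_option linter.style.haveILetI false
set_option linter.unusedSimpArgs false

/-! ### Part C: slices -/

section Slice

variable {G : Type} [Group G] [TopologicalSpace G] [IsTopologicalGroup G] [CompactSpace G]
variable {W : Type} [NormedAddCommGroup W] [InnerProductSpace ℝ W] [FiniteDimensional ℝ W]
variable (ρ : G →* (W →ₗᵢ[ℝ] W)) (θ : W)

/-- The ideal of an orbit. -/
def orbIdeal : Ideal (Poly W) where
  carrier := {p | ∀ g, (p : W → ℝ) (ρ g θ) = 0}
  add_mem' := by intro a b ha hb g; simp [ha g, hb g]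
  zero_mem' := by intro g; simp
  smul_mem' := by intro c a ha g; simp [ha g]

/-- The normal space of the orbit. -/
def nrm : Submodule ℝ W where
  carrier := {n | ∃ p ∈ orbIdeal ρ θ, ∀ w, fderiv ℝ (p : W → ℝ) θ w = inner ℝ n w}
  add_mem' := by
    rintro a b ⟨p, hp, h1⟩ ⟨q, hq, h2⟩
    refine ⟨p + q, (orbIdeal ρ θ).add_mem hp hq, fun w => ?_⟩
    have : ((p + q : Poly W) : W → ℝ) = fun x => (p : W → ℝ) x + (q : W → ℝ) x := by ext; simp
    rw [this, fderiv_fun_add (poly_differentiable p.2 _) (poly_differentiable q.2 _), inner_add_left,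
      ← h1, ← h2]; rfl
  zero_mem' := by
    refine ⟨0, (orbIdeal ρ θ).zero_mem, fun w => ?_⟩
    have : ((0 : Poly W) : W → ℝ) = fun x => 0 := by ext; simp
    rw [this]; simp
  smul_mem' := by
    rintro c a ⟨p, hp, h1⟩
    refine ⟨c • p, ?_, fun w => ?_⟩
    · intro g; simp [hp g]
    · have : ((c • p : Poly W) : W → ℝ) = fun x => c * (p : W → ℝ) x := by ext; simp
      rw [this, fderiv_const_mul (poly_differentiable p.2 _), real_inner_smul_left, ← h1]; rfl

variable {ρ θ}

lemma orbIdeal_trans {p : Poly W} (hp : p ∈ orbIdeal ρ θ) (g : G) : ∃ q ∈ orbIdeal ρ θ,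
    (∀ x, (q : W → ℝ) x = (p : W → ℝ) (ρ g x)) ∧
    ∀ x w, fderiv ℝ (q : W → ℝ) x w = fderiv ℝ (p : W → ℝ) (ρ g x) (ρ g w) := by
  refine ⟨⟨_, poly_comp_clm (ρ g).toContinuousLinearMap p.2⟩, ?_, fun x => rfl, fun x w => ?_⟩
  · intro h
    have := hp (g * h)
    rw [rep_mul] at this
    exact this
  · have h1 : HasFDerivAt (fun x => (p : W → ℝ) ((ρ g).toContinuousLinearMap x))
        ((fderiv ℝ (p : W → ℝ) (ρ g x)).comp (ρ g).toContinuousLinearMap) x :=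
      HasFDerivAt.comp x (poly_differentiable p.2 (ρ g x)).hasFDerivAt
        (ρ g).toContinuousLinearMap.hasFDerivAt
    rw [h1.fderiv]; rfl

lemma orbIdeal_zero (hρ : CtsRep ρ) {x : W} (h : ∀ p ∈ orbIdeal ρ θ, (p : W → ℝ) x = 0) :
    ∃ g, ρ g θ = x := by
  by_contra hcon
  push Not at hcon
  obtain ⟨P, hP, hPi, hne⟩ := orbit_sep hρ hcon
  have := h ⟨_, poly_sub hP (poly_const (P θ))⟩ (fun g => by simp [hPi g θ])
  simp only [sub_eq_zero] at this
  exact hne this.symm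

lemma nrm_grad {p : Poly W} (hp : p ∈ orbIdeal ρ θ) :
    ∃ n ∈ nrm ρ θ, ∀ w, fderiv ℝ (p : W → ℝ) θ w = inner ℝ n w := by
  refine ⟨(InnerProductSpace.toDual ℝ W).symm (fderiv ℝ (p : W → ℝ) θ), ⟨p, hp, fun w => ?_⟩,
    fun w => ?_⟩ <;> simp

lemma self_mem_nrm : θ ∈ nrm ρ θ := by
  have h2 : (2 : ℝ)⁻¹ • ((2 : ℝ) • θ) = θ := by simp
  have h3 : (2 : ℝ) • θ ∈ nrm ρ θ := ?_
  · have h4 := (nrm ρ θ).smul_mem (2 : ℝ)⁻¹ h3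
    rwa [h2] at h4
  refine ⟨⟨_, poly_sub norm_sq_poly (poly_const (‖θ‖ ^ 2))⟩, ?_, fun w => ?_⟩
  · intro g; simp
  · simp only [fderiv_sub_const]
    have := (hasStrictFDerivAt_norm_sq θ).hasFDerivAt
    rw [this.fderiv, real_inner_smul_left]
    simp [two_smul]; ring

lemma nrm_stable {l : G} (hl : ρ l θ = θ) {n : W} (hn : n ∈ nrm ρ θ) : ρ l n ∈ nrm ρ θ := by
  obtain ⟨p, hp, h⟩ := hn
  obtain ⟨q, hq, -, hq2⟩ := orbIdeal_trans hp l⁻¹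
  have hl' : ρ l⁻¹ θ = θ := by
    conv_lhs => rw [← hl]
    rw [rep_inv]
  refine ⟨q, hq, fun w => ?_⟩
  rw [hq2, hl', h, ← (ρ l).inner_map_map, rep_inv']

/-- Evaluation ring homomorphism. -/
def evP (y : W) : Poly W →+* ℝ := (Pi.evalRingHom (fun _ : W => ℝ) y).comp (Poly W).val.toRingHom

lemma evP_apply (y : W) (p : Poly W) : evP y p = (p : W → ℝ) y := rfl

/-- The polynomial vector field tangent to the orbit. -/
lemma exists_field (hρ : CtsRep ρ) {w : W} (hw : w ∈ (nrm ρ θ)ᗮ) :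
    ∃ V : W → W, ContDiff ℝ 1 V ∧ V θ = w ∧
      ∀ p ∈ orbIdeal ρ θ, ∃ q ∈ orbIdeal ρ θ, ∀ y, (q : W → ℝ) y = fderiv ℝ (p : W → ℝ) y (V y) := by
  classical
  let b := stdOrthonormalBasis ℝ (nrm ρ θ)
  choose v hv hvb using fun i => (b i).2
  let M : Matrix (Fin (Module.finrank ℝ (nrm ρ θ))) (Fin (Module.finrank ℝ (nrm ρ θ))) (Poly W) :=
    fun i j => ⟨_, poly_fderiv (v i).2 (b j : W)⟩
  let Dw : Fin (Module.finrank ℝ (nrm ρ θ)) → Poly W := fun i => ⟨_, poly_fderiv (v i).2 w⟩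
  let a := M.adjugate.mulVec Dw
  let V : W → W := fun y => (M.det : W → ℝ) y • ((M.det : W → ℝ) y • w -
    ∑ j, (a j : W → ℝ) y • (b j : W))
  have hMθ : M.map (evP θ) = 1 := by
    ext i j
    show fderiv ℝ (v i : W → ℝ) θ (b j : W) = _
    rw [hvb]
    have := (orthonormal_iff_ite.1 b.orthonormal) i j
    rw [Submodule.coe_inner] at this
    rw [this, Matrix.one_apply]
  have hdet : ∀ y, (M.det : W → ℝ) y = (M.map (evP y)).det := by
    intro y
    have := RingHom.map_det (evP y) M
    exact this
  have hMa : ∀ y i, ∑ j, fderiv ℝ (v i : W → ℝ) y (b j : W) * (a j : W → ℝ) y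
      = (M.det : W → ℝ) y * fderiv ℝ (v i : W → ℝ) y w := by
    intro y i
    have h1 : M.mulVec a = M.det • Dw := by
      simp only [a]
      rw [Matrix.mulVec_mulVec, Matrix.mul_adjugate, Matrix.smul_mulVec, Matrix.one_mulVec]
    have h2 := congrArg (evP y) (congrFun h1 i)
    simp only [Matrix.mulVec, dotProduct, map_sum, map_mul, Pi.smul_apply, smul_eq_mul] at h2
    exact h2
  refine ⟨V, ?_, ?_, ?_⟩
  · have h1 : ContDiff ℝ 1 (M.det : W → ℝ) := poly_contDiff M.det.2
    have h2 : ∀ j, ContDiff ℝ 1 (a j : W → ℝ) := fun j => poly_contDiff (a j).2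
    exact h1.smul ((h1.smul contDiff_const).sub
      (ContDiff.sum fun j _ => (h2 j).smul contDiff_const))
  · have h1 : (M.det : W → ℝ) θ = 1 := by rw [hdet, hMθ]; simp
    have h2 : ∀ j, (a j : W → ℝ) θ = 0 := by
      intro j
      have := hMa θ j
      have h3 : ∀ i, fderiv ℝ (v j : W → ℝ) θ (b i : W) = (1 : Matrix _ _ ℝ) j i := by
        intro i
        exact congrFun (congrFun hMθ j) i
      simp only [h3, Matrix.one_apply] at this
      simp only [ite_mul, one_mul, zero_mul, Finset.sum_ite_eq, Finset.mem_univ, if_true] at this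
      rw [this, h1, hvb, (Submodule.mem_orthogonal _ _).1 hw _ (b j).2]; simp
    simp only [V, h1, h2]; simp
  · intro p hp
    have hpV : ∀ y, fderiv ℝ (p : W → ℝ) y (V y) = (M.det : W → ℝ) y * ((M.det : W → ℝ) y *
        fderiv ℝ (p : W → ℝ) y w - ∑ j, (a j : W → ℝ) y * fderiv ℝ (p : W → ℝ) y (b j : W)) := by
      intro y; simp [V]
    refine ⟨⟨fun y => fderiv ℝ (p : W → ℝ) y (V y), ?_⟩, ?_, fun y => rfl⟩
    · simp only [hpV]
      exact poly_mul M.det.2 (poly_sub (poly_mul M.det.2 (poly_fderiv p.2 _))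
        (poly_sum _ fun j _ => poly_mul (a j).2 (poly_fderiv p.2 _)))
    · intro g
      show fderiv ℝ (p : W → ℝ) (ρ g θ) (V (ρ g θ)) = 0
      set y := ρ g θ with hy
      by_cases hdy : (M.det : W → ℝ) y = 0
      · rw [hpV, hdy]; simp
      · -- gradients of the translates
        have htr : ∀ p ∈ orbIdeal ρ θ, ∃ n ∈ nrm ρ θ, ∀ u, fderiv ℝ (p : W → ℝ) y u = inner ℝ n (ρ g⁻¹ u) := by
          intro p hp
          obtain ⟨q, hq, -, hq2⟩ := orbIdeal_trans hp g
          obtain ⟨n, hn, hn2⟩ := nrm_grad hq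
          refine ⟨n, hn, fun u => ?_⟩
          rw [← hn2, hq2, rep_inv']
        choose n hn hn2 using fun i => htr (v i) (hv i)
        let n' : Fin (Module.finrank ℝ (nrm ρ θ)) → nrm ρ θ := fun i => ⟨n i, hn i⟩
        have hli : LinearIndependent ℝ n' := by
          rw [Fintype.linearIndependent_iff]
          intro c hc
          have h0 : Matrix.vecMul c (M.map (evP y)) = 0 := by
            ext j
            show ∑ i, c i * fderiv ℝ (v i : W → ℝ) y (b j : W) = 0
            simp only [hn2]
            have h1 := congrArg (fun z : nrm ρ θ => inner ℝ (z : W) (ρ g⁻¹ (b j : W))) hc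
            simpa [n', sum_inner, real_inner_smul_left] using h1
          have := Matrix.eq_zero_of_vecMul_eq_zero (by rw [← hdet]; exact hdy) h0
          exact fun i => congrFun this i
        have hspan := hli.span_eq_top_of_card_eq_finrank' (by simp)
        obtain ⟨m, hm, hm2⟩ := htr p hp
        rw [hm2]
        have hvi : ∀ i, inner ℝ (n i) (ρ g⁻¹ (V y)) = 0 := by
          intro i
          rw [← hn2]
          have := hMa y i
          have e : fderiv ℝ (v i : W → ℝ) y (V y) = (M.det : W → ℝ) y * ((M.det : W → ℝ) y *
            fderiv ℝ (v i : W → ℝ) y w - ∑ j, fderiv ℝ (v i : W → ℝ) y (b j : W) * (a j : W → ℝ) y) := by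
              simp [V, mul_comm]
          rw [e, this]; simp
        have hmem : (⟨m, hm⟩ : nrm ρ θ) ∈ Submodule.span ℝ (Set.range n') := by rw [hspan]; trivial
        obtain ⟨c, hc⟩ := (Submodule.mem_span_range_iff_exists_fun ℝ).1 hmem
        have h1 := congrArg (fun z : nrm ρ θ => inner ℝ (z : W) (ρ g⁻¹ (V y))) hc
        simp only [AddSubmonoidClass.coe_finset_sum, Submodule.coe_smul, sum_inner, real_inner_smul_left, n', hvi] at h1
        simpa using h1.symm

lemma exists_curve (hρ : CtsRep ρ) {w : W} (hw : w ∈ (nrm ρ θ)ᗮ) :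
    ∃ c : ℝ → W, c 0 = θ ∧ HasDerivAt c w 0 ∧ ∃ ε > 0, ∀ t ∈ Set.Icc (0 : ℝ) ε, ∃ g, ρ g θ = c t := by
  obtain ⟨V, hV, hVθ, hVI⟩ := exists_field hρ hw
  obtain ⟨c, hc0, ε, hε, hc⟩ :=
    (hV.contDiffAt (x := θ)).exists_forall_mem_closedBall_exists_eq_forall_mem_Ioo_hasDerivAt₀ 0
  simp only [zero_sub, zero_add] at hc
  refine ⟨c, hc0, ?_, ε / 2, by linarith, ?_⟩
  · have := hc 0 ⟨by linarith, hε⟩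
    rwa [hc0, hVθ] at this
  · obtain ⟨k, s, hs⟩ := Submodule.fg_iff_exists_fin_generating_family.1
      (IsNoetherian.noetherian (orbIdeal ρ θ))
    have hsI : ∀ i, s i ∈ orbIdeal ρ θ := fun i => by
      rw [← hs]; exact Submodule.subset_span ⟨i, rfl⟩
    choose q hq hqV using fun i => hVI (s i) (hsI i)
    have hqs : ∀ i, ∃ a : Fin k → Poly W, ∑ j, a j • s j = q i := fun i => by
      have : q i ∈ Submodule.span (Poly W) (Set.range s) := by rw [hs]; exact hq i
      exact (Submodule.mem_span_range_iff_exists_fun _).1 this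
    choose a ha using hqs
    have ha' : ∀ i y, fderiv ℝ (s i : W → ℝ) y (V y)
        = ∑ j, (a i j : W → ℝ) y * (s j : W → ℝ) y := by
      intro i y
      rw [← hqV i y, ← ha i]; simp
    have hcc : ContinuousOn c (Set.Icc 0 (ε / 2)) := fun t ht =>
      (hc t ⟨by linarith [ht.1], by linarith [ht.2]⟩).continuousAt.continuousWithinAt
    have hbd : ∃ K, ∀ t ∈ Set.Icc 0 (ε / 2), ∑ i, ∑ j, |(a i j : W → ℝ) (c t)| ≤ K := by
      have h1 : ContinuousOn (fun t => ∑ i, ∑ j, |(a i j : W → ℝ) (c t)|) (Set.Icc 0 (ε / 2)) :=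
        continuousOn_finset_sum _ fun i _ => continuousOn_finset_sum _ fun j _ =>
          ((poly_continuous (a i j).2).comp_continuousOn hcc).abs
      obtain ⟨K, hK⟩ := isCompact_Icc.bddAbove_image h1
      exact ⟨K, fun t ht => hK ⟨t, ht, rfl⟩⟩
    obtain ⟨K, hK⟩ := hbd
    have hzero := eq_zero_of_abs_deriv_le_mul_abs_self_of_eq_zero_right (K := K) (a := 0) (b := ε / 2)
      (f := fun t i => (s i : W → ℝ) (c t))
      (f' := fun t i => fderiv ℝ (s i : W → ℝ) (c t) (V (c t))) ?_ ?_ ?_ ?_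
    · intro t ht
      refine orbIdeal_zero hρ fun p hp => ?_
      rw [← hs] at hp
      obtain ⟨b, hb⟩ := (Submodule.mem_span_range_iff_exists_fun _).1 hp
      rw [← hb]
      have h0 : ∀ i, (s i : W → ℝ) (c t) = 0 := fun i => congrFun (hzero t ht) i
      simp [h0]
    · exact continuousOn_pi.2 fun i => (poly_continuous (s i).2).comp_continuousOn hcc
    · intro t ht
      refine HasDerivAt.hasDerivWithinAt (hasDerivAt_pi.2 fun i => ?_)
      exact (poly_differentiable (s i).2 (c t)).hasFDerivAt.comp_hasDerivAt t
        (hc t ⟨by linarith [ht.1], by linarith [ht.2]⟩)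
    · ext i
      have := hsI i 1
      rw [rep_one] at this
      rw [hc0]; exact this
    · intro t ht
      have hK0 : 0 ≤ K := le_trans (by positivity) (hK t ⟨ht.1, ht.2.le⟩)
      refine (pi_norm_le_iff_of_nonneg (by positivity)).2 fun i => ?_
      rw [ha']
      refine (norm_sum_le _ _).trans ?_
      calc ∑ j, ‖(a i j : W → ℝ) (c t) * (s j : W → ℝ) (c t)‖
          ≤ ∑ j, |(a i j : W → ℝ) (c t)| * ‖fun i => (s i : W → ℝ) (c t)‖ := by
            refine Finset.sum_le_sum fun j _ => ?_
            rw [norm_mul]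
            gcongr
            · exact le_of_eq (Real.norm_eq_abs _)
            · exact norm_le_pi_norm (fun i => (s i : W → ℝ) (c t)) j
        _ = (∑ j, |(a i j : W → ℝ) (c t)|) * ‖fun i => (s i : W → ℝ) (c t)‖ := by
            rw [Finset.sum_mul]
        _ ≤ K * ‖fun i => (s i : W → ℝ) (c t)‖ := by
            gcongr
            refine le_trans ?_ (hK t ⟨ht.1, ht.2.le⟩)
            exact Finset.single_le_sum (f := fun i => ∑ j, |(a i j : W → ℝ) (c t)|)
              (fun i _ => by positivity) (Finset.mem_univ i)

lemma slice (hρ : CtsRep ρ) (x : W) :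
    ∃ g, ρ g x - θ ∈ nrm ρ θ ∧ ∀ h, ‖ρ g x - θ‖ ≤ ‖ρ h x - θ‖ := by
  have hcont : Continuous fun g => ‖ρ g x - θ‖ :=
    ((hρ.cont continuous_id continuous_const).sub continuous_const).norm
  obtain ⟨g, -, hg⟩ := isCompact_univ.exists_isMinOn (Set.univ_nonempty (α := G)) hcont.continuousOn
  have hmin : ∀ h, ‖ρ g x - θ‖ ≤ ‖ρ h x - θ‖ := fun h => hg (Set.mem_univ h)
  refine ⟨g, ?_, hmin⟩
  set n := ρ g x - θ with hn
  have key : ∀ w ∈ (nrm ρ θ)ᗮ, inner ℝ n w ≤ 0 := by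
    intro w hw
    obtain ⟨c, hc0, hc1, ε, hε, hc2⟩ := exists_curve hρ hw
    have hd : HasDerivAt (fun t => ‖n - (c t - θ)‖ ^ 2) (2 * inner ℝ (n - (c 0 - θ)) (-w)) 0 := by
      have := ((hc1.sub_const θ).const_sub n).norm_sq
      exact this
    have ht := hd.tendsto_slope_zero_right
    have h0 : 0 ≤ 2 * inner ℝ (n - (c 0 - θ)) (-w) := by
      refine ge_of_tendsto ht ?_
      have hev : ∀ᶠ t in 𝓝[>] (0 : ℝ), t ∈ Set.Ioc 0 ε := Ioc_mem_nhdsGT hε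
      filter_upwards [hev] with t ht
      obtain ⟨h, hh⟩ := hc2 t ⟨ht.1.le, ht.2⟩
      have h1 : ‖n - (c 0 - θ)‖ ≤ ‖n - (c t - θ)‖ := by
        rw [hc0, ← hh, hn]
        have := hmin (h⁻¹ * g)
        have e : ‖ρ (h⁻¹ * g) x - θ‖ = ‖ρ g x - ρ h θ‖ := by
          rw [← (ρ h).norm_map, map_sub, rep_mul, rep_inv']
        rw [e] at this
        simpa using this
      have h2 : ‖n - (c 0 - θ)‖ ^ 2 ≤ ‖n - (c t - θ)‖ ^ 2 := by gcongr
      have : 0 ≤ t⁻¹ := inv_nonneg.2 ht.1.le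
      simp only [zero_add, smul_eq_mul]
      exact mul_nonneg this (by linarith)
    rw [hc0] at h0
    simp at h0
    linarith
  rw [← Submodule.orthogonal_orthogonal (nrm ρ θ), Submodule.mem_orthogonal]
  intro w hw
  have h1 := key w hw
  have h2 := key (-w) (Submodule.neg_mem _ hw)
  rw [inner_neg_right] at h2
  rw [real_inner_comm]
  linarith

end Slice

end Schwarz

namespace Schwarz

open scoped ContDiff Topology

set_option linter.all false
set_option linter.unusedSectionVars false
set_option linter.style.haveILetI false
set_option linter.unusedSimpArgs false

/-! ### Part D: jets of invariants along the slice -/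

section Jets

variable {G : Type} [Group G] [TopologicalSpace G] [IsTopologicalGroup G] [CompactSpace G]
variable {W : Type} [NormedAddCommGroup W] [InnerProductSpace ℝ W] [FiniteDimensional ℝ W]
variable {ρ : G →* (W →ₗᵢ[ℝ] W)} {θ : W}

lemma approx_identity (hρ : CtsRep ρ) (θ : W) : ∃ h : ℕ → W → ℝ, (∀ m, h m ∈ Poly W) ∧
    ∀ (ψ : G → ℝ) (c : ℝ), Continuous ψ → (∀ l, ρ l θ = θ → ψ l = c) →
      Filter.Tendsto (fun m => av (fun g => h m (ρ g θ) * ψ g)) Filter.atTop (𝓝 c) := by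
  have hgθ : Continuous fun g => ρ g θ := hρ.cont continuous_id continuous_const
  have bump : ∀ δ : ℝ, 0 < δ → ∃ h ∈ Poly W, ∃ u : W → ℝ, Continuous u ∧ (∀ x, 0 ≤ u x) ∧
      (∀ x, δ ≤ ‖x - θ‖ → u x = 0) ∧ av (fun g => u (ρ g θ)) = 1 ∧
      ∀ g, |h (ρ g θ) - u (ρ g θ)| < δ := by
    intro δ hδ
    let u0 : W → ℝ := fun x => max 0 (δ - ‖x - θ‖)
    have hu0 : Continuous u0 := by fun_prop
    have hI : 0 < av (fun g => u0 (ρ g θ)) := by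
      refine av_pos (hu0.comp hgθ) (fun g => le_max_left _ _) ?_
      simp [u0, rep_one, hδ]
    set I := av (fun g => u0 (ρ g θ))
    obtain ⟨h, hh, hh2⟩ := poly_approx (isCompact_range hgθ)
      (u := fun x => I⁻¹ * u0 x) (by fun_prop) hδ
    refine ⟨h, hh, fun x => I⁻¹ * u0 x, by fun_prop, fun x => ?_, fun x hx => ?_, ?_, fun g => ?_⟩
    · exact mul_nonneg (inv_nonneg.2 hI.le) (le_max_left _ _)
    · simp [u0, hx]
    · rw [av_cmul]; exact inv_mul_cancel₀ hI.ne'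
    · exact hh2 _ ⟨g, rfl⟩
  choose h hh u hu hu0 huz hu1 hhu using fun m : ℕ => bump (1 / ((m : ℝ) + 1)) (by positivity)
  refine ⟨h, hh, fun ψ c hψ hc => ?_⟩
  obtain ⟨C, hC⟩ : ∃ C, ∀ g, |ψ g| ≤ C := by
    obtain ⟨C, hC⟩ := (isCompact_range hψ.abs).bddAbove
    exact ⟨C, fun g => hC ⟨g, rfl⟩⟩
  have hC0 : 0 ≤ C := (abs_nonneg _).trans (hC 1)
  rw [Metric.tendsto_atTop]
  intro ε hε
  have hδ : ∃ δ > 0, ∀ g, ‖ρ g θ - θ‖ < δ → |ψ g - c| < ε / 3 := by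
    have hcl : IsCompact {g | ε / 3 ≤ |ψ g - c|} :=
      (isClosed_le continuous_const (hψ.sub continuous_const).abs).isCompact
    rcases Set.eq_empty_or_nonempty {g | ε / 3 ≤ |ψ g - c|} with he | hne
    · refine ⟨1, one_pos, fun g _ => ?_⟩
      by_contra hcon
      have : g ∈ {g | ε / 3 ≤ |ψ g - c|} := not_lt.1 hcon
      rw [he] at this; exact this
    · obtain ⟨g0, hg0, hmin⟩ := hcl.exists_isMinOn hne
        (f := fun g => ‖ρ g θ - θ‖) (hgθ.sub continuous_const).norm.continuousOn
      refine ⟨‖ρ g0 θ - θ‖, ?_, fun g hg => ?_⟩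
      · rw [gt_iff_lt, norm_pos_iff, sub_ne_zero]
        intro h0
        have h1 : ε / 3 ≤ |ψ g0 - c| := hg0
        rw [hc g0 h0] at h1
        simp at h1; linarith
      · by_contra hcon
        have h1 : ‖ρ g0 θ - θ‖ ≤ ‖ρ g θ - θ‖ := hmin (not_lt.1 hcon : g ∈ {g | ε / 3 ≤ |ψ g - c|})
        linarith
  obtain ⟨δ, hδ0, hδ⟩ := hδ
  obtain ⟨m0, hm0⟩ := exists_nat_gt (max (1 / δ) (C / (ε / 3)))
  refine ⟨m0, fun m hm => ?_⟩
  have hmm : (m0 : ℝ) ≤ m := by exact_mod_cast hm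
  have hm1 : 1 / δ < (m : ℝ) + 1 := by linarith [(le_max_left _ _).trans_lt hm0]
  have hm2 : C / (ε / 3) < (m : ℝ) + 1 := by linarith [(le_max_right _ _).trans_lt hm0]
  have hm1' : 1 / ((m : ℝ) + 1) < δ := by
    rw [div_lt_iff₀ (by positivity)] at hm1 ⊢; linarith
  have hm2' : 1 / ((m : ℝ) + 1) * C ≤ ε / 3 := by
    rw [div_lt_iff₀ (by positivity)] at hm2
    rw [div_mul_eq_mul_div, div_le_iff₀ (by positivity)]; linarith
  have hhc : Continuous fun g => h m (ρ g θ) := (poly_continuous (hh m)).comp hgθ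
  have huc : Continuous fun g => u m (ρ g θ) := (hu m).comp hgθ
  have e1 : av (fun g => h m (ρ g θ) * ψ g) - c
      = av (fun g => h m (ρ g θ) * ψ g - u m (ρ g θ) * c) := by
    rw [av_sub (φ := fun g => h m (ρ g θ) * ψ g) (ψ := fun g => u m (ρ g θ) * c) (hhc.mul hψ)
      (huc.mul continuous_const), av_mulc, hu1, one_mul]
  rw [Real.dist_eq, e1]
  have hpt : ∀ g, |h m (ρ g θ) * ψ g - u m (ρ g θ) * c| ≤ ε / 3 + ε / 3 * u m (ρ g θ) := by
    intro g
    have e2 : h m (ρ g θ) * ψ g - u m (ρ g θ) * c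
        = (h m (ρ g θ) - u m (ρ g θ)) * ψ g + u m (ρ g θ) * (ψ g - c) := by ring
    rw [e2]
    refine (abs_add_le _ _).trans (add_le_add ?_ ?_)
    · rw [abs_mul]
      refine le_trans ?_ hm2'
      exact mul_le_mul (hhu m g).le (hC g) (abs_nonneg _) (by positivity)
    · rw [abs_mul, abs_of_nonneg (hu0 m _), mul_comm]
      rcases lt_or_ge ‖ρ g θ - θ‖ δ with hlt | hge
      · exact mul_le_mul_of_nonneg_right (hδ g hlt).le (hu0 m _)
      · rw [huz m _ (hm1'.le.trans hge)]; simp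
  have hcc : Continuous fun g => h m (ρ g θ) * ψ g - u m (ρ g θ) * c :=
    (hhc.mul hψ).sub (huc.mul continuous_const)
  have hcr : Continuous fun g => ε / 3 + ε / 3 * u m (ρ g θ) :=
    continuous_const.add (continuous_const.mul huc)
  have hav : av (fun g => ε / 3 + ε / 3 * u m (ρ g θ)) = ε / 3 + ε / 3 := by
    rw [av_add (φ := fun _ => ε / 3) (ψ := fun g => ε / 3 * u m (ρ g θ)) continuous_const (continuous_const.mul huc), av_const, av_cmul, hu1, mul_one]
  have hup := av_mono hcc hcr fun g => (abs_le.1 (hpt g)).2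
  have hlo := av_mono (φ := fun g => (-1) * (ε / 3 + ε / 3 * u m (ρ g θ)))
    (continuous_const.mul hcr) hcc fun g => by linarith [(abs_le.1 (hpt g)).1]
  rw [av_cmul, hav] at hlo
  rw [hav] at hup
  rw [abs_lt]
  constructor <;> linarith

lemma low_coeff (e : ℕ) : ∀ (n : ℕ) (a : ℕ → ℝ) (φ : ℝ → ℝ), e < n → Continuous φ →
    (∀ t : ℝ, ∑ j ∈ Finset.range n, t ^ j * a j = t ^ e * φ t) →
    (∀ j < e, a j = 0) ∧ a e = φ 0 := by
  induction e with
  | zero =>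
    intro n a φ hn hφ h
    refine ⟨by simp, ?_⟩
    obtain ⟨n, rfl⟩ : ∃ k, n = k + 1 := ⟨n - 1, by omega⟩
    have := h 0
    rw [Finset.sum_range_succ'] at this
    simpa using this
  | succ e ih =>
    intro n a φ hn hφ h
    obtain ⟨n, rfl⟩ : ∃ k, n = k + 1 := ⟨n - 1, by omega⟩
    have h0 : a 0 = 0 := by
      have := h 0
      rw [Finset.sum_range_succ'] at this
      simpa using this
    have h1 : ∀ t : ℝ, ∑ j ∈ Finset.range n, t ^ j * a (j + 1) = t ^ e * φ t := by
      have : (fun t : ℝ => ∑ j ∈ Finset.range n, t ^ j * a (j + 1)) = fun t => t ^ e * φ t := by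
        refine Continuous.ext_on (dense_compl_singleton (0 : ℝ)) (by fun_prop) (by fun_prop) ?_
        intro t ht
        have h2 := h t
        rw [Finset.sum_range_succ', h0] at h2
        have ht' : t ≠ 0 := ht
        refine mul_left_cancel₀ ht' ?_
        dsimp only
        rw [Finset.mul_sum]
        simp only [mul_zero, add_zero] at h2
        calc _ = ∑ k ∈ Finset.range n, t ^ (k + 1) * a (k + 1) :=
              Finset.sum_congr rfl fun k _ => by ring
          _ = _ := by rw [h2]; ring
      exact fun t => congrFun this t
    obtain ⟨h2, h3⟩ := ih n (fun j => a (j + 1)) φ (by omega) hφ h1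
    refine ⟨fun j hj => ?_, h3⟩
    rcases j with _ | j
    · exact h0
    · exact h2 j (by omega)

/-- Polynomials all of whose homogeneous components have degree at least `D`. -/
def HS (W : Type) [NormedAddCommGroup W] [NormedSpace ℝ W] (D : ℕ) : Submodule ℝ (W → ℝ) :=
  ⨆ j : Set.Ici D, HomPoly W j

lemma homPoly_le_HS {D j : ℕ} (h : D ≤ j) : HomPoly W j ≤ HS W D :=
  le_iSup (fun j : Set.Ici D => HomPoly W j) ⟨j, h⟩

lemma HS_mono {D E : ℕ} (h : D ≤ E) : HS W E ≤ HS W D :=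
  iSup_le fun j => homPoly_le_HS (h.trans j.2)

lemma HS_le_poly {D : ℕ} : HS W D ≤ Subalgebra.toSubmodule (Poly W) :=
  iSup_le fun _ _ hp => hp.1

lemma poly_mem_HS {p : W → ℝ} (hp : p ∈ Poly W) : p ∈ HS W 0 := by
  obtain ⟨n, c, hc, hh, hs⟩ := poly_decomp hp
  have : p = ∑ j ∈ Finset.range n, c j := by ext x; rw [hs]; simp
  rw [this]
  exact Submodule.sum_mem _ fun j _ => homPoly_le_HS (Nat.zero_le j) ⟨hc j, hh j⟩

lemma HS_split (D : ℕ) : HS W D ≤ HomPoly W D ⊔ HS W (D + 1) := by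
  refine iSup_le fun j => ?_
  rcases eq_or_lt_of_le (show D ≤ j from j.2) with h | h
  · rw [← h]; exact le_sup_left
  · exact (homPoly_le_HS h).trans le_sup_right

lemma HS_avg (hρ : CtsRep ρ) {D : ℕ} {p : W → ℝ} (hp : p ∈ HS W D) :
    (fun x => av (fun g => p (ρ g x))) ∈ HS W D := by
  have hcc : ∀ {p : W → ℝ}, p ∈ HS W D → ∀ x, Continuous fun g => p (ρ g x) := fun hp x =>
    (poly_continuous (HS_le_poly hp)).comp (hρ.cont continuous_id continuous_const)
  suffices H : p ∈ HS W D ∧ (fun x => av (fun g => p (ρ g x))) ∈ HS W D from H.2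
  refine Submodule.iSup_induction (fun j : Set.Ici D => HomPoly W j)
    (motive := fun p => p ∈ HS W D ∧ (fun x => av (fun g => p (ρ g x))) ∈ HS W D) hp ?_ ?_ ?_
  · intro j q hq
    exact ⟨homPoly_le_HS j.2 hq, homPoly_le_HS j.2 ⟨avg_poly hρ hq.1, avg_hom hq.2⟩⟩
  · refine ⟨Submodule.zero_mem _, ?_⟩
    simp only [Pi.zero_apply, av_const]
    exact Submodule.zero_mem _
  · rintro x y ⟨h1, h2⟩ ⟨h3, h4⟩
    refine ⟨Submodule.add_mem _ h1 h3, ?_⟩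
    have : (fun z => av (fun g => (x + y) (ρ g z)))
        = (fun z => av (fun g => x (ρ g z))) + fun z => av (fun g => y (ρ g z)) := by
      ext z
      exact av_add (hcc h1 z) (hcc h3 z)
    rw [this]
    exact Submodule.add_mem _ h2 h4

/-- The stabilizer. -/
def stab (ρ : G →* (W →ₗᵢ[ℝ] W)) (θ : W) : Subgroup G where
  carrier := {l | ρ l θ = θ}
  mul_mem' := by
    intro a b ha hb
    show ρ (a * b) θ = θ
    rw [rep_mul, hb, ha]
  one_mem' := rep_one θ
  inv_mem' := by
    intro a ha
    show ρ a⁻¹ θ = θ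
    conv_lhs => rw [← (ha : ρ a θ = θ)]
    rw [rep_inv]

lemma stab_compact (hρ : CtsRep ρ) : CompactSpace (stab ρ θ) :=
  isCompact_iff_compactSpace.1
    (isClosed_eq (hρ.cont continuous_id continuous_const) continuous_const).isCompact

/-- Restriction of a representation to a subgroup and a stable subspace. -/
def subRep (ρ : G →* (W →ₗᵢ[ℝ] W)) (L : Subgroup G) (S : Submodule ℝ W)
    (h : ∀ l ∈ L, ∀ n ∈ S, ρ l n ∈ S) : L →* (S →ₗᵢ[ℝ] S) where
  toFun l := ⟨(ρ l.1).toLinearMap.restrict (h l.1 l.2), fun x => (ρ l.1).norm_map x⟩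
  map_one' := by ext x; exact rep_one (ρ := ρ) (x : W)
  map_mul' a b := by ext x; exact rep_mul (ρ := ρ) (a : G) b (x : W)

lemma subRep_coe {L : Subgroup G} {S : Submodule ℝ W}
    {h : ∀ l ∈ L, ∀ n ∈ S, ρ l n ∈ S} (l : L) (n : S) : (subRep ρ L S h l n : W) = ρ l n := rfl

lemma subRep_cts (hρ : CtsRep ρ) {L : Subgroup G} {S : Submodule ℝ W}
    {h : ∀ l ∈ L, ∀ n ∈ S, ρ l n ∈ S} : CtsRep (subRep ρ L S h) :=
  Continuous.subtype_mk (hρ.cont (continuous_subtype_val.comp continuous_fst)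
    (continuous_subtype_val.comp continuous_snd)) _

/-- The slice representation. -/
def repN (ρ : G →* (W →ₗᵢ[ℝ] W)) (θ : W) : stab ρ θ →* (nrm ρ θ →ₗᵢ[ℝ] nrm ρ θ) :=
  subRep ρ (stab ρ θ) (nrm ρ θ) fun _ hl _ hn => nrm_stable hl hn

lemma jet_hom (hρ : CtsRep ρ) {e : ℕ} {q : nrm ρ θ → ℝ} (hq : q ∈ HomPoly (nrm ρ θ) e)
    (hqi : Inv (repN ρ θ) q) : ∃ P ∈ Poly W, Inv ρ P ∧
      (fun n : nrm ρ θ => P (θ + n) - q n) ∈ HS (nrm ρ θ) (e + 1) := by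
  let N := nrm ρ θ
  let M : Submodule ℝ (N → ℝ) :=
    { carrier := {c | c ∈ HomPoly N e ∧ ∃ P ∈ Poly W, Inv ρ P ∧
        (fun n : N => P (θ + n) - c n) ∈ HS N (e + 1)}
      add_mem' := by
        rintro a b ⟨h1, P, hP, hPi, hP2⟩ ⟨h2, Q, hQ, hQi, hQ2⟩
        refine ⟨Submodule.add_mem _ h1 h2, _, poly_add hP hQ,
          fun g x => by simp [hPi g x, hQi g x], ?_⟩
        convert Submodule.add_mem _ hP2 hQ2 using 1
        ext n; simp; ring
      zero_mem' := by
        refine ⟨Submodule.zero_mem _, _, poly_const 0, fun g x => rfl, ?_⟩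
        convert Submodule.zero_mem _ using 1
        ext n; simp
      smul_mem' := by
        rintro k a ⟨h1, P, hP, hPi, hP2⟩
        refine ⟨Submodule.smul_mem _ k h1, _, poly_cmul k hP, fun g x => by simp [hPi g x], ?_⟩
        convert Submodule.smul_mem _ k hP2 using 1
        ext n; simp; ring }
  suffices H : q ∈ M from H.2
  haveI := homPoly_finite (W := N) e
  haveI : FiniteDimensional ℝ M := Submodule.finiteDimensional_of_le (S₂ := HomPoly N e) fun c hc => hc.1
  have hclosed : IsClosed (M : Set (N → ℝ)) := Submodule.closed_of_finiteDimensional M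
  let b := stdOrthonormalBasis ℝ N
  choose v hv hvb using fun i => (b i).2
  choose u hu hu1 hu2 using fun i => poly_hadamard (v i).2
  obtain ⟨h, hh, hlim⟩ := approx_identity hρ θ
  -- the leading coefficient
  let U : ℝ → N → G → N := fun t n g => ∑ i, u i (t, ρ g θ, ρ g n) • b i
  have hqc := poly_continuous hq.1
  have hUc : ∀ n, Continuous fun z : ℝ × G => U z.1 n z.2 := by
    intro n
    refine continuous_finset_sum _ fun i _ => ((hu i).comp ?_).smul continuous_const
    exact continuous_fst.prodMk ((hρ.cont continuous_snd continuous_const).prodMk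
      (hρ.cont continuous_snd continuous_const))
  let Φ : ℕ → N → ℝ → ℝ := fun m n t => av (fun g => h m (ρ g (θ + t • (n : W))) * q (U t n g))
  have hΦ : ∀ m n, Continuous (Φ m n) := by
    intro m n
    refine av_continuous (φ := fun t g => h m (ρ g (θ + t • (n : W))) * q (U t n g)) ?_
    refine ((poly_continuous (hh m)).comp (hρ.cont continuous_snd (by fun_prop))).mul
      (hqc.comp (hUc n))
  have hmem : ∀ m, (fun n => Φ m n 0) ∈ M := by
    intro m
    let p : W → ℝ := fun x => h m x * q (∑ i, (v i : W → ℝ) x • b i)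
    have hp : p ∈ Poly W := by
      refine poly_mul (hh m) (poly_comp (T := fun x => ∑ i, (v i : W → ℝ) x • b i) (fun l => ?_) hq.1)
      have : (fun x => l (∑ i, (v i : W → ℝ) x • b i)) = fun x => ∑ i, l (b i) * (v i : W → ℝ) x := by
        ext x; simp [map_sum, mul_comm]
      rw [this]
      exact poly_sum _ fun i _ => poly_cmul _ (v i).2
    let P : W → ℝ := fun x => av (fun g => p (ρ g x))
    have hP : P ∈ Poly W := avg_poly hρ hp
    have hPΦ : ∀ (t : ℝ) (n : N), P (θ + t • (n : W)) = t ^ e * Φ m n t := by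
      intro t n
      simp only [P, Φ, p]
      rw [← av_cmul]
      congr 1
      ext g
      have e1 : ∑ i, (v i : W → ℝ) (ρ g (θ + t • (n : W))) • b i = t • U t n g := by
        simp only [U, Finset.smul_sum, smul_smul]
        refine Finset.sum_congr rfl fun i _ => ?_
        rw [map_add, map_smul, hu1, hv i g, zero_add]
      rw [e1, hq.2]; ring
    have hPN : (fun n : N => P (θ + n)) ∈ Poly N := poly_comp_affine θ N.subtypeL hP
    obtain ⟨k, c, hc, hch, hcs⟩ := poly_decomp' hPN
    have hlow : ∀ n : N, (∀ j < e, c j n = 0) ∧ c e n = Φ m n 0 := by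
      intro n
      refine low_coeff e (k + e + 1) (fun j => c j n) (Φ m n) (by omega) (hΦ m n) fun t => ?_
      rw [← hPΦ]
      have := hcs (k + e + 1) (by omega) (t • n)
      simp only [hch _ t n] at this
      exact this.symm
    have hce : (fun n => Φ m n 0) = c e := by ext n; exact (hlow n).2.symm
    rw [hce]
    refine ⟨⟨hc e, hch e⟩, P, hP, avg_inv hρ (poly_continuous hp), ?_⟩
    have e2 : (fun n : N => P (θ + n) - c e n) = ∑ j ∈ Finset.Ico (e + 1) (k + e + 1), c j := by
      ext n
      have e3 : P (θ + n) = _ := hcs (k + e + 1) (by omega) n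
      rw [e3, Finset.sum_apply, ← Finset.sum_range_add_sum_Ico _ (show e + 1 ≤ k + e + 1 by omega),
        Finset.sum_range_succ, Finset.sum_eq_zero fun j hj => (hlow n).1 j (Finset.mem_range.1 hj)]
      ring
    rw [e2]
    exact Submodule.sum_mem _ fun j hj => homPoly_le_HS (Finset.mem_Ico.1 hj).1 ⟨hc j, hch j⟩
  refine hclosed.mem_of_tendsto (f := fun m => fun n => Φ m n 0) (b := Filter.atTop) ?_
    (Filter.Eventually.of_forall hmem)
  rw [tendsto_pi_nhds]
  intro n
  have e4 : ∀ m, Φ m n 0 = av (fun g => h m (ρ g θ) * q (U 0 n g)) := by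
    intro m; simp only [Φ, zero_smul, add_zero]
  simp only [e4]
  refine hlim (fun g => q (U 0 n g)) (q n) (hqc.comp ((hUc n).comp (Continuous.prodMk_right 0)))
    fun l hl => ?_
  have e5 : U 0 n l = repN ρ θ ⟨l, hl⟩ n := by
    simp only [U, hu2]
    rw [hl]
    simp only [hvb]
    exact b.sum_repr' (repN ρ θ ⟨l, hl⟩ n)
  rw [e5, hqi]

lemma jet (hρ : CtsRep ρ) {q : nrm ρ θ → ℝ} (hq : q ∈ Poly (nrm ρ θ))
    (hqi : Inv (repN ρ θ) q) (D : ℕ) : ∃ P ∈ Poly W, Inv ρ P ∧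
      (fun n : nrm ρ θ => P (θ + n) - q n) ∈ HS (nrm ρ θ) D := by
  haveI := stab_compact (θ := θ) hρ
  induction D with
  | zero =>
    refine ⟨_, poly_const 0, fun g x => rfl, poly_mem_HS (poly_sub (poly_const 0) hq)⟩
  | succ D ih =>
    obtain ⟨P, hP, hPi, hPr⟩ := ih
    obtain ⟨c, hc, r, hr, hcr⟩ := Submodule.mem_sup.1 (HS_split D hPr)
    have hrN : CtsRep (repN ρ θ) := subRep_cts hρ
    have hinv : Inv (repN ρ θ) (fun n : nrm ρ θ => P (θ + n) - q n) := by
      intro l n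
      dsimp only
      rw [hqi, ← hPi l (θ + n), map_add, (l.2 : ρ l θ = θ)]; rfl
    obtain ⟨Q, hQ, hQi, hQr⟩ := jet_hom hρ (q := fun n => av (fun g => c (repN ρ θ g n)))
      ⟨avg_poly hrN hc.1, avg_hom hc.2⟩ (avg_inv hrN (poly_continuous hc.1))
    refine ⟨_, poly_sub hP hQ, fun g x => by simp [hPi g x, hQi g x], ?_⟩
    have := Submodule.sub_mem _ (HS_avg hrN hr) hQr
    convert this using 1
    ext n
    have h1 := avg_of_inv hinv n
    have h2 : (fun g => P (θ + (repN ρ θ g n : nrm ρ θ)) - q (repN ρ θ g n))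
        = fun g => c (repN ρ θ g n) + r (repN ρ θ g n) := by
      ext g; exact (congrFun hcr (repN ρ θ g n)).symm
    rw [h2, av_add (φ := fun g => c (repN ρ θ g n)) (ψ := fun g => r (repN ρ θ g n)) ((poly_continuous hc.1).comp (hrN.cont continuous_id continuous_const))
      ((poly_continuous (HS_le_poly hr)).comp (hrN.cont continuous_id continuous_const))] at h1
    simp only [Pi.sub_apply]
    have h3 : P (θ + n) - Q (θ + n) - q n = (P (θ + n) - q n) - Q (θ + n) := by ring
    rw [h3, ← h1]
    ring

end Jets

end Schwarz

namespace Schwarz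

open scoped ContDiff Topology

set_option linter.all false
set_option linter.unusedSectionVars false
set_option linter.style.haveILetI false
set_option linter.unusedSimpArgs false

/-! ### Part E: Borel lemma -/

/-- The weighted dilation. -/
noncomputable def dil {ι : Type} [Fintype ι] (d : ι → ℕ) (t : ℝ) : (ι → ℝ) →L[ℝ] (ι → ℝ) :=
  ContinuousLinearMap.pi fun i => (t ^ d i) • ContinuousLinearMap.proj i

theorem dil_apply {ι : Type} [Fintype ι] (d : ι → ℕ) (t : ℝ) (y : ι → ℝ) (i : ι) :
    dil d t y i = t ^ d i * y i := by simp [dil]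

theorem dil_dil {ι : Type} [Fintype ι] (d : ι → ℕ) (s t : ℝ) (y : ι → ℝ) :
    dil d s (dil d t y) = dil d (s * t) y := by
  ext i; simp only [dil_apply]; ring

theorem dil_continuous {ι : Type} [Fintype ι] (d : ι → ℕ) (y : ι → ℝ) :
    Continuous fun t : ℝ => dil d t y := by
  refine continuous_pi fun i => ?_
  simp only [dil_apply]; fun_prop

theorem dil_zero {ι : Type} [Fintype ι] (d : ι → ℕ) (hd : ∀ i, 1 ≤ d i) (y : ι → ℝ) :
    dil d 0 y = 0 := by
  ext i; simp only [dil_apply]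
  rw [zero_pow (by have := hd i; omega)]; simp

theorem dil_norm_le {ι : Type} [Fintype ι] (d : ι → ℕ) (D : ℕ) (hD : ∀ i, d i ≤ D)
    {R : ℝ} (hR : 1 ≤ R) (y : ι → ℝ) : ‖dil d R y‖ ≤ R ^ D * ‖y‖ := by
  refine (pi_norm_le_iff_of_nonneg (by positivity)).2 fun i => ?_
  rw [dil_apply, norm_mul, norm_pow, Real.norm_eq_abs, abs_of_nonneg (by linarith)]
  exact mul_le_mul (pow_le_pow_right₀ hR (hD i)) (norm_le_pi_norm y i) (norm_nonneg _)
    (by positivity)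

theorem iter_comp_bound {E E' : Type} [NormedAddCommGroup E] [NormedSpace ℝ E]
    [NormedAddCommGroup E'] [NormedSpace ℝ E']
    (v : E' → ℝ) (hv : ContDiff ℝ ∞ v) (T : E →L[ℝ] E') (k : ℕ) (C : ℝ)
    (hC : ∀ z, ‖iteratedFDeriv ℝ k v z‖ ≤ C) (r : ℝ) (hT : ‖T‖ ≤ r) (x : E) :
    ‖iteratedFDeriv ℝ k (v ∘ T) x‖ ≤ C * r ^ k := by
  rw [ContinuousLinearMap.iteratedFDeriv_comp_right T hv x (i := k) (by exact_mod_cast le_top)]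
  refine (ContinuousMultilinearMap.norm_compContinuousLinearMap_le _ _).trans ?_
  simp only [Finset.prod_const, Finset.card_univ, Fintype.card_fin]
  have h0 : 0 ≤ C := (norm_nonneg _).trans (hC (T x))
  gcongr
  exact hC _

theorem borel {P : Type} [NormedAddCommGroup P] [NormedSpace ℝ P]
    {ι : Type} [Fintype ι] (d : ι → ℕ) (hd : ∀ i, 1 ≤ d i)
    (Q : ℕ → P × (ι → ℝ) → ℝ) (hQ : ∀ j, ContDiff ℝ ∞ (Q j))
    (hom : ∀ j p t y, Q j (p, dil d t y) = t ^ j * Q j (p, y))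
    (C : Set P) (hC : IsCompact C) (hs : ∀ j p y, p ∉ C → Q j (p, y) = 0) (b : ℝ) :
    ∃ F : P × (ι → ℝ) → ℝ, ContDiff ℝ ∞ F ∧ (∀ p y, (∀ j, Q j (p, y) = 0) → F (p, y) = 0) ∧
      ∀ n p y, ‖y‖ ≤ b →
        (fun t : ℝ => F (p, dil d t y) - ∑ j ∈ Finset.range (n + 1), t ^ j * Q j (p, y))
          =O[𝓝 0] fun t : ℝ => t ^ (n + 1) := by
  classical
  obtain ⟨D, hD⟩ : ∃ D, ∀ i, d i ≤ D := ⟨∑ i, d i, fun i =>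
    Finset.single_le_sum (fun _ _ => Nat.zero_le _) (Finset.mem_univ i)⟩
  let χ : ContDiffBump (0 : ι → ℝ) := ⟨1, 2, one_pos, by norm_num⟩
  let v : ℕ → P × (ι → ℝ) → ℝ := fun j z => Q j z * χ z.2
  have hv : ∀ j, ContDiff ℝ ∞ (v j) := fun j => (hQ j).mul (χ.contDiff.comp contDiff_snd)
  have hvs : ∀ j, HasCompactSupport (v j) := by
    intro j
    refine HasCompactSupport.intro (K := C ×ˢ Metric.closedBall (0 : ι → ℝ) 2)
      (hC.prod (isCompact_closedBall _ _)) ?_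
    rintro ⟨p, y⟩ hz
    simp only [Set.mem_prod, not_and_or] at hz
    rcases hz with h | h
    · simp [v, hs j p y h]
    · have : χ y = 0 := χ.zero_of_le_dist (by
        simp only [Metric.mem_closedBall, not_le] at h; exact h.le)
      simp [v, this]
  have hB : ∀ j k, ∃ c, ∀ z, ‖iteratedFDeriv ℝ k (v j) z‖ ≤ c := fun j k =>
    ((hvs j).iteratedFDeriv k).exists_bound_of_continuous
      ((hv j).continuous_iteratedFDeriv (by exact_mod_cast le_top))
  choose B hB using hB
  have hB0 : ∀ j k, 0 ≤ B j k := fun j k => (norm_nonneg _).trans (hB j k 0)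
  have hV : ∀ j z, |v j z| ≤ B j 0 := fun j z => by
    have := hB j 0 z
    simpa using this
  have hS : ∀ j, ∃ c, ∀ p y, ‖y‖ ≤ b → |Q j (p, y)| ≤ c := by
    intro j
    obtain ⟨c, hc⟩ := (hC.prod (isCompact_closedBall (0 : ι → ℝ) b)).exists_bound_of_continuousOn
      (hQ j).continuous.continuousOn
    refine ⟨max c 0, fun p y hy => ?_⟩
    by_cases hp : p ∈ C
    · exact (hc (p, y) ⟨hp, by simpa using hy⟩).trans (le_max_left _ _)
    · rw [hs j p y hp]; simp
  choose S hS using hS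
  let M : ℕ → ℝ := fun j => max (S j) (B j 0)
  have hM0 : ∀ j, 0 ≤ M j := fun j => (hB0 j 0).trans (le_max_right _ _)
  let X : ℕ → ℝ := fun j => 1 + M j + ∑ k ∈ Finset.range (j + 1), B j k
  have hX1 : ∀ j, 1 ≤ X j := fun j => by
    have := Finset.sum_nonneg (s := Finset.range (j + 1)) (fun k _ => hB0 j k)
    have := hM0 j
    simp only [X]; linarith
  have hXM : ∀ j, M j ≤ X j := fun j => by
    have := Finset.sum_nonneg (s := Finset.range (j + 1)) (fun k _ => hB0 j k)
    simp only [X]; linarith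
  have hXB : ∀ j k, k ≤ j → B j k ≤ X j := fun j k hk => by
    have := Finset.single_le_sum (f := fun k => B j k) (s := Finset.range (j + 1))
      (fun k _ => hB0 j k) (Finset.mem_range.2 (Nat.lt_succ_of_le hk))
    have := hM0 j
    simp only [X]; linarith
  let R : ℕ → ℝ := fun j => 2 ^ j * X j
  have hR1 : ∀ j, 1 ≤ R j := fun j => one_le_mul_of_one_le_of_one_le (one_le_pow₀ (by norm_num)) (hX1 j)
  have hRp : ∀ j, 0 < R j := fun j => by linarith [hR1 j]
  have hRX : ∀ j, X j * (R j)⁻¹ = (1 / 2) ^ j := fun j => by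
    have : X j ≠ 0 := by linarith [hX1 j]
    simp only [R]; field_simp; rw [← mul_pow]; simp
  -- the rescaled terms
  let T : ℕ → (P × (ι → ℝ)) →L[ℝ] (P × (ι → ℝ)) := fun j =>
    (ContinuousLinearMap.id ℝ P).prodMap (dil d (R j))
  have hT : ∀ j, ‖T j‖ ≤ R j ^ D := by
    intro j
    refine ContinuousLinearMap.opNorm_le_bound _ (pow_nonneg (hRp j).le _) ?_
    rintro ⟨p, y⟩
    have h1 : (1 : ℝ) ≤ R j ^ D := one_le_pow₀ (hR1 j)
    refine max_le ?_ ?_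
    · show ‖p‖ ≤ _
      have := norm_fst_le (p, y)
      have h2 : 0 ≤ ‖(p, y)‖ := norm_nonneg _
      simp only at this
      nlinarith
    · show ‖dil d (R j) y‖ ≤ _
      refine (dil_norm_le d D hD (hR1 j) y).trans ?_
      gcongr
      exact norm_snd_le (p, y)
  let u : ℕ → P × (ι → ℝ) → ℝ := fun j z => ((R j)⁻¹) ^ j * v j (T j z)
  have hu : ∀ j, ContDiff ℝ ∞ (u j) := fun j => contDiff_const.mul ((hv j).comp (T j).contDiff)
  have huQ : ∀ j p y, u j (p, y) = Q j (p, y) * χ (dil d (R j) y) := by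
    intro j p y
    show ((R j)⁻¹) ^ j * (Q j (p, dil d (R j) y) * χ (dil d (R j) y)) = _
    rw [hom]
    have : ((R j)⁻¹) ^ j * R j ^ j = 1 := by rw [← mul_pow, inv_mul_cancel₀ (hRp j).ne', one_pow]
    linear_combination (Q j (p, y) * χ (dil d (R j) y)) * this
  have hub : ∀ k j, D * k < j → k ≤ j → ∀ z, ‖iteratedFDeriv ℝ k (u j) z‖ ≤ (1 / 2) ^ j := by
    intro k j h1 h2 z
    have e : u j = ((R j)⁻¹) ^ j • (v j ∘ T j) := rfl
    rw [e, iteratedFDeriv_const_smul_apply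
      (((hv j).comp (T j).contDiff).contDiffAt.of_le (by exact_mod_cast le_top)), norm_smul]
    have h3 := iter_comp_bound (v j) (hv j) (T j) k _ (hB j k) _ (hT j) z
    rw [norm_pow, Real.norm_eq_abs, abs_of_pos (inv_pos.2 (hRp j))]
    have h4 : (R j ^ D) ^ k ≤ R j ^ (j - 1) := by
      rw [← pow_mul]; exact pow_le_pow_right₀ (hR1 j) (by omega)
    have h5 : ((R j)⁻¹) ^ j * R j ^ (j - 1) = (R j)⁻¹ := by
      obtain ⟨i, rfl⟩ : ∃ i, j = i + 1 := ⟨j - 1, by omega⟩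
      simp only [Nat.add_sub_cancel]
      rw [pow_succ, mul_right_comm, ← mul_pow, inv_mul_cancel₀ (hRp _).ne', one_pow, one_mul]
    have h6 : (0 : ℝ) ≤ ((R j)⁻¹) ^ j := pow_nonneg (inv_nonneg.2 (hRp j).le) _
    calc ((R j)⁻¹) ^ j * ‖iteratedFDeriv ℝ k (v j ∘ T j) z‖
        ≤ ((R j)⁻¹) ^ j * (B j k * R j ^ (j - 1)) := by
          refine mul_le_mul_of_nonneg_left (h3.trans ?_) h6
          exact mul_le_mul_of_nonneg_left h4 (hB0 j k)
      _ = B j k * (R j)⁻¹ := by rw [mul_left_comm, h5]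
      _ ≤ X j * (R j)⁻¹ := mul_le_mul_of_nonneg_right (hXB j k h2) (inv_nonneg.2 (hRp j).le)
      _ = _ := hRX j
  have hgeo : Summable fun j : ℕ => ((1 : ℝ) / 2) ^ j := summable_geometric_two
  refine ⟨fun z => ∑' j, u j z, ?_, ?_, ?_⟩
  · refine contDiff_tsum_of_eventually (v := fun _ j => (1 / 2) ^ j) hu (fun _ _ => hgeo) ?_
    intro k _
    rw [Nat.cofinite_eq_atTop]
    filter_upwards [Filter.eventually_gt_atTop (D * k), Filter.eventually_ge_atTop k] with j h1 h2 z
    exact hub k j h1 h2 z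
  · intro p y h
    have : ∀ j, u j (p, y) = 0 := fun j => by rw [huQ, h j, zero_mul]
    simp [this]
  · intro n p y hy
    have hsum : ∀ z, Summable fun j => u j z := by
      intro z
      refine Summable.of_norm_bounded_eventually_nat hgeo ?_
      filter_upwards [Filter.eventually_gt_atTop 0] with j h1
      have := hub 0 j (by simpa using h1) (Nat.zero_le _) z
      simpa using this
    have htail : ∀ j t, n + 2 ≤ j → |u j (p, dil d t y)| ≤ (1 / 2) ^ j * |t| ^ (n + 1) := by
      intro j t hj
      have e : u j (p, dil d t y) = ((R j)⁻¹) ^ j * v j (p, dil d (R j * t) y) := by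
        show ((R j)⁻¹) ^ j * v j (p, dil d (R j) (dil d t y)) = _
        rw [dil_dil]
      have h1 : |v j (p, dil d (R j * t) y)| ≤ M j * |R j * t| ^ (n + 1) := by
        by_cases hst : |R j * t| ≤ 1
        · have : |v j (p, dil d (R j * t) y)| ≤ |R j * t| ^ j * S j := by
            show |Q j (p, dil d (R j * t) y) * χ (dil d (R j * t) y)| ≤ _
            rw [hom, abs_mul, abs_mul, abs_pow]
            have h2 : |χ (dil d (R j * t) y)| ≤ 1 := by
              rw [abs_of_nonneg χ.nonneg]; exact χ.le_one
            have h3 := hS j p y hy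
            have h0 : 0 ≤ S j := (abs_nonneg _).trans h3
            calc _ ≤ |R j * t| ^ j * S j * 1 := by gcongr
              _ = _ := mul_one _
          have h4 : |R j * t| ^ j ≤ |R j * t| ^ (n + 1) :=
            pow_le_pow_of_le_one (abs_nonneg _) hst (by omega)
          have h0 : 0 ≤ S j := (abs_nonneg _).trans (hS j p y hy)
          calc _ ≤ _ := this
            _ ≤ |R j * t| ^ (n + 1) * M j := mul_le_mul h4 (le_max_left _ _) h0 (by positivity)
            _ = _ := mul_comm _ _
        · have : 1 ≤ |R j * t| ^ (n + 1) := one_le_pow₀ (by linarith)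
          have h2 := (hV j (p, dil d (R j * t) y)).trans (le_max_right (S j) _)
          have h3 := hM0 j
          show _ ≤ M j * _
          nlinarith
      rw [e, abs_mul, abs_pow, abs_of_pos (inv_pos.2 (hRp j))]
      have h5 : ((R j)⁻¹) ^ j * R j ^ (n + 1) ≤ (R j)⁻¹ := by
        obtain ⟨i, rfl⟩ : ∃ i, j = n + 1 + (i + 1) := ⟨j - (n + 2), by omega⟩
        rw [pow_add, mul_right_comm, ← mul_pow, inv_mul_cancel₀ (hRp _).ne', one_pow, one_mul,
          pow_succ]
        exact mul_le_of_le_one_left (inv_nonneg.2 (hRp _).le)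
          (pow_le_one₀ (inv_nonneg.2 (hRp _).le) (inv_le_one_of_one_le₀ (hR1 _)))
      calc ((R j)⁻¹) ^ j * |v j (p, dil d (R j * t) y)|
          ≤ ((R j)⁻¹) ^ j * (M j * |R j * t| ^ (n + 1)) :=
            mul_le_mul_of_nonneg_left h1 (pow_nonneg (inv_nonneg.2 (hRp j).le) _)
        _ = (((R j)⁻¹) ^ j * R j ^ (n + 1)) * M j * |t| ^ (n + 1) := by
            rw [abs_mul, abs_of_pos (hRp j), mul_pow]; ring
        _ ≤ (R j)⁻¹ * X j * |t| ^ (n + 1) := by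
            have := hXM j
            have := hM0 j
            have := (inv_pos.2 (hRp j)).le
            gcongr
        _ = _ := by rw [mul_comm (R j)⁻¹, hRX]
    -- for small t the first terms are exact
    have hex : ∀ᶠ t in 𝓝 (0 : ℝ), ∀ j ∈ Finset.range (n + 2),
        u j (p, dil d t y) = t ^ j * Q j (p, y) := by
      rw [Filter.eventually_all_finset]
      intro j _
      have hc : Filter.Tendsto (fun t : ℝ => dil d (R j) (dil d t y)) (𝓝 0) (𝓝 0) := by
        have : Continuous fun t : ℝ => dil d (R j) (dil d t y) :=
          (dil d (R j)).continuous.comp (dil_continuous d y)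
        have h := this.tendsto 0
        rwa [dil_zero d hd, map_zero] at h
      filter_upwards [hc (Metric.closedBall_mem_nhds _ one_pos)] with t ht
      rw [huQ, hom, χ.one_of_mem_closedBall ht, mul_one]
    refine Asymptotics.IsBigO.of_bound (|Q (n + 1) (p, y)| + ∑' j, ((1 : ℝ) / 2) ^ j) ?_
    filter_upwards [hex] with t ht
    have hspl := (hsum (p, dil d t y)).sum_add_tsum_nat_add (n + 2)
    rw [Finset.sum_congr rfl ht, Finset.sum_range_succ] at hspl
    have e : (∑' j, u j (p, dil d t y)) - ∑ j ∈ Finset.range (n + 1), t ^ j * Q j (p, y)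
        = t ^ (n + 1) * Q (n + 1) (p, y) + ∑' i, u (i + (n + 2)) (p, dil d t y) := by
      rw [← hspl]; ring
    have hb : ∀ i, ‖u (i + (n + 2)) (p, dil d t y)‖ ≤ (1 / 2) ^ i * |t| ^ (n + 1) := by
      intro i
      refine (htail (i + (n + 2)) t (by omega)).trans ?_
      have : ((1 : ℝ) / 2) ^ (i + (n + 2)) ≤ (1 / 2) ^ i :=
        pow_le_pow_of_le_one (by norm_num) (by norm_num) (by omega)
      gcongr
    have hsb : Summable fun i : ℕ => ((1 : ℝ) / 2) ^ i * |t| ^ (n + 1) := hgeo.mul_right _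
    have h2 := tsum_of_norm_bounded hsb.hasSum hb
    rw [tsum_mul_right] at h2
    rw [e, norm_pow, Real.norm_eq_abs t, add_mul]
    refine (norm_add_le _ _).trans (add_le_add ?_ h2)
    rw [norm_mul, norm_pow, Real.norm_eq_abs, Real.norm_eq_abs, mul_comm]

end Schwarz

namespace Schwarz

open scoped ContDiff Topology

set_option linter.all false
set_option linter.unusedSectionVars false
set_option linter.style.haveILetI false
set_option linter.unusedSimpArgs false

/-! ### Part F: flat functions -/

theorem taylor1 (φ : ℝ → ℝ) (hφ : ContDiff ℝ ∞ φ) (n : ℕ) :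
    (fun t => φ t - ∑ j ∈ Finset.range (n + 1), t ^ j * (iteratedDeriv j φ 0 / j.factorial))
      =O[𝓝 0] fun t : ℝ => t ^ (n + 1) := by
  have h := (taylor_isLittleO_univ (x₀ := 0) (n := n + 1)
    (hφ.of_le (by exact_mod_cast le_top))).isBigO
  have h2 : (fun t : ℝ => t ^ (n + 1) * (iteratedDeriv (n + 1) φ 0 / (n + 1).factorial))
      =O[𝓝 0] fun t : ℝ => t ^ (n + 1) := by
    simpa [mul_comm] using
      (Asymptotics.isBigO_refl (fun t : ℝ => t ^ (n + 1)) (𝓝 0)).const_mul_left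
        (iteratedDeriv (n + 1) φ 0 / (n + 1).factorial)
  simp only [sub_zero] at h
  refine (h.add h2).congr_left fun t => ?_
  rw [taylor_within_apply, Finset.sum_range_succ]
  simp only [iteratedDerivWithin_univ, sub_zero, smul_eq_mul]
  have : ∀ j : ℕ, ((j.factorial : ℝ))⁻¹ * t ^ j * iteratedDeriv j φ 0
      = t ^ j * (iteratedDeriv j φ 0 / j.factorial) := fun j => by rw [div_eq_mul_inv]; ring
  simp only [this]
  ring

theorem pow_bigO_zero (c : ℝ) (k : ℕ)
    (h : (fun t : ℝ => t ^ k * c) =O[𝓝 0] fun t : ℝ => t ^ (k + 1)) : c = 0 := by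
  by_contra hc
  have h1 : (fun t : ℝ => t ^ k) =O[𝓝 0] fun t : ℝ => t ^ (k + 1) := by
    have := h.const_mul_left c⁻¹
    refine this.congr_left fun t => ?_
    field_simp
  have h2 : (fun t : ℝ => t ^ (k + 1)) =o[𝓝 0] fun t : ℝ => t ^ k :=
    Asymptotics.isLittleO_pow_pow (by omega)
  have h3 : (fun t : ℝ => t ^ k) =o[𝓝 0] fun t : ℝ => t ^ k := h1.trans_isLittleO h2
  have h4 := (h3.def (c := 1 / 2) (by norm_num))
  have h5 : ∃ᶠ t : ℝ in 𝓝 0, t ≠ 0 := by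
    have : ∃ᶠ t : ℝ in 𝓝[≠] 0, t ≠ 0 :=
      (eventually_mem_nhdsWithin (a := (0 : ℝ)) (s := {0}ᶜ)).frequently
    exact this.filter_mono nhdsWithin_le_nhds
  obtain ⟨t, ht, ht2⟩ := (h5.and_eventually h4).exists
  have : 0 < ‖t ^ k‖ := norm_pos_iff.2 (pow_ne_zero _ ht)
  linarith

theorem flat1 (φ : ℝ → ℝ) (hφ : ContDiff ℝ ∞ φ)
    (h : ∀ n : ℕ, φ =O[𝓝 0] fun t : ℝ => t ^ n) (k : ℕ) : iteratedDeriv k φ 0 = 0 := by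
  induction k using Nat.strong_induction_on with
  | _ k ih =>
    have h1 := taylor1 φ hφ k
    have h2 := (h (k + 1)).sub h1
    have h3 : iteratedDeriv k φ 0 / k.factorial = 0 := by
      refine pow_bigO_zero _ k (h2.congr_left fun t => ?_)
      rw [Finset.sum_range_succ, Finset.sum_eq_zero]
      · ring
      · intro j hj
        rw [ih j (Finset.mem_range.1 hj)]; simp
    have : (k.factorial : ℝ) ≠ 0 := by positivity
    field_simp at h3
    simpa using h3

section
variable {Q : Type} [NormedAddCommGroup Q] [NormedSpace ℝ Q]

/-- derivative in the last variable -/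
noncomputable def pt {V : Type} [NormedAddCommGroup V] [NormedSpace ℝ V] (h : Q × ℝ → V) :
    Q × ℝ → V := fun z => fderiv ℝ h z (0, 1)

variable {V : Type} [NormedAddCommGroup V] [NormedSpace ℝ V]

theorem contDiff_fderiv {E V : Type} [NormedAddCommGroup E] [NormedSpace ℝ E]
    [NormedAddCommGroup V] [NormedSpace ℝ V] {h : E → V} (hh : ContDiff ℝ ∞ h) :
    ContDiff ℝ ∞ (fderiv ℝ h) := (contDiff_infty_iff_fderiv.1 hh).2

theorem pt_contDiff {h : Q × ℝ → V} (hh : ContDiff ℝ ∞ h) : ContDiff ℝ ∞ (pt h) :=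
  (contDiff_fderiv hh).clm_apply contDiff_const

theorem pt_iter_contDiff {h : Q × ℝ → V} (hh : ContDiff ℝ ∞ h) (k : ℕ) :
    ContDiff ℝ ∞ (pt^[k] h) := by
  induction k with
  | zero => exact hh
  | succ k ih => rw [Function.iterate_succ_apply']; exact pt_contDiff ih

theorem iteratedDeriv_pt {h : Q × ℝ → V} (hh : ContDiff ℝ ∞ h) (k : ℕ) (q : Q) :
    iteratedDeriv k (fun t => h (q, t)) = fun t => (pt^[k] h) (q, t) := by
  induction k with
  | zero => simp
  | succ k ih =>
    rw [iteratedDeriv_succ, ih]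
    ext t
    rw [Function.iterate_succ_apply']
    have h1 : HasFDerivAt (pt^[k] h) (fderiv ℝ (pt^[k] h) (q, t)) (q, t) :=
      ((pt_iter_contDiff hh k).differentiable (by simp)).differentiableAt.hasFDerivAt
    have h2 : HasDerivAt (fun t : ℝ => (q, t)) ((0 : Q), (1 : ℝ)) t :=
      (hasDerivAt_const t q).prodMk (hasDerivAt_id t)
    exact (h1.comp_hasDerivAt t h2).deriv

theorem pt_fderiv {h : Q × ℝ → V} (hh : ContDiff ℝ ∞ h) :
    pt (fderiv ℝ h) = fderiv ℝ (pt h) := by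
  ext1 z
  have h1 : HasFDerivAt (fderiv ℝ h) (fderiv ℝ (fderiv ℝ h) z) z :=
    ((contDiff_fderiv hh).differentiable (by simp)).differentiableAt.hasFDerivAt
  have h2 : HasFDerivAt (pt h) ((fderiv ℝ (fderiv ℝ h) z).flip (0, 1)) z := by
    have := h1.clm_apply (hasFDerivAt_const ((0 : Q), (1 : ℝ)) z)
    simp only [ContinuousLinearMap.comp_zero, zero_add] at this
    exact this
  rw [h2.fderiv]
  have hsym : IsSymmSndFDerivAt ℝ h z := hh.contDiffAt.isSymmSndFDerivAt (by
    simp only [minSmoothness_of_isRCLikeNormedField]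
    exact WithTop.coe_le_coe.2 (le_top : (2 : ℕ∞) ≤ ⊤))
  refine ContinuousLinearMap.ext fun v => ?_
  exact hsym _ _

theorem pt_iter_fderiv (k : ℕ) {h : Q × ℝ → V} (hh : ContDiff ℝ ∞ h) :
    pt^[k] (fderiv ℝ h) = fderiv ℝ (pt^[k] h) := by
  induction k generalizing h with
  | zero => rfl
  | succ k ih =>
    rw [Function.iterate_succ_apply, pt_fderiv hh, ih (pt_contDiff hh),
      Function.iterate_succ_apply]

theorem flat_of_pt (k : ℕ) : ∀ {V : Type} [NormedAddCommGroup V] [NormedSpace ℝ V]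
    {h : Q × ℝ → V}, ContDiff ℝ ∞ h → (∀ j q, (pt^[j] h) (q, 0) = 0) →
    ∀ q, iteratedFDeriv ℝ k h (q, 0) = 0 := by
  induction k with
  | zero =>
    intro V _ _ h hh h0 q
    rw [← norm_eq_zero, norm_iteratedFDeriv_zero, norm_eq_zero]
    exact h0 0 q
  | succ k ih =>
    intro V _ _ h hh h0 q
    rw [← norm_eq_zero, ← norm_iteratedFDeriv_fderiv, norm_eq_zero]
    refine ih (contDiff_fderiv hh) ?_ q
    intro j q
    rw [pt_iter_fderiv j hh]
    have hd : HasFDerivAt (pt^[j] h) (fderiv ℝ (pt^[j] h) (q, 0)) (q, 0) :=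
      ((pt_iter_contDiff hh j).differentiable (by simp)).differentiableAt.hasFDerivAt
    have e1 : ∀ v : Q, fderiv ℝ (pt^[j] h) (q, 0) (v, 0) = 0 := by
      intro v
      have h2 : HasFDerivAt (fun q : Q => (q, (0 : ℝ))) (ContinuousLinearMap.inl ℝ Q ℝ) q :=
        (ContinuousLinearMap.inl ℝ Q ℝ).hasFDerivAt
      have h3 := hd.comp q h2
      have h4 : (pt^[j] h) ∘ (fun q : Q => (q, (0 : ℝ))) = fun _ => 0 := by
        ext1 q'; exact h0 j q'
      rw [h4] at h3
      have h5 := h3.unique (hasFDerivAt_const 0 q)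
      have := congrArg (fun T => T v) h5
      simpa using this
    have e2 : fderiv ℝ (pt^[j] h) (q, 0) (0, 1) = 0 := by
      have := h0 (j + 1) q
      rwa [Function.iterate_succ_apply'] at this
    refine ContinuousLinearMap.ext fun w => ?_
    obtain ⟨v, s⟩ := w
    have : ((v, s) : Q × ℝ) = (v, 0) + s • (0, 1) := by ext <;> simp
    rw [this, map_add, map_smul, e1, e2]; simp

/-- flat functions with compact support -/
structure Flt {V : Type} [NormedAddCommGroup V] [NormedSpace ℝ V] (h : Q × ℝ → V) : Prop where
  smooth : ContDiff ℝ ∞ h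
  supp : HasCompactSupport h
  flat : ∀ q k, iteratedFDeriv ℝ k h (q, 0) = 0

theorem Flt.fderiv {h : Q × ℝ → V} (hh : Flt h) : Flt (fderiv ℝ h) where
  smooth := contDiff_fderiv hh.smooth
  supp := hh.supp.fderiv ℝ
  flat q k := by
    rw [← norm_eq_zero, norm_iteratedFDeriv_fderiv, hh.flat, norm_zero]

theorem Flt.bilin {V' V'' : Type} [NormedAddCommGroup V'] [NormedSpace ℝ V']
    [NormedAddCommGroup V''] [NormedSpace ℝ V''] (B : V →L[ℝ] V' →L[ℝ] V'')
    {h : Q × ℝ → V} (hh : Flt h) {A : Q × ℝ → V'} (hA : ContDiff ℝ ∞ A) :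
    Flt (fun z => B (h z) (A z)) where
  smooth := (B.contDiff.comp hh.smooth).clm_apply hA
  supp := hh.supp.mono' (by
    intro z hz
    apply subset_closure
    intro h0
    apply hz
    simp [h0])
  flat q k := by
    rw [← norm_eq_zero]
    refine le_antisymm ?_ (norm_nonneg _)
    refine (B.norm_iteratedFDeriv_le_of_bilinear hh.smooth hA (q, 0) (n := k)
      (by exact_mod_cast le_top)).trans ?_
    rw [Finset.sum_eq_zero]
    · simp
    · intro i _
      rw [hh.flat]; simp

theorem Flt.add {h h' : Q × ℝ → V} (hh : Flt h) (hh' : Flt h') : Flt (fun z => h z + h' z) where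
  smooth := hh.smooth.add hh'.smooth
  supp := hh.supp.add hh'.supp
  flat q k := by
    have := iteratedFDeriv_add_apply (x := (q, (0 : ℝ))) (𝕜 := ℝ) (i := k)
      (hh.smooth.contDiffAt.of_le (by exact_mod_cast le_top))
      (hh'.smooth.contDiffAt.of_le (by exact_mod_cast le_top))
    rw [hh.flat, hh'.flat, add_zero] at this
    exact this

theorem Flt.bound (n : ℕ) : ∀ {V : Type} [NormedAddCommGroup V] [NormedSpace ℝ V]
    {h : Q × ℝ → V}, Flt h → ∃ C, 0 ≤ C ∧ ∀ z, ‖h z‖ ≤ C * |z.2| ^ n := by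
  induction n with
  | zero =>
    intro V _ _ h hh
    obtain ⟨C, hC⟩ := hh.supp.exists_bound_of_continuous hh.smooth.continuous
    exact ⟨C, (norm_nonneg _).trans (hC 0), fun z => by simpa using hC z⟩
  | succ n ih =>
    intro V _ _ h hh
    obtain ⟨C, hC0, hC⟩ := ih hh.fderiv
    refine ⟨C, hC0, ?_⟩
    rintro ⟨q, t⟩
    have h0 : h (q, 0) = 0 := by
      have := hh.flat q 0
      rwa [← norm_eq_zero, norm_iteratedFDeriv_zero, norm_eq_zero] at this
    have hseg : ∀ z ∈ segment ℝ (q, (0 : ℝ)) (q, t), ‖_root_.fderiv ℝ h z‖ ≤ C * |t| ^ n := by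
      intro z hz
      refine (hC z).trans ?_
      have : |z.2| ≤ |t| := by
        obtain ⟨a, b, ha, hb, hab, rfl⟩ := hz
        have e : (a • (q, (0 : ℝ)) + b • (q, t)).2 = b * t := by simp
        rw [e, abs_mul, abs_of_nonneg hb]
        have : b ≤ 1 := by linarith
        nlinarith [abs_nonneg t]
      gcongr
    have := (convex_segment (𝕜 := ℝ) (q, (0 : ℝ)) (q, t)).norm_image_sub_le_of_norm_fderiv_le
      (f := h) (fun z _ => (hh.smooth.differentiable (by simp)).differentiableAt) hseg
      (left_mem_segment ℝ _ _) (right_mem_segment ℝ _ _)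
    rw [h0, sub_zero] at this
    refine this.trans (le_of_eq ?_)
    have : ‖((q, t) : Q × ℝ) - (q, 0)‖ = |t| := by simp [Prod.norm_def]
    rw [this, pow_succ]; ring

theorem flatten (h : Q × ℝ → ℝ) (hh : ContDiff ℝ ∞ h) (C : Set Q) (hC : IsCompact C)
    (hs : ∀ q t, q ∉ C → h (q, t) = 0) :
    ∃ h' : Q × ℝ → ℝ, ContDiff ℝ ∞ h' ∧ (∀ q k, iteratedFDeriv ℝ k h' (q, 0) = 0) ∧
      ∀ q, (∀ n : ℕ, (fun t => h (q, t)) =O[𝓝 0] fun t : ℝ => t ^ n) →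
        ∀ t, h' (q, t) = h (q, t) := by
  let a : ℕ → Q → ℝ := fun j q => (pt^[j] h) (q, 0) / j.factorial
  have ha : ∀ j, ContDiff ℝ ∞ (a j) := fun j =>
    ((pt_iter_contDiff hh j).comp (contDiff_id.prodMk contDiff_const)).div_const _
  have haD : ∀ j q, a j q = iteratedDeriv j (fun t => h (q, t)) 0 / j.factorial := by
    intro j q; rw [iteratedDeriv_pt hh]
  have hcs : ∀ q, ContDiff ℝ ∞ fun t => h (q, t) := fun q =>
    hh.comp (contDiff_const.prodMk contDiff_id)
  let Qf : ℕ → Q × (Unit → ℝ) → ℝ := fun j z => a j z.1 * z.2 () ^ j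
  obtain ⟨F, hF, hF0, hFa⟩ := borel (P := Q) (ι := Unit) (fun _ => 1) (fun _ => le_rfl) Qf
    (fun j => ((ha j).comp contDiff_fst).mul
      (((contDiff_apply ℝ ℝ ()).comp contDiff_snd).pow j))
    (fun j p t y => by simp only [Qf, dil_apply]; ring) C hC
    (fun j p y hp => by
      have : (fun t => h (p, t)) = fun _ => 0 := funext fun t => hs p t hp
      simp only [Qf]; rw [haD, this]; simp [iteratedDeriv_const]) 1
  have hcut : ContDiff ℝ ∞ fun z : Q × ℝ => F (z.1, fun _ => z.2) :=
    hF.comp (contDiff_fst.prodMk (contDiff_pi.2 fun _ => contDiff_snd))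
  refine ⟨fun z => h z - F (z.1, fun _ => z.2), hh.sub hcut, ?_, ?_⟩
  · intro q k
    refine flat_of_pt k (hh.sub hcut) ?_ q
    intro j q
    have e := congrFun (iteratedDeriv_pt (hh.sub hcut) j q) 0
    rw [← e]
    refine flat1 _ ((hcs q).sub (hcut.comp (contDiff_const.prodMk contDiff_id))) ?_ j
    have key : ∀ n : ℕ, (fun t => h (q, t) - F (q, fun _ => t)) =O[𝓝 0]
        fun t : ℝ => t ^ (n + 1) := by
      intro n
      have h1 := taylor1 _ (hcs q) n
      have h2 := hFa n q (fun _ => 1) (by simp)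
      refine (h1.sub h2).congr_left fun t => ?_
      have e1 : dil (fun _ : Unit => 1) t (fun _ => 1) = fun _ => t := by
        ext i; rw [dil_apply]; simp
      rw [e1]
      have e2 : ∀ j, Qf j (q, fun _ => 1) = iteratedDeriv j (fun t => h (q, t)) 0 / j.factorial := by
        intro j; simp only [Qf, one_pow, mul_one]; rw [haD]
      simp only [e2]
      ring
    intro n
    cases n with
    | zero => exact (key 0).trans (by
        simpa using (Asymptotics.isLittleO_pow_pow (𝕜 := ℝ) (m := 0) (n := 1) (by omega)).isBigO)
    | succ n => exact key n
  · intro q hq t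
    have : ∀ j, Qf j (q, fun _ => t) = 0 := by
      intro j
      simp only [Qf]
      rw [haD, flat1 _ (hcs q) hq]; simp
    simp only [hF0 q _ this, sub_zero]

theorem flat_pullback {E : Type} [NormedAddCommGroup E] [NormedSpace ℝ E] (l : E →L[ℝ] ℝ)
    (Ψ : E → Q × ℝ) (A : Q × ℝ → (E →L[ℝ] Q × ℝ)) (M : ℕ) (hA : ContDiff ℝ ∞ A)
    (hΨ2 : ∀ z, (Ψ z).2 = Real.sqrt (l z))
    (hΨ : ∀ z, 0 < l z → HasFDerivAt Ψ ((((Ψ z).2) ^ M)⁻¹ • A (Ψ z)) z) (n : ℕ) :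
    ∀ {V : Type} [NormedAddCommGroup V] [NormedSpace ℝ V] {h : Q × ℝ → V} (a : ℕ), Flt h →
      ContDiff ℝ n (fun z => if 0 < l z then (((Ψ z).2) ^ a)⁻¹ • h (Ψ z) else 0) := by
  have main : ∀ {V : Type} [NormedAddCommGroup V] [NormedSpace ℝ V] {h : Q × ℝ → V} (a : ℕ),
      Flt h → ∃ h' : Q × ℝ → (E →L[ℝ] V), Flt h' ∧ ∀ z,
        HasFDerivAt (fun z => if 0 < l z then (((Ψ z).2) ^ a)⁻¹ • h (Ψ z) else 0)
          (if 0 < l z then (((Ψ z).2) ^ (a + M + 1))⁻¹ • h' (Ψ z) else 0) z := by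
    intro V _ _ h a hh
    let sA : Q × ℝ → (E →L[ℝ] ℝ) := fun w => (ContinuousLinearMap.snd ℝ Q ℝ).comp (A w)
    have hsA : ContDiff ℝ ∞ sA :=
      (ContinuousLinearMap.compL ℝ E (Q × ℝ) ℝ (ContinuousLinearMap.snd ℝ Q ℝ)).contDiff.comp hA
    let h1 : Q × ℝ → (E →L[ℝ] V) := fun w => (_root_.fderiv ℝ h w).comp (w.2 • A w)
    let h2 : Q × ℝ → (E →L[ℝ] V) := fun w => ((-(a : ℝ)) • sA w).smulRight (h w)
    have hh1 : Flt h1 := hh.fderiv.bilin (ContinuousLinearMap.compL ℝ E (Q × ℝ) V)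
      (contDiff_snd.smul hA)
    have hh2 : Flt h2 := hh.bilin (ContinuousLinearMap.smulRightL ℝ E V).flip
      (hsA.const_smul (-(a : ℝ)))
    refine ⟨fun w => h1 w + h2 w, hh1.add hh2, ?_⟩
    intro z
    by_cases hz : 0 < l z
    · have hev : (fun z => if 0 < l z then (((Ψ z).2) ^ a)⁻¹ • h (Ψ z) else 0) =ᶠ[𝓝 z]
          fun z => (((Ψ z).2) ^ a)⁻¹ • h (Ψ z) := by
        filter_upwards [(isOpen_lt continuous_const l.continuous).mem_nhds hz] with w hw
        exact if_pos hw
      rw [if_pos hz]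
      refine HasFDerivAt.congr_of_eventuallyEq ?_ hev
      set t := (Ψ z).2 with ht
      have htp : 0 < t := by rw [ht, hΨ2]; exact Real.sqrt_pos.2 hz
      have d1 : HasFDerivAt (fun z => h (Ψ z))
          ((_root_.fderiv ℝ h (Ψ z)).comp ((t ^ M)⁻¹ • A (Ψ z))) z :=
        ((hh.smooth.differentiable (by simp)).differentiableAt.hasFDerivAt).comp z (hΨ z hz)
      have d2 : HasFDerivAt (fun z => (Ψ z).2)
          ((ContinuousLinearMap.snd ℝ Q ℝ).comp ((t ^ M)⁻¹ • A (Ψ z))) z :=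
        (ContinuousLinearMap.snd ℝ Q ℝ).hasFDerivAt.comp z (hΨ z hz)
      have d3 : HasDerivAt (fun s : ℝ => (s ^ a)⁻¹) (-(a : ℝ) * (t ^ (a + 1))⁻¹) t := by
        have := (hasDerivAt_pow a t).inv (pow_ne_zero a htp.ne')
        refine HasDerivAt.congr_deriv this ?_
        clear this
        generalize t = t at htp
        rcases Nat.eq_zero_or_pos a with rfl | ha
        · simp
        · obtain ⟨c, rfl⟩ : ∃ c, a = c + 1 := ⟨a - 1, by omega⟩
          simp only [Nat.add_sub_cancel]; field_simp
          ring
      have d4 := (d3.comp_hasFDerivAt z d2).smul d1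
      refine d4.congr_fderiv ?_
      refine ContinuousLinearMap.ext fun v => ?_
      simp only [h1, h2, sA, ContinuousLinearMap.add_apply, ContinuousLinearMap.smul_apply,
        ContinuousLinearMap.comp_apply, ContinuousLinearMap.smulRight_apply, map_smul,
        Function.comp_apply, smul_add, smul_smul, smul_eq_mul, ContinuousLinearMap.coe_snd', ← ht]
      have e1 : (t ^ (a + M + 1))⁻¹ * t = (t ^ a)⁻¹ * (t ^ M)⁻¹ := by
        field_simp
        ring
      have e2 : (t ^ (a + M + 1))⁻¹ = (t ^ (a + 1))⁻¹ * (t ^ M)⁻¹ := by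
        field_simp
        ring
      rw [e1, e2]
      congr 2
      ring
    · rw [if_neg hz]
      obtain ⟨C, hC0, hC⟩ := Flt.bound (a + 4) hh
      refine Asymptotics.IsBigO.hasFDerivAt (n := 2) ?_ (by norm_num)
      refine Asymptotics.IsBigO.of_bound (C * ‖l‖ ^ 2) (Filter.Eventually.of_forall fun w => ?_)
      by_cases hw : 0 < l w
      · rw [if_pos hw]
        set t := (Ψ w).2 with ht
        have htp : 0 < t := by rw [ht, hΨ2]; exact Real.sqrt_pos.2 hw
        have ht2 : t ^ 2 = l w := by rw [ht, hΨ2]; exact Real.sq_sqrt hw.le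
        rw [norm_smul, norm_inv, norm_pow, Real.norm_eq_abs, abs_of_pos htp]
        have h3 := hC (Ψ w)
        rw [← ht, abs_of_pos htp] at h3
        have h4 : l w ≤ ‖l‖ * ‖w - z‖ := by
          have h5 := (le_abs_self _).trans (l.le_opNorm (w - z))
          rw [map_sub] at h5
          linarith
        calc (t ^ a)⁻¹ * ‖h (Ψ w)‖ ≤ (t ^ a)⁻¹ * (C * t ^ (a + 4)) := by gcongr
          _ = C * (t ^ 2) ^ 2 := by field_simp; ring
          _ = C * (l w) ^ 2 := by rw [ht2]
          _ ≤ C * (‖l‖ * ‖w - z‖) ^ 2 := by gcongr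
          _ = C * ‖l‖ ^ 2 * ‖‖w - z‖ ^ 2‖ := by
            rw [norm_pow, norm_norm]; ring
      · rw [if_neg hw, norm_zero]; positivity
  induction n with
  | zero =>
    intro V _ _ h a hh
    obtain ⟨h', -, hd⟩ := main a hh
    rw [Nat.cast_zero, contDiff_zero]
    exact continuous_iff_continuousAt.2 fun z => (hd z).continuousAt
  | succ n ih =>
    intro V _ _ h a hh
    obtain ⟨h', hh', hd⟩ := main a hh
    rw [Nat.cast_succ, contDiff_succ_iff_hasFDerivAt]
    exact ⟨_, ih (a + M + 1) hh', hd⟩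

end

end Schwarz

namespace Schwarz

open scoped ContDiff Topology Manifold

set_option linter.all false
set_option linter.unusedSectionVars false
set_option linter.style.haveILetI false
set_option linter.unusedSimpArgs false

/-! ### Part G: gluing and local factorization away from the origin -/

theorem glue {Z X : Type} [NormedAddCommGroup Z] [NormedSpace ℝ Z] [FiniteDimensional ℝ Z]
    (Φ : X → Z) (A : Set X) (f : X → ℝ) (hcl : IsClosed (Φ '' A))
    (hloc : ∀ a ∈ A, ∃ U ∈ 𝓝 (Φ a), ∃ F : Z → ℝ, ContDiffOn ℝ ∞ F U ∧
      ∀ x ∈ A, Φ x ∈ U → F (Φ x) = f x) :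
    ∃ F : Z → ℝ, ContDiff ℝ ∞ F ∧ ∀ x ∈ A, F (Φ x) = f x := by
  obtain ⟨g, hg⟩ := exists_contMDiffMap_forall_mem_convex_of_local (n := (⊤ : ℕ∞)) 𝓘(ℝ, Z)
    (t := fun z => {v : ℝ | ∀ x ∈ A, Φ x = z → v = f x}) (by
      intro z v hv w hw a b ha hb hab x hx hxz
      rw [hv x hx hxz, hw x hx hxz, ← add_smul, hab, one_smul]) (by
      intro z
      by_cases hz : z ∈ Φ '' A
      · obtain ⟨a, ha, rfl⟩ := hz
        obtain ⟨U, hU, F, hF, hFx⟩ := hloc a ha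
        refine ⟨U, hU, F, contMDiffOn_iff_contDiffOn.2 hF, ?_⟩
        rintro y hy x hx rfl
        exact hFx x hx hy
      · refine ⟨(Φ '' A)ᶜ, hcl.isOpen_compl.mem_nhds hz, fun _ => 0, contMDiffOn_const, ?_⟩
        rintro y hy x hx rfl
        exact absurd ⟨x, hx, rfl⟩ hy)
  exact ⟨g, contMDiff_iff_contDiff.1 g.contMDiff, fun x hx => hg (Φ x) x hx rfl⟩

theorem mv_contDiff {ι : Type} [Fintype ι] (B : MvPolynomial ι ℝ) {n : WithTop ℕ∞} :
    ContDiff ℝ n fun y : ι → ℝ => MvPolynomial.eval y B :=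
  poly_contDiff (poly_eval (σ := fun i (y : ι → ℝ) => y i)
    (fun i => poly_clm (ContinuousLinearMap.proj (R := ℝ) (φ := fun _ : ι => ℝ) i)) B)

theorem mv_bigO {ι : Type} [Fintype ι] (B : MvPolynomial ι ℝ)
    (hB : ∀ s ∈ B.support, 2 ≤ ∑ i, s i) :
    (fun y : ι → ℝ => MvPolynomial.eval y B) =O[𝓝 0] fun y : ι → ℝ => ‖y - 0‖ ^ 2 := by
  have : (fun y : ι → ℝ => MvPolynomial.eval y B)
      = fun y => ∑ s ∈ B.support, B.coeff s * ∏ i, y i ^ s i := by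
    ext y; exact MvPolynomial.eval_eq' y B
  rw [this]
  refine Asymptotics.IsBigO.fun_sum fun s hs => ?_
  refine Asymptotics.IsBigO.const_mul_left ?_ _
  refine Asymptotics.IsBigO.of_bound 1 ?_
  filter_upwards [Metric.closedBall_mem_nhds (0 : ι → ℝ) one_pos] with y hy
  rw [mem_closedBall_zero_iff] at hy
  rw [one_mul, norm_prod, sub_zero, norm_pow, norm_norm]
  calc ∏ i, ‖y i ^ s i‖ ≤ ∏ i, ‖y‖ ^ s i := by
        refine Finset.prod_le_prod (fun _ _ => norm_nonneg _) fun i _ => ?_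
        rw [norm_pow]
        exact pow_le_pow_left₀ (norm_nonneg _) (norm_le_pi_norm y i) _
    _ = ‖y‖ ^ ∑ i, s i := Finset.prod_pow_eq_pow_sum _ _ _
    _ ≤ ‖y‖ ^ 2 := pow_le_pow_of_le_one (norm_nonneg _) hy (hB s hs)

section
variable {G : Type} [Group G] [TopologicalSpace G] [IsTopologicalGroup G] [CompactSpace G]
variable {W : Type} [NormedAddCommGroup W] [InnerProductSpace ℝ W] [FiniteDimensional ℝ W]
variable {ρ : G →* (W →ₗᵢ[ℝ] W)} {θ : W}

theorem HS_inv_rep (hρ : CtsRep ρ) {ι : Type} [Fintype ι] {τ : ι → W → ℝ} {e : ι → ℕ} {j0 : ι}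
    (H : HGen ρ τ e j0) {D : ℕ} {r : W → ℝ} (hr : r ∈ HS W D) (hi : Inv ρ r) :
    ∃ R : MvPolynomial ι ℝ, (∀ s ∈ R.support, D ≤ ∑ i, s i * e i) ∧
      ∀ x, r x = MvPolynomial.eval (fun i => τ i x) R := by
  classical
  have hcc : ∀ {p : W → ℝ}, p ∈ HS W D → ∀ x, Continuous fun g => p (ρ g x) := fun hp x =>
    (poly_continuous (HS_le_poly hp)).comp (hρ.cont continuous_id continuous_const)
  suffices hh : r ∈ HS W D ∧ ∃ R : MvPolynomial ι ℝ, (∀ s ∈ R.support, D ≤ ∑ i, s i * e i) ∧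
      ∀ x, av (fun g => r (ρ g x)) = MvPolynomial.eval (fun i => τ i x) R by
    obtain ⟨-, R, h1, h2⟩ := hh
    exact ⟨R, h1, fun x => by rw [← h2, avg_of_inv hi]⟩
  refine Submodule.iSup_induction (fun j : Set.Ici D => HomPoly W j)
    (motive := fun r => r ∈ HS W D ∧ ∃ R : MvPolynomial ι ℝ,
      (∀ s ∈ R.support, D ≤ ∑ i, s i * e i) ∧
      ∀ x, av (fun g => r (ρ g x)) = MvPolynomial.eval (fun i => τ i x) R) hr ?_ ?_ ?_
  · intro j q hq
    refine ⟨homPoly_le_HS j.2 hq, ?_⟩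
    obtain ⟨B, hB, hBx⟩ := H.gen_hom (avg_poly hρ hq.1)
      (avg_inv hρ (poly_continuous hq.1)) (avg_hom hq.2)
    refine ⟨B, fun s hs => ?_, hBx⟩
    have := hB (MvPolynomial.mem_support_iff.1 hs)
    rw [Finsupp.weight_apply, Finsupp.sum_fintype _ _ (by simp)] at this
    simp only [smul_eq_mul] at this
    rw [this]
    exact j.2
  · exact ⟨Submodule.zero_mem _, 0, by simp, by simp [av_const]⟩
  · rintro x y ⟨h1, R, hR, hRx⟩ ⟨h2, R', hR', hRx'⟩
    refine ⟨Submodule.add_mem _ h1 h2, R + R', ?_, ?_⟩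
    · intro s hs
      rcases Finset.mem_union.1 (MvPolynomial.support_add hs) with h | h
      · exact hR s h
      · exact hR' s h
    · intro z
      rw [map_add, ← hRx, ← hRx']
      exact av_add (hcc h1 z) (hcc h2 z)

/-- The factorization property, with parameters, for all finite generating families. -/
def Good {G : Type} [Group G] {W : Type} [NormedAddCommGroup W] [InnerProductSpace ℝ W]
    (ρ : G →* (W →ₗᵢ[ℝ] W)) : Prop :=
  ∀ (P : Type) [NormedAddCommGroup P] [NormedSpace ℝ P] [FiniteDimensional ℝ P] (f : P × W → ℝ),
    ContDiff ℝ ∞ f → (∀ p g x, f (p, ρ g x) = f (p, x)) →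
    ∀ (ι : Type) [Fintype ι] (τ : ι → W → ℝ), (∀ i, τ i ∈ Poly W) →
      (∀ p, p ∈ Poly W → Inv ρ p →
        ∃ B : MvPolynomial ι ℝ, ∀ x, p x = MvPolynomial.eval (fun i => τ i x) B) →
      ∃ F : P × (ι → ℝ) → ℝ, ContDiff ℝ ∞ F ∧ ∀ p x, f (p, x) = F (p, fun i => τ i x)

theorem good_of_one {ι : Type} [Fintype ι] {σ : ι → W → ℝ} {d : ι → ℕ} {i0 : ι}
    (H : HGen ρ σ d i0)
    (h : ∀ (P : Type) [NormedAddCommGroup P] [NormedSpace ℝ P] [FiniteDimensional ℝ P]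
      (f : P × W → ℝ), ContDiff ℝ ∞ f → (∀ p g x, f (p, ρ g x) = f (p, x)) →
      ∃ F : P × (ι → ℝ) → ℝ, ContDiff ℝ ∞ F ∧ ∀ p x, f (p, x) = F (p, fun i => σ i x)) :
    Good ρ := by
  intro P _ _ _ f hf hfi κ _ τ hτ hgen
  obtain ⟨F, hF, hFx⟩ := h P f hf hfi
  choose B hB using fun i => hgen (σ i) (H.poly i) (H.inv i)
  refine ⟨fun z => F (z.1, fun i => MvPolynomial.eval z.2 (B i)),
    hF.comp (contDiff_fst.prodMk (contDiff_pi.2 fun i => (mv_contDiff (B i)).comp contDiff_snd)),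
    fun p x => ?_⟩
  rw [hFx]
  simp only [← hB]

theorem local_fac (hρ : CtsRep ρ) {ι : Type} [Fintype ι] {σ : ι → W → ℝ} {d : ι → ℕ} {i0 : ι}
    (H : HGen ρ σ d i0) (θ : W) (hG : Good (repN ρ θ))
    {P : Type} [NormedAddCommGroup P] [NormedSpace ℝ P] [FiniteDimensional ℝ P]
    (f : P × W → ℝ) (hf : ContDiff ℝ ∞ f) (hfi : ∀ p g x, f (p, ρ g x) = f (p, x)) (p0 : P) :
    ∃ U ∈ 𝓝 (p0, fun i => σ i θ), ∃ F : P × (ι → ℝ) → ℝ, ContDiffOn ℝ ∞ F U ∧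
      ∀ p x, (p, fun i => σ i x) ∈ U → F (p, fun i => σ i x) = f (p, x) := by
  classical
  haveI := stab_compact (θ := θ) hρ
  have hrN : CtsRep (repN ρ θ) := subRep_cts hρ
  obtain ⟨κ, _, τ, e, j0, HN⟩ := hilbert hrN
  have hfix : ∀ (l : stab ρ θ) (n : nrm ρ θ), θ + (repN ρ θ l n : W) = ρ (l : G) (θ + n) := by
    intro l n
    rw [map_add]
    have h1 : ρ (l : G) θ = θ := l.2
    rw [h1]; rfl
  obtain ⟨F1, hF1, hF1x⟩ := hG P (fun z => f (z.1, θ + z.2))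
    (hf.comp (contDiff_fst.prodMk (contDiff_const.add
      ((nrm ρ θ).subtypeL.contDiff.comp contDiff_snd))))
    (fun p l n => by
      show f (p, θ + (repN ρ θ l n : W)) = _
      rw [hfix, hfi]) κ τ HN.poly HN.gen
  -- the jets
  set D := ∑ j, e j with hD
  have hDe : ∀ j, e j ≤ D := fun j =>
    Finset.single_le_sum (fun _ _ => Nat.zero_le _) (Finset.mem_univ j)
  choose Pj hPj hPi hPr using fun j => jet hρ (HN.poly j) (HN.inv j) (D + 1)
  have hri : ∀ j, Inv (repN ρ θ) (fun n : nrm ρ θ => Pj j (θ + n) - τ j n) := by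
    intro j l n
    show Pj j (θ + (repN ρ θ l n : W)) - τ j (repN ρ θ l n) = _
    rw [hfix, hPi, HN.inv j l n]
  choose R hR hRx using fun j => HS_inv_rep hrN HN (hPr j) (hri j)
  choose B hB using fun j => H.gen (Pj j) (hPj j) (hPi j)
  let φ : (κ → ℝ) → (κ → ℝ) := fun y j => y j + MvPolynomial.eval y (R j)
  have hφ : ContDiff ℝ ω φ := contDiff_pi.2 fun j => (contDiff_apply ℝ ℝ j).add (mv_contDiff (R j))
  have hR2 : ∀ j, ∀ s ∈ (R j).support, 2 ≤ ∑ i, s i := by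
    intro j s hs
    have h1 := hR j s hs
    by_contra hlt
    have h2 : ∑ i, s i * e i ≤ (∑ i, s i) * D := by
      rw [Finset.sum_mul]
      exact Finset.sum_le_sum fun i _ => Nat.mul_le_mul_left _ (hDe i)
    have h3 : (∑ i, s i) * D ≤ 1 * D := Nat.mul_le_mul_right _ (by omega)
    omega
  have hRd : ∀ j, HasFDerivAt (fun y : κ → ℝ => MvPolynomial.eval y (R j))
      (0 : (κ → ℝ) →L[ℝ] ℝ) 0 := fun j =>
    Asymptotics.IsBigO.hasFDerivAt (mv_bigO (R j) (hR2 j)) (by norm_num)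
  have hR0 : ∀ j, MvPolynomial.eval (0 : κ → ℝ) (R j) = 0 := by
    intro j
    have := (mv_bigO (R j) (hR2 j)).eq_zero_of_norm_pow (by norm_num)
    simpa using this
  have hφ0 : φ 0 = 0 := by
    ext j
    show (0 : ℝ) + MvPolynomial.eval (0 : κ → ℝ) (R j) = 0
    rw [hR0, add_zero]
  have hφd : HasFDerivAt φ ((ContinuousLinearEquiv.refl ℝ (κ → ℝ) : (κ → ℝ) ≃L[ℝ] (κ → ℝ)) :
      (κ → ℝ) →L[ℝ] (κ → ℝ)) 0 := by
    refine hasFDerivAt_pi'.2 fun j => ?_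
    have h1 : HasFDerivAt (fun y : κ → ℝ => y j)
        (ContinuousLinearMap.proj (R := ℝ) (φ := fun _ : κ => ℝ) j) 0 :=
      (ContinuousLinearMap.proj (R := ℝ) (φ := fun _ : κ => ℝ) j).hasFDerivAt
    refine (h1.add (hRd j)).congr_fderiv ?_
    ext v; simp
  let ψ := hφ.contDiffAt.localInverse hφd (by simp)
  have hψ : ContDiffAt ℝ ω ψ 0 := by
    have := hφ.contDiffAt.to_localInverse hφd (by simp)
    rwa [hφ0] at this
  have hψl : ∀ᶠ y in 𝓝 (0 : κ → ℝ), ψ (φ y) = y :=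
    (hφ.contDiffAt.hasStrictFDerivAt' hφd (by simp)).eventually_left_inverse
  have hψe : ∀ᶠ y in 𝓝 (0 : κ → ℝ), ContDiffAt ℝ ω ψ y := hψ.eventually (by simp)
  have hτ0 : (fun j => τ j (0 : nrm ρ θ)) = 0 := by
    ext j
    have := HN.hom j 0 0
    rw [smul_zero, zero_pow (by have := HN.pos j; omega), zero_mul] at this
    exact this
  have hPφ : ∀ n : nrm ρ θ, (fun j => Pj j (θ + n)) = φ (fun j => τ j n) := by
    intro n; ext j
    have := hRx j n
    simp only [φ, ← this]; ring
  let Bv : (ι → ℝ) → (κ → ℝ) := fun y j => MvPolynomial.eval y (B j)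
  have hBv : ContDiff ℝ ∞ Bv := contDiff_pi.2 fun j => mv_contDiff (B j)
  have hBσ : ∀ x, Bv (fun i => σ i x) = fun j => Pj j x := by
    intro x; ext j; exact (hB j x).symm
  have hB0 : Bv (fun i => σ i θ) = 0 := by
    rw [hBσ]
    have := hPφ 0
    simp only [Submodule.coe_zero, add_zero] at this
    rw [this, hτ0, hφ0]
  have ht : Filter.Tendsto (fun n : nrm ρ θ => fun j => τ j n) (𝓝 0) (𝓝 0) := by
    have := HN.continuous.tendsto 0
    rwa [hτ0] at this
  obtain ⟨ε, hε, hball⟩ := Metric.eventually_nhds_iff_ball.1 (ht.eventually hψl)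
  have hnear := HGen.near hρ H θ hε
  have hcB : Filter.Tendsto Bv (𝓝 (fun i => σ i θ)) (𝓝 0) := by
    have := hBv.continuous.tendsto (fun i => σ i θ)
    rwa [hB0] at this
  let U : Set (P × (ι → ℝ)) := {z | (∀ x, (fun i => σ i x) = z.2 → ∃ g, ‖ρ g x - θ‖ < ε) ∧
    ContDiffAt ℝ ω ψ (Bv z.2)}
  refine ⟨U, ?_, fun z => F1 (z.1, ψ (Bv z.2)), ?_, ?_⟩
  · have h1 : ∀ᶠ y in 𝓝 (fun i => σ i θ), (∀ x, (fun i => σ i x) = y → ∃ g, ‖ρ g x - θ‖ < ε) ∧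
        ContDiffAt ℝ ω ψ (Bv y) := hnear.and (hcB.eventually hψe)
    exact (continuous_snd.tendsto (p0, fun i => σ i θ)).eventually h1
  · intro z hz
    have h1 : ContDiffAt ℝ ∞ ψ (Bv z.2) := hz.2.of_le (by exact_mod_cast le_top)
    have h2 : ContDiffAt ℝ ∞ (fun z : P × (ι → ℝ) => ψ (Bv z.2)) z :=
      ContDiffAt.comp z h1 (hBv.comp contDiff_snd).contDiffAt
    exact (hF1.contDiffAt.comp z (contDiffAt_fst.prodMk h2)).contDiffWithinAt
  · rintro p x ⟨hU1, -⟩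
    obtain ⟨g0, hg0⟩ := hU1 x rfl
    obtain ⟨g, hgN, hgm⟩ := slice (θ := θ) hρ x
    have hlt : ‖ρ g x - θ‖ < ε := (hgm g0).trans_lt hg0
    let n : nrm ρ θ := ⟨ρ g x - θ, hgN⟩
    have hn : θ + (n : W) = ρ g x := by simp [n]
    have h3 : ψ (φ (fun j => τ j n)) = fun j => τ j n := hball n (by
      rw [mem_ball_zero_iff]; exact hlt)
    have h4 : Bv (fun i => σ i x) = φ (fun j => τ j n) := by
      rw [hBσ, ← hPφ]; ext j
      rw [hn, hPi]
    show F1 (p, ψ (Bv fun i => σ i x)) = f (p, x)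
    rw [h4, h3, ← hF1x]
    show f (p, θ + (n : W)) = _
    rw [hn, hfi]

end

end Schwarz

namespace Schwarz

open scoped ContDiff Topology Manifold

set_option linter.all false
set_option linter.unusedSectionVars false
set_option linter.style.haveILetI false
set_option linter.unusedSimpArgs false

/-! ### Part H: splitting off a fixed vector -/

section
variable {G : Type} [Group G] [TopologicalSpace G] [IsTopologicalGroup G] [CompactSpace G]
variable {W : Type} [NormedAddCommGroup W] [InnerProductSpace ℝ W] [FiniteDimensional ℝ W]
variable {ρ : G →* (W →ₗᵢ[ℝ] W)} {θ : W}

/-- The orthogonal complement of a vector. -/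
noncomputable def perp (v : W) : Submodule ℝ W := LinearMap.ker (innerSL ℝ v : W →L[ℝ] ℝ).toLinearMap

theorem mem_perp {v x : W} : x ∈ perp v ↔ inner ℝ v x = 0 := Iff.rfl

theorem perp_stable {v : W} (hv : ∀ g, ρ g v = v) : ∀ l ∈ (⊤ : Subgroup G), ∀ n ∈ perp v, ρ l n ∈ perp v := by
  intro l _ n hn
  rw [mem_perp] at *
  rw [← hn]
  conv_lhs => rw [← hv l]
  exact (ρ l).inner_map_map v n

theorem perp_lt {v : W} (hv : v ≠ 0) : Module.finrank ℝ (perp v) < Module.finrank ℝ W := by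
  refine Submodule.finrank_lt fun h => hv ?_
  have : v ∈ perp v := h ▸ Submodule.mem_top
  exact inner_self_eq_zero.1 (mem_perp.1 this)

theorem good_extend (hρ : CtsRep ρ) {v : W} (hv0 : v ≠ 0) (hv : ∀ g, ρ g v = v)
    (hG : Good (subRep ρ ⊤ (perp v) (perp_stable hv))) : Good ρ := by
  classical
  intro P _ _ _ f hf hfi ι _ τ hτ hgen
  haveI : CompactSpace (⊤ : Subgroup G) := isCompact_iff_compactSpace.1 (by simpa using isCompact_univ)
  have hr := subRep_cts hρ (h := perp_stable hv)
  obtain ⟨κ, _, τ', e, j0, H'⟩ := hilbert hr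
  let s : W →L[ℝ] ℝ := (‖v‖ ^ 2)⁻¹ • innerSL ℝ v
  have hs : ∀ x, s x = (‖v‖ ^ 2)⁻¹ * inner ℝ v x := fun x => rfl
  have hvn : ‖v‖ ^ 2 ≠ 0 := by simpa using hv0
  have hsg : ∀ g x, s (ρ g x) = s x := by
    intro g x
    rw [hs, hs]
    conv_lhs => rw [← hv g]
    rw [(ρ g).inner_map_map v x, (ρ g).norm_map]
  let T : W →L[ℝ] W := ContinuousLinearMap.id ℝ W - s.smulRight v
  have hT : ∀ x, T x = x - s x • v := fun x => rfl
  have hTm : ∀ x, T x ∈ perp v := by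
    intro x
    rw [mem_perp, hT, inner_sub_right, inner_smul_right, real_inner_self_eq_norm_sq, hs]
    field_simp; ring
  let T' : W →L[ℝ] perp v := T.codRestrict (perp v) hTm
  have hT' : ∀ x, (T' x : W) = x - s x • v := fun x => rfl
  have hdec : ∀ x, s x • v + (T' x : W) = x := fun x => by rw [hT']; abel
  have hTg : ∀ g x, T' (ρ g x) = subRep ρ ⊤ (perp v) (perp_stable hv) ⟨g, trivial⟩ (T' x) := by
    intro g x
    apply Subtype.ext
    rw [subRep_coe, hT', hT', hsg, map_sub, map_smul, hv]
  obtain ⟨F, hF, hFx⟩ := hG (P × ℝ) (fun z => f (z.1.1, z.1.2 • v + (z.2 : W)))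
    (hf.comp ((contDiff_fst.comp contDiff_fst).prodMk
      (((contDiff_snd.comp contDiff_fst).smul contDiff_const).add
        ((perp v).subtypeL.contDiff.comp contDiff_snd))))
    (fun p l n => by
      show f (p.1, p.2 • v + ρ (l : G) (n : W)) = f (p.1, p.2 • v + (n : W))
      rw [← hfi p.1 (l : G) (p.2 • v + (n : W)), map_add, map_smul, hv]) κ τ' H'.poly H'.gen
  obtain ⟨B0, hB0⟩ := hgen (fun x => s x) (poly_clm s) hsg
  choose B hB using fun j => hgen (fun x => τ' j (T' x)) (poly_comp_clm T' (H'.poly j)) (by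
    intro g x
    show τ' j (T' (ρ g x)) = τ' j (T' x)
    rw [hTg, H'.inv j])
  refine ⟨fun z => F ((z.1, MvPolynomial.eval z.2 B0), fun j => MvPolynomial.eval z.2 (B j)),
    hF.comp ((contDiff_fst.prodMk ((mv_contDiff B0).comp contDiff_snd)).prodMk
      (contDiff_pi.2 fun j => (mv_contDiff (B j)).comp contDiff_snd)), fun p x => ?_⟩
  have h1 := hFx (p, s x) (T' x)
  simp only [hdec] at h1
  rw [h1]
  simp only [← hB, ← hB0]

end

end Schwarz

namespace Schwarz

open scoped ContDiff Topology Manifold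

set_option linter.all false
set_option linter.unusedSectionVars false
set_option linter.style.haveILetI false
set_option linter.unusedSimpArgs false

/-! ### Part I: Taylor expansion at the origin -/

theorem cutoff {E : Type} [NormedAddCommGroup E] [NormedSpace ℝ E] [FiniteDimensional ℝ E] (R : ℝ) :
    ∃ χ : E → ℝ, ContDiff ℝ ∞ χ ∧ HasCompactSupport χ ∧ ∀ x, ‖x‖ ≤ R → χ x = 1 := by
  let b : ContDiffBump (0 : E) := ⟨|R| + 1, |R| + 2, by positivity, by linarith⟩
  refine ⟨b, b.contDiff, b.hasCompactSupport, fun x hx => b.one_of_mem_closedBall ?_⟩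
  rw [mem_closedBall_zero_iff]
  exact hx.trans ((le_abs_self R).trans (by show |R| ≤ |R| + 1; linarith))

theorem hom_poly {W : Type} [NormedAddCommGroup W] [NormedSpace ℝ W] [FiniteDimensional ℝ W]
    (j : ℕ) : ∀ (u : W → ℝ), ContDiff ℝ ∞ u → IsHom j u → u ∈ Poly W := by
  induction j with
  | zero =>
    intro u hu h
    have : u = fun _ => u 0 := by
      ext x
      have := h 0 x
      rw [zero_smul, pow_zero, one_mul] at this
      exact this.symm
    rw [this]
    exact poly_const _
  | succ j ih =>
    intro u hu h
    have hd : Differentiable ℝ u := hu.differentiable (by simp)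
    have hc : ContDiff ℝ ∞ (fderiv ℝ u) := contDiff_fderiv hu
    have h1 : ∀ w, IsHom j (fun x => fderiv ℝ u x w) := by
      intro w t x
      have key : ∀ s : ℝ, s ≠ 0 → fderiv ℝ u (s • x) w = s ^ j * fderiv ℝ u x w := by
        intro s hs
        have e1 : HasFDerivAt (fun x => u (s • x))
            ((fderiv ℝ u (s • x)).comp (s • ContinuousLinearMap.id ℝ W)) x :=
          (hd (s • x)).hasFDerivAt.comp x ((hasFDerivAt_id x).const_smul s)
        have e2 : HasFDerivAt (fun x => u (s • x)) (s ^ (j + 1) • fderiv ℝ u x) x := by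
          have : (fun x => u (s • x)) = fun x => s ^ (j + 1) * u x := by ext x; exact h s x
          rw [this]
          exact (hd x).hasFDerivAt.const_mul _
        have e3 := congrArg (fun L : W →L[ℝ] ℝ => L w) (e1.unique e2)
        simp only [ContinuousLinearMap.comp_apply, ContinuousLinearMap.smul_apply,
          ContinuousLinearMap.id_apply, map_smul, smul_eq_mul] at e3
        have : s * (fderiv ℝ u (s • x) w) = s * (s ^ j * fderiv ℝ u x w) := by
          rw [e3]; ring
        exact mul_left_cancel₀ hs this
      have c1 : Continuous fun s : ℝ => fderiv ℝ u (s • x) w :=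
        (hc.continuous.comp (continuous_id.smul continuous_const)).clm_apply continuous_const
      have c2 : Continuous fun s : ℝ => s ^ j * fderiv ℝ u x w := by fun_prop
      have := Continuous.ext_on (dense_compl_singleton (0 : ℝ)) c1 c2 (fun s hs => key s hs)
      exact congrFun this t
    have h2 : ∀ x, fderiv ℝ u x x = (j + 1) * u x := by
      intro x
      have e1 : HasDerivAt (fun t : ℝ => u (t • x)) (fderiv ℝ u x x) 1 := by
        have a1 : HasDerivAt (fun t : ℝ => t • x) ((1 : ℝ) • x) 1 :=
          (hasDerivAt_id (1 : ℝ)).smul_const x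
        have a2 : HasFDerivAt u (fderiv ℝ u x) ((1 : ℝ) • x) := by
          rw [one_smul]; exact (hd x).hasFDerivAt
        have := a2.comp_hasDerivAt (1 : ℝ) a1
        rwa [one_smul] at this
      have e2 : HasDerivAt (fun t : ℝ => u (t • x)) ((j + 1) * u x) 1 := by
        have : (fun t : ℝ => u (t • x)) = fun t => t ^ (j + 1) * u x := by ext t; exact h t x
        rw [this]
        have := (hasDerivAt_pow (j + 1) (1 : ℝ)).mul_const (u x)
        simpa using this
      exact e1.unique e2
    have h3 : u = fun x => ∑ i, ((j + 1 : ℝ)⁻¹ * crd W i x) * fderiv ℝ u x (Module.finBasis ℝ W i) := by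
      ext x
      have e : fderiv ℝ u x x = ∑ i, crd W i x * fderiv ℝ u x (Module.finBasis ℝ W i) := by
        conv_lhs => rw [vec_expand x]
        rw [map_sum]
        simp only [map_smul, smul_eq_mul]
        rw [← vec_expand x]
      rw [h2] at e
      have hj : (j + 1 : ℝ) ≠ 0 := by positivity
      simp only [mul_assoc]
      rw [← Finset.mul_sum, ← e]
      field_simp
    rw [h3]
    refine poly_sum _ fun i _ => poly_mul (poly_cmul _ (poly_clm (crd W i))) ?_
    exact ih _ (hc.clm_apply contDiff_const) (h1 _)

theorem points {X : Type} (V : Submodule ℝ (X → ℝ)) [FiniteDimensional ℝ V] :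
    ∃ (r : ℕ) (b : Fin r → X → ℝ) (c : Fin r → X →₀ ℝ), (∀ k, b k ∈ V) ∧
      ∀ u ∈ V, ∀ x, u x = ∑ k, ((c k).sum fun y a => a * u y) * b k x := by
  classical
  let ev : X → Module.Dual ℝ V := fun x => (LinearMap.proj x).comp V.subtype
  have hsp : Submodule.span ℝ (Set.range ev) = ⊤ := by
    by_contra hne
    obtain ⟨φ, hφ, hle⟩ := Submodule.exists_le_ker_of_lt_top _ (lt_top_iff_ne_top.2 hne)
    obtain ⟨v, rfl⟩ := (Module.evalEquiv ℝ V).surjective φ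
    apply hφ
    have hv : v = 0 := by
      apply Subtype.ext
      ext x
      exact hle (Submodule.subset_span ⟨x, rfl⟩)
    rw [hv, map_zero]
  let e := Module.finBasis ℝ V
  have hc : ∀ k, ∃ c : X →₀ ℝ, (c.sum fun y a => a • ev y) = e.coord k := fun k =>
    Finsupp.mem_span_range_iff_exists_finsupp.1 (hsp ▸ Submodule.mem_top)
  choose c hc using hc
  refine ⟨_, fun k => (e k : X → ℝ), c, fun k => (e k).2, fun u hu x => ?_⟩
  have h1 : (⟨u, hu⟩ : V) = ∑ k, e.coord k ⟨u, hu⟩ • e k := (e.sum_repr ⟨u, hu⟩).symm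
  have h2 := congrArg (fun v : V => (v : X → ℝ) x) h1
  simp only [Submodule.coe_sum, Finset.sum_apply, Submodule.coe_smul, Pi.smul_apply,
    smul_eq_mul] at h2
  refine h2.trans (Finset.sum_congr rfl fun k _ => ?_)
  rw [← hc k]
  congr 1
  rw [Finsupp.sum, LinearMap.sum_apply]
  rfl

section
variable {G : Type} [Group G] [TopologicalSpace G] [IsTopologicalGroup G] [CompactSpace G]
variable {W : Type} [NormedAddCommGroup W] [InnerProductSpace ℝ W] [FiniteDimensional ℝ W]
variable {ρ : G →* (W →ₗᵢ[ℝ] W)} {θ : W}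

theorem HGen.dil {ι : Type} [Fintype ι] {σ : ι → W → ℝ} {d : ι → ℕ} {i0 : ι}
    (H : HGen ρ σ d i0) (t : ℝ) (x : W) : (fun i => σ i (t • x)) = dil d t fun i => σ i x := by
  ext i; rw [dil_apply, H.hom i]

theorem origin_flat (hρ : CtsRep ρ) {ι : Type} [Fintype ι] {σ : ι → W → ℝ} {d : ι → ℕ} {i0 : ι}
    (H : HGen ρ σ d i0) {P : Type} [NormedAddCommGroup P] [NormedSpace ℝ P] [FiniteDimensional ℝ P]
    (f : P × W → ℝ) (hf : ContDiff ℝ ∞ f) (hfi : ∀ p g x, f (p, ρ g x) = f (p, x))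
    (C : Set P) (hC : IsCompact C) (hs : ∀ p x, p ∉ C → f (p, x) = 0) :
    ∃ F : P × (ι → ℝ) → ℝ, ContDiff ℝ ∞ F ∧ (∀ p y, p ∉ C → F (p, y) = 0) ∧
      ∀ (n : ℕ) p x, ‖x‖ = 1 → (fun t : ℝ => f (p, t • x) - F (p, fun i => σ i (t • x)))
        =O[𝓝 0] fun t : ℝ => t ^ n := by
  classical
  let h : (P × W) × ℝ → ℝ := fun z => f (z.1.1, z.2 • z.1.2)
  have hh : ContDiff ℝ ∞ h := hf.comp ((contDiff_fst.comp contDiff_fst).prodMk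
    (contDiff_snd.smul (contDiff_snd.comp contDiff_fst)))
  let a : ℕ → P × W → ℝ := fun j q => (pt^[j] h) (q, 0) / j.factorial
  have ha : ∀ j, ContDiff ℝ ∞ (a j) := fun j =>
    ((pt_iter_contDiff hh j).comp (contDiff_id.prodMk contDiff_const)).div_const _
  have haD : ∀ j p x, a j (p, x) = iteratedDeriv j (fun t : ℝ => f (p, t • x)) 0 / j.factorial := by
    intro j p x
    have := iteratedDeriv_pt hh j (p, x)
    simp only [a]
    rw [← congrFun this 0]
  have hsm : ∀ p x, ContDiff ℝ ∞ fun t : ℝ => f (p, t • x) := fun p x =>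
    hf.comp (contDiff_const.prodMk (contDiff_id.smul contDiff_const))
  have hahom : ∀ j p, IsHom j fun x => a j (p, x) := by
    intro j p s x
    show a j (p, s • x) = s ^ j * a j (p, x)
    have e : (fun t : ℝ => f (p, t • s • x)) = fun t => (fun r : ℝ => f (p, r • x)) (s * t) := by
      ext t; simp only [smul_smul, mul_comm]
    rw [haD, haD, e, iteratedDeriv_comp_const_mul ((hsm p x).of_le (by exact_mod_cast le_top))]
    simp only [mul_zero]; ring
  have hainv : ∀ j p, Inv ρ fun x => a j (p, x) := by
    intro j p g x
    show a j (p, ρ g x) = a j (p, x)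
    have e : (fun t : ℝ => f (p, t • ρ g x)) = fun t => f (p, t • x) := by
      ext t; rw [← map_smul, hfi]
    rw [haD, haD, e]
  have ha0 : ∀ j p x, p ∉ C → a j (p, x) = 0 := by
    intro j p x hp
    have e : (fun t : ℝ => f (p, t • x)) = fun _ => 0 := by ext t; exact hs _ _ hp
    rw [haD, e, iteratedDeriv_const]; simp
  have hap : ∀ j p, (fun x => a j (p, x)) ∈ Poly W := fun j p =>
    hom_poly j _ ((ha j).comp (contDiff_const.prodMk contDiff_id)) (hahom j p)
  let V : ℕ → Submodule ℝ (W → ℝ) := fun j =>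
    { carrier := {u | u ∈ HomPoly W j ∧ Inv ρ u}
      add_mem' := fun {u v} hu hv => ⟨Submodule.add_mem _ hu.1 hv.1, fun g x => by
        show u (ρ g x) + v (ρ g x) = u x + v x
        rw [hu.2, hv.2]⟩
      zero_mem' := ⟨Submodule.zero_mem _, fun g x => rfl⟩
      smul_mem' := fun c {u} hu => ⟨Submodule.smul_mem _ c hu.1, fun g x => by
        show c * u (ρ g x) = c * u x
        rw [hu.2]⟩ }
  haveI hfin : ∀ j, FiniteDimensional ℝ (V j) := fun j => by
    haveI := homPoly_finite (W := W) j
    exact Submodule.finiteDimensional_of_le (fun u (hu : u ∈ V j) => hu.1)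
  choose r b c hb hu using fun j => points (V j)
  choose B hBw hB using fun j k => H.gen_hom (hb j k).1.1 (hb j k).2 (hb j k).1.2
  let Q : ℕ → P × (ι → ℝ) → ℝ := fun j z =>
    ∑ k, ((c j k).sum fun y α => α * a j (z.1, y)) * MvPolynomial.eval z.2 (B j k)
  have hQ : ∀ j, ContDiff ℝ ∞ (Q j) := fun j => by
    refine ContDiff.sum fun k _ => ContDiff.mul ?_ ((mv_contDiff _).comp contDiff_snd)
    refine ContDiff.sum fun y _ => contDiff_const.mul ?_
    exact (ha j).comp (contDiff_fst.prodMk contDiff_const)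
  have hQσ : ∀ j p x, Q j (p, fun i => σ i x) = a j (p, x) := by
    intro j p x
    have := hu j (fun x => a j (p, x)) ⟨⟨hap j p, hahom j p⟩, hainv j p⟩ x
    rw [this]
    simp only [Q, ← hB]
  -- bound on the sphere
  have hcs : IsCompact (Metric.sphere (0 : W) 1) := isCompact_sphere 0 1
  obtain ⟨R, hR⟩ := (hcs.image H.continuous).isBounded.exists_norm_le
  obtain ⟨F, hF, hF0, hFn⟩ := borel d H.pos Q hQ (by
      intro j p t y
      simp only [Q, Finset.mul_sum]
      refine Finset.sum_congr rfl fun k _ => ?_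
      have := weighted_eval (hBw j k) t y
      have e : Schwarz.dil d t y = fun i => t ^ d i * y i := by ext i; rw [dil_apply]
      rw [e, this]; ring) C hC (by
      intro j p y hp
      simp only [Q, ha0 j p _ hp, mul_zero]
      simp) R
  refine ⟨F, hF, fun p y hp => hF0 p y fun j => by
      simp only [Q, ha0 j p _ hp, mul_zero]
      simp, ?_⟩
  intro n p x hx
  have h1 := hFn n p (fun i => σ i x) (hR _ ⟨x, by simpa using hx, rfl⟩)
  have h2 := taylor1 _ (hsm p x) n
  have h3 := h2.sub h1
  have h4 : (fun t : ℝ => f (p, t • x) - F (p, fun i => σ i (t • x)))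
      =O[𝓝 0] fun t : ℝ => t ^ (n + 1) := by
    refine h3.congr_left fun t => ?_
    simp only [hQσ, haD]
    rw [H.dil]; ring
  refine h4.trans ?_
  simp only [pow_succ]
  have : (fun t : ℝ => t) =O[𝓝 0] fun _ : ℝ => (1 : ℝ) :=
    (continuous_id.tendsto (0 : ℝ)).isBigO_one ℝ
  simpa using (Asymptotics.isBigO_refl (fun t : ℝ => t ^ n) (𝓝 0)).mul this

end

end Schwarz

namespace Schwarz

open scoped ContDiff Topology Manifold

set_option linter.all false
set_option linter.unusedSectionVars false
set_option linter.style.haveILetI false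
set_option linter.unusedSimpArgs false

/-! ### Part J: factorization of flat functions near the origin, and the induction -/

/-- Weighted polar coordinates. -/
noncomputable def polar {P ι : Type} (d : ι → ℕ) (i0 : ι) (z : P × (ι → ℝ)) : (P × (ι → ℝ)) × ℝ :=
  ((z.1, fun i => ((√(z.2 i0)) ^ d i)⁻¹ * z.2 i), √(z.2 i0))

section
variable {P : Type} [NormedAddCommGroup P] [NormedSpace ℝ P] {ι : Type} [Fintype ι]

/-- The coordinate functional. -/
noncomputable def lin (P : Type) [NormedAddCommGroup P] [NormedSpace ℝ P] {ι : Type} [Fintype ι]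
    (i : ι) : (P × (ι → ℝ)) →L[ℝ] ℝ :=
  (ContinuousLinearMap.proj (R := ℝ) (φ := fun _ : ι => ℝ) i).comp
    (ContinuousLinearMap.snd ℝ P (ι → ℝ))

theorem lin_apply (i : ι) (z : P × (ι → ℝ)) : lin P i z = z.2 i := rfl

/-- The numerator of the derivative of polar coordinates. -/
noncomputable def polarD (d : ι → ℕ) (i0 : ι) (M : ℕ) (q : (P × (ι → ℝ)) × ℝ) :
    (P × (ι → ℝ)) →L[ℝ] (P × (ι → ℝ)) × ℝ :=
  ((q.2 ^ M • ContinuousLinearMap.fst ℝ P (ι → ℝ)).prod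
    (ContinuousLinearMap.pi fun i => q.2 ^ (M - d i) • lin P i -
      (d i / 2 * q.2 ^ (M - 2) * q.1.2 i) • lin P i0)).prod ((q.2 ^ (M - 1) / 2) • lin P i0)

theorem polarD_contDiff [FiniteDimensional ℝ P] (d : ι → ℕ) (i0 : ι) (M : ℕ) :
    ContDiff ℝ ∞ (polarD (P := P) d i0 M) := by
  refine contDiff_clm_apply_iff.2 fun z => ?_
  have c2 : ContDiff ℝ ∞ fun q : (P × (ι → ℝ)) × ℝ => q.2 := contDiff_snd
  have c1 : ∀ i, ContDiff ℝ ∞ fun q : (P × (ι → ℝ)) × ℝ => q.1.2 i := fun i =>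
    (contDiff_apply ℝ ℝ i).comp (contDiff_snd.comp contDiff_fst)
  have e : (fun q => polarD (P := P) d i0 M q z) = fun q => ((q.2 ^ M • z.1, fun i =>
      q.2 ^ (M - d i) * z.2 i - (d i / 2 * q.2 ^ (M - 2) * q.1.2 i) * z.2 i0),
      (q.2 ^ (M - 1) / 2) * z.2 i0) := rfl
  rw [e]
  refine (((c2.pow M).smul contDiff_const).prodMk (contDiff_pi.2 fun i => ?_)).prodMk ?_
  · exact ((c2.pow _).mul contDiff_const).sub
      (((contDiff_const.mul (c2.pow _)).mul (c1 i)).mul contDiff_const)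
  · exact ((c2.pow _).div_const _).mul contDiff_const

theorem polar_deriv (d : ι → ℕ) (i0 : ι) (M : ℕ) (hM : ∀ i, d i ≤ M) (hM2 : 2 ≤ M)
    (z : P × (ι → ℝ)) (hz : 0 < lin P i0 z) :
    HasFDerivAt (polar (P := P) d i0)
      ((((polar d i0 z).2) ^ M)⁻¹ • polarD d i0 M (polar d i0 z)) z := by
  have ht : 0 < √(z.2 i0) := Real.sqrt_pos.2 hz
  have h1 : HasFDerivAt (fun z : P × (ι → ℝ) => √(z.2 i0))
      ((1 / (2 * √(z.2 i0))) • lin P i0) z := by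
    have := (lin P i0).hasFDerivAt (x := z)
    exact this.sqrt hz.ne'
  have h2 : ∀ i, HasFDerivAt (fun z : P × (ι → ℝ) => ((√(z.2 i0)) ^ d i)⁻¹ * z.2 i)
      (((√(z.2 i0)) ^ d i)⁻¹ • lin P i -
        ((d i / 2) * ((√(z.2 i0)) ^ 2)⁻¹ * (((√(z.2 i0)) ^ d i)⁻¹ * z.2 i)) • lin P i0) z := by
    intro i
    have a1 : HasDerivAt (fun t : ℝ => (t ^ d i)⁻¹)
        (-(d i * (√(z.2 i0)) ^ (d i - 1)) / ((√(z.2 i0)) ^ d i) ^ 2) (√(z.2 i0)) :=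
      (hasDerivAt_pow (d i) (√(z.2 i0))).inv (by positivity)
    have a2 := a1.comp_hasFDerivAt z h1
    have a3 := a2.mul ((lin P i).hasFDerivAt (x := z))
    refine a3.congr_fderiv (ContinuousLinearMap.ext fun w => ?_)
    simp only [ContinuousLinearMap.add_apply, ContinuousLinearMap.sub_apply,
      ContinuousLinearMap.smul_apply, smul_eq_mul, Function.comp, lin_apply]
    rcases Nat.eq_zero_or_pos (d i) with h0 | h0
    · simp [h0]
    · obtain ⟨k, hk⟩ := Nat.exists_eq_add_of_lt h0
      rw [hk]
      simp only [zero_add, Nat.add_sub_cancel]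
      generalize √(z.2 i0) = t at ht
      field_simp
      ring
  have h3 : HasFDerivAt (polar (P := P) d i0) (((ContinuousLinearMap.fst ℝ P (ι → ℝ)).prod
      (ContinuousLinearMap.pi fun i => ((√(z.2 i0)) ^ d i)⁻¹ • lin P i -
        ((d i / 2) * ((√(z.2 i0)) ^ 2)⁻¹ * (((√(z.2 i0)) ^ d i)⁻¹ * z.2 i)) • lin P i0)).prod
      ((1 / (2 * √(z.2 i0))) • lin P i0)) z :=
    ((hasFDerivAt_fst).prodMk (hasFDerivAt_pi.2 h2)).prodMk h1
  refine h3.congr_fderiv ?_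
  have e1 : (polar d i0 z).2 = √(z.2 i0) := rfl
  have e2 : ∀ i, (polar d i0 z).1.2 i = ((√(z.2 i0)) ^ d i)⁻¹ * z.2 i := fun i => rfl
  refine ContinuousLinearMap.ext fun w => ?_
  refine Prod.ext (Prod.ext ?_ ?_) ?_
  · show w.1 = ((polar d i0 z).2 ^ M)⁻¹ • ((polar d i0 z).2 ^ M • w.1)
    rw [e1, smul_smul, inv_mul_cancel₀ (by positivity), one_smul]
  · ext i
    show ((√(z.2 i0)) ^ d i)⁻¹ * w.2 i -
        ((d i / 2) * ((√(z.2 i0)) ^ 2)⁻¹ * (((√(z.2 i0)) ^ d i)⁻¹ * z.2 i)) * w.2 i0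
      = ((polar d i0 z).2 ^ M)⁻¹ * ((polar d i0 z).2 ^ (M - d i) * w.2 i -
        (d i / 2 * (polar d i0 z).2 ^ (M - 2) * (polar d i0 z).1.2 i) * w.2 i0)
    rw [e2, e1, pow_sub₀ _ ht.ne' (hM i), pow_sub₀ _ ht.ne' hM2]
    generalize √(z.2 i0) = t at ht
    field_simp
  · show (1 / (2 * √(z.2 i0))) * w.2 i0
      = ((polar d i0 z).2 ^ M)⁻¹ * (((polar d i0 z).2 ^ (M - 1) / 2) * w.2 i0)
    rw [e1, pow_sub₀ _ ht.ne' (by omega : 1 ≤ M)]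
    generalize √(z.2 i0) = t at ht
    field_simp

end

theorem Flt.of_mul {Q : Type} [NormedAddCommGroup Q] [NormedSpace ℝ Q] {χ h : Q × ℝ → ℝ}
    (hχ : ContDiff ℝ ∞ χ) (hc : HasCompactSupport χ) (hh : ContDiff ℝ ∞ h)
    (hf : ∀ q k, iteratedFDeriv ℝ k h (q, 0) = 0) : Flt fun z => χ z * h z where
  smooth := hχ.mul hh
  supp := hc.mul_right
  flat q k := by
    have := norm_iteratedFDeriv_mul_le hχ hh (q, (0 : ℝ)) (n := k) (by exact_mod_cast le_top)
    rw [← norm_le_zero_iff]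
    refine this.trans (le_of_eq (Finset.sum_eq_zero fun i _ => ?_))
    rw [hf]; simp

section
variable {G : Type} [Group G] [TopologicalSpace G] [IsTopologicalGroup G] [CompactSpace G]
variable {W : Type} [NormedAddCommGroup W] [InnerProductSpace ℝ W] [FiniteDimensional ℝ W]
variable {ρ : G →* (W →ₗᵢ[ℝ] W)} {θ : W}

theorem flat_fac (hρ : CtsRep ρ) {ι : Type} [Fintype ι] {σ : ι → W → ℝ} {d : ι → ℕ} {i0 : ι}
    (H : HGen ρ σ d i0) (hG : ∀ θ : W, θ ≠ 0 → Good (repN ρ θ)) [Nontrivial W]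
    {P : Type} [NormedAddCommGroup P] [NormedSpace ℝ P] [FiniteDimensional ℝ P]
    (f : P × W → ℝ) (hf : ContDiff ℝ ∞ f) (hfi : ∀ p g x, f (p, ρ g x) = f (p, x))
    (C : Set P) (hC : IsCompact C) (hs : ∀ p x, p ∉ C → f (p, x) = 0)
    (hfl : ∀ (n : ℕ) p x, ‖x‖ = 1 → (fun t : ℝ => f (p, t • x)) =O[𝓝 0] fun t : ℝ => t ^ n) :
    ∃ F : P × (ι → ℝ) → ℝ, ContDiff ℝ ∞ F ∧
      ∀ p x, ‖x‖ ≤ 1 → F (p, fun i => σ i x) = f (p, x) := by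
  classical
  -- factor on the sphere
  obtain ⟨K, hK, hKx⟩ := glue (Z := (P × ℝ) × (ι → ℝ)) (X := (P × ℝ) × W)
    (fun z => (z.1, fun i => σ i z.2)) {z | ‖z.2‖ = 1} (fun z => f (z.1.1, z.1.2 • z.2))
    (by
      have hp : IsProperMap (Prod.map (id : P × ℝ → P × ℝ) fun (x : W) i => σ i x) :=
        isProperMap_id.prodMap H.proper
      exact hp.isClosedMap _ (isClosed_eq (continuous_snd.norm) continuous_const))
    (by
      rintro ⟨p, x⟩ hx
      have hx0 : x ≠ 0 := by
        rintro rfl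
        simp at hx
      obtain ⟨U, hU, F, hF, hFx⟩ := local_fac hρ H x (hG x hx0) (P := P × ℝ)
        (fun z => f (z.1.1, z.1.2 • z.2))
        (hf.comp ((contDiff_fst.comp contDiff_fst).prodMk
          ((contDiff_snd.comp contDiff_fst).smul contDiff_snd)))
        (fun p g x => by
          show f (p.1, p.2 • ρ g x) = f (p.1, p.2 • x)
          rw [← map_smul, hfi]) p
      exact ⟨U, hU, F, hF, fun z _ hz => hFx z.1 z.2 hz⟩)
  have hcs : IsCompact (Metric.sphere (0 : W) 1) := isCompact_sphere 0 1
  obtain ⟨R, hR⟩ := (hcs.image H.continuous).isBounded.exists_norm_le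
  obtain ⟨R', hR'⟩ := hC.isBounded.exists_norm_le
  obtain ⟨χ, hχ, hχc, hχ1⟩ := cutoff (E := P × (ι → ℝ)) (max R R')
  obtain ⟨χ', hχ', hχc', hχ1'⟩ := cutoff (E := (P × (ι → ℝ)) × ℝ) (max (max R R') 1)
  let h : (P × (ι → ℝ)) × ℝ → ℝ := fun z => χ z.1 * K ((z.1.1, z.2), z.1.2)
  have hh : ContDiff ℝ ∞ h := (hχ.comp contDiff_fst).mul (hK.comp
    (((contDiff_fst.comp contDiff_fst).prodMk contDiff_snd).prodMk
      (contDiff_snd.comp contDiff_fst)))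
  have hσn : ∀ x : W, ‖x‖ = 1 → ‖fun i => σ i x‖ ≤ R := fun x hx =>
    hR _ ⟨x, by simpa using hx, rfl⟩
  have hhx : ∀ p x, ‖x‖ = 1 → ∀ t, h ((p, fun i => σ i x), t) = f (p, t • x) := by
    intro p x hx t
    have h1 : K ((p, t), fun i => σ i x) = f (p, t • x) := hKx ((p, t), x) hx
    by_cases hp : p ∈ C
    swap
    · show χ (p, fun i => σ i x) * K ((p, t), fun i => σ i x) = _
      rw [h1, hs _ _ hp, mul_zero]
    have h2 : χ (p, fun i => σ i x) = 1 := hχ1 _ (by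
      rw [Prod.norm_mk, max_comm R R']
      exact max_le_max (hR' p hp) (hσn x hx))
    show χ (p, fun i => σ i x) * K ((p, t), fun i => σ i x) = _
    rw [h1, h2, one_mul]
  obtain ⟨h', hh', hfl', hhx'⟩ := flatten h hh (tsupport χ) hχc (by
    intro q t hq
    show χ q * _ = 0
    rw [image_eq_zero_of_notMem_tsupport hq, zero_mul])
  have hFlt : Flt fun z => χ' z * h' z := Flt.of_mul hχ' hχc' hh' hfl'
  have hval : ∀ p x, ‖x‖ = 1 → ∀ t, |t| ≤ 1 →
      χ' ((p, fun i => σ i x), t) * h' ((p, fun i => σ i x), t) = f (p, t • x) := by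
    intro p x hx t ht
    rw [hhx' (p, fun i => σ i x) (fun n => by simpa only [hhx p x hx] using hfl n p x hx) t,
      hhx p x hx]
    by_cases hp : p ∈ C
    swap
    · rw [hs _ _ hp, mul_zero]
    rw [hχ1' _ (by
        rw [Prod.norm_mk, Prod.norm_mk, max_comm R R']
        exact max_le_max (max_le_max (hR' p hp) (hσn x hx)) ht), one_mul]
  let M := (∑ i, d i) + 2
  have hM : ∀ i, d i ≤ M := fun i =>
    (Finset.single_le_sum (fun _ _ => Nat.zero_le _) (Finset.mem_univ i)).trans (Nat.le_add_right _ _)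
  have hpb := fun n => flat_pullback (lin P i0) (polar d i0) (polarD d i0 M) M
    (polarD_contDiff d i0 M) (fun z => rfl)
    (fun z hz => polar_deriv d i0 M hM (Nat.le_add_left _ _) z hz) n 0 hFlt
  refine ⟨_, contDiff_infty.2 hpb, fun p x hx => ?_⟩
  have hl : lin P i0 (p, fun i => σ i x) = ‖x‖ ^ 2 := H.sq x
  simp only [hl]
  by_cases hx0 : x = 0
  · subst hx0
    obtain ⟨u, hu⟩ := exists_norm_eq W (zero_le_one (α := ℝ))
    have := (hfl 1 p u hu)
    simp only [pow_one] at this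
    have h0 := this.eq_zero_imp.self_of_nhds rfl
    rw [zero_smul] at h0
    rw [if_neg (by simp), h0]
  · have hxn : 0 < ‖x‖ := norm_pos_iff.2 hx0
    have hsq : √(σ i0 x) = ‖x‖ := by rw [H.sq, Real.sqrt_sq hxn.le]
    have hpol : polar d i0 (p, fun i => σ i x) = ((p, fun i => σ i (‖x‖⁻¹ • x)), ‖x‖) := by
      simp only [polar, hsq]
      congr 2
      ext i
      rw [H.hom i, inv_pow]
    rw [if_pos (by positivity), hpol, pow_zero, inv_one, one_smul,
      hval p (‖x‖⁻¹ • x) (by rw [norm_smul, norm_inv, norm_norm, inv_mul_cancel₀ hxn.ne']) ‖x‖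
        (by rwa [abs_of_pos hxn]), smul_smul, mul_inv_cancel₀ hxn.ne', one_smul]

/-- Local factorization at the origin. -/
theorem origin_fac (hρ : CtsRep ρ) {ι : Type} [Fintype ι] {σ : ι → W → ℝ} {d : ι → ℕ} {i0 : ι}
    (H : HGen ρ σ d i0) (hG : ∀ θ : W, θ ≠ 0 → Good (repN ρ θ))
    {P : Type} [NormedAddCommGroup P] [NormedSpace ℝ P] [FiniteDimensional ℝ P]
    (f : P × W → ℝ) (hf : ContDiff ℝ ∞ f) (hfi : ∀ p g x, f (p, ρ g x) = f (p, x)) (p0 : P) :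
    ∃ U ∈ 𝓝 (p0, fun i => σ i (0 : W)), ∃ F : P × (ι → ℝ) → ℝ, ContDiffOn ℝ ∞ F U ∧
      ∀ p x, (p, fun i => σ i x) ∈ U → F (p, fun i => σ i x) = f (p, x) := by
  classical
  rcases subsingleton_or_nontrivial W with hW | hW
  · refine ⟨Set.univ, Filter.univ_mem, fun z => f (z.1, 0),
      (hf.comp (contDiff_fst.prodMk contDiff_const)).contDiffOn, fun p x _ => ?_⟩
    rw [Subsingleton.elim x 0]
  obtain ⟨β, hβ, hβc, hβ1⟩ := cutoff (E := P) (‖p0‖ + 1)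
  let f1 : P × W → ℝ := fun z => β z.1 * f z
  have hf1 : ContDiff ℝ ∞ f1 := (hβ.comp contDiff_fst).mul hf
  have hf1i : ∀ p g x, f1 (p, ρ g x) = f1 (p, x) := fun p g x => by
    show β p * f (p, ρ g x) = β p * f (p, x)
    rw [hfi]
  have hf1s : ∀ p x, p ∉ tsupport β → f1 (p, x) = 0 := fun p x hp => by
    show β p * f (p, x) = 0
    rw [image_eq_zero_of_notMem_tsupport hp, zero_mul]
  obtain ⟨F0, hF0, hF0s, hfl⟩ := origin_flat hρ H f1 hf1 hf1i (tsupport β) hβc hf1s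
  obtain ⟨F, hF, hFx⟩ := flat_fac hρ H hG (fun z => f1 z - F0 (z.1, fun i => σ i z.2))
    (hf1.sub (hF0.comp (contDiff_fst.prodMk (contDiff_pi.2 fun i =>
      (poly_contDiff (H.poly i)).comp contDiff_snd))))
    (fun p g x => by
      show f1 (p, ρ g x) - F0 (p, fun i => σ i (ρ g x)) = f1 (p, x) - F0 (p, fun i => σ i x)
      rw [hf1i]
      simp only [H.inv _ g x]) (tsupport β) hβc
    (fun p x hp => by
      show f1 (p, x) - F0 (p, fun i => σ i x) = 0
      rw [hf1s p x hp, hF0s p _ hp, sub_zero]) hfl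
  refine ⟨{z | ‖z.1‖ < ‖p0‖ + 1 ∧ z.2 i0 < 1}, ?_, fun z => F0 z + F z,
    (hF0.add hF).contDiffOn, ?_⟩
  · refine IsOpen.mem_nhds ?_ ?_
    · exact (isOpen_lt continuous_fst.norm continuous_const).inter
        (isOpen_lt ((continuous_apply i0).comp continuous_snd) continuous_const)
    · refine ⟨by show ‖p0‖ < ‖p0‖ + 1; linarith, ?_⟩
      show σ i0 0 < 1
      rw [H.sq]; simp
  · rintro p x ⟨h1, h2⟩
    have h2' : ‖x‖ ^ 2 < 1 := by rw [← H.sq]; exact h2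
    have hx : ‖x‖ ≤ 1 := by nlinarith [norm_nonneg x]
    show F0 (p, fun i => σ i x) + F (p, fun i => σ i x) = f (p, x)
    rw [hFx p x hx]
    show F0 (p, fun i => σ i x) + (β p * f (p, x) - F0 (p, fun i => σ i x)) = f (p, x)
    rw [hβ1 p h1.le]; ring

end

theorem good_main (n : ℕ) : ∀ (G : Type) [Group G] [TopologicalSpace G] [IsTopologicalGroup G]
    [CompactSpace G] (W : Type) [NormedAddCommGroup W] [InnerProductSpace ℝ W]
    [FiniteDimensional ℝ W] (ρ : G →* (W →ₗᵢ[ℝ] W)), CtsRep ρ → Module.finrank ℝ W = n →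
    Good ρ := by
  induction n using Nat.strong_induction_on with
  | _ n ih =>
    intro G _ _ _ _ W _ _ _ ρ hρ hn
    have hG : ∀ θ : W, θ ≠ 0 → Good (repN ρ θ) := by
      intro θ hθ
      haveI := stab_compact (θ := θ) hρ
      have hrN : CtsRep (repN ρ θ) := subRep_cts hρ
      let v : nrm ρ θ := ⟨θ, self_mem_nrm⟩
      have hv0 : v ≠ 0 := fun h => hθ (congrArg Subtype.val h)
      have hv : ∀ g, repN ρ θ g v = v := fun g => Subtype.ext g.2
      refine good_extend hrN hv0 hv ?_
      haveI : CompactSpace (⊤ : Subgroup (stab ρ θ)) :=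
        isCompact_iff_compactSpace.1 (by simpa using isCompact_univ)
      refine ih (Module.finrank ℝ (perp v)) ?_ _ _ _ (subRep_cts hrN) rfl
      rw [← hn]
      exact (perp_lt hv0).trans_le (Submodule.finrank_le _)
    obtain ⟨ι, _, σ, d, i0, H⟩ := hilbert hρ
    refine good_of_one H ?_
    intro P _ _ _ f hf hfi
    obtain ⟨F, hF, hFx⟩ := glue (Z := P × (ι → ℝ)) (X := P × W)
      (fun z => (z.1, fun i => σ i z.2)) Set.univ f
      (by
        have hp : IsProperMap (Prod.map (id : P → P) fun (x : W) i => σ i x) :=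
          isProperMap_id.prodMap H.proper
        exact hp.isClosedMap _ isClosed_univ)
      (by
        rintro ⟨p, x⟩ -
        have : ∃ U ∈ 𝓝 (p, fun i => σ i x), ∃ F : P × (ι → ℝ) → ℝ, ContDiffOn ℝ ∞ F U ∧
            ∀ p x, (p, fun i => σ i x) ∈ U → F (p, fun i => σ i x) = f (p, x) := by
          by_cases hx : x = 0
          · subst hx
            exact origin_fac hρ H hG f hf hfi p
          · exact local_fac hρ H x (hG x hx) f hf hfi p
        obtain ⟨U, hU, F, hF, hFx⟩ := this
        exact ⟨U, hU, F, hF, fun z _ hz => hFx z.1 z.2 hz⟩)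
    exact ⟨F, hF, fun p x => (hFx (p, x) trivial).symm⟩

end Schwarz

namespace Schwarz

open scoped ContDiff Topology Manifold

set_option linter.all false
set_option linter.unusedSectionVars false
set_option linter.style.haveILetI false
set_option linter.unusedSimpArgs false

/-! ### Part K: from matrix groups to representations -/

theorem poly_euclidean {m : ℕ} {p : EuclideanSpace ℝ (Fin m) → ℝ}
    (hp : p ∈ Poly (EuclideanSpace ℝ (Fin m))) :
    ∃ B : MvPolynomial (Fin m) ℝ, ∀ x : Fin m → ℝ, p (WithLp.toLp 2 x) = MvPolynomial.eval x B := by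
  classical
  refine poly_induction (C := fun p _ => ∃ B : MvPolynomial (Fin m) ℝ,
    ∀ x : Fin m → ℝ, p (WithLp.toLp 2 x) = MvPolynomial.eval x B) ?_ ?_ ?_ ?_ hp
  · intro l
    refine ⟨∑ k, MvPolynomial.C (l (EuclideanSpace.single k 1)) * MvPolynomial.X k, fun x => ?_⟩
    have e : WithLp.toLp 2 x = ∑ k, x k • (EuclideanSpace.single k (1 : ℝ)) := by
      ext i
      simp [Finset.sum_apply, Pi.single_apply]
    rw [e, map_sum, map_sum]
    refine Finset.sum_congr rfl fun k _ => ?_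
    simp [mul_comm]
  · intro c
    exact ⟨MvPolynomial.C c, fun x => by simp⟩
  · rintro p q _ _ ⟨B, hB⟩ ⟨B', hB'⟩
    exact ⟨B + B', fun x => by rw [map_add, ← hB, ← hB']⟩
  · rintro p q _ _ ⟨B, hB⟩ ⟨B', hB'⟩
    exact ⟨B * B', fun x => by rw [map_mul, ← hB, ← hB']⟩

theorem mulVec_norm {m : ℕ} {g : Matrix (Fin m) (Fin m) ℝ}
    (hg : g ∈ Matrix.orthogonalGroup (Fin m) ℝ) (x : Fin m → ℝ) :
    ‖WithLp.toLp 2 (g.mulVec x)‖ = ‖WithLp.toLp 2 x‖ := by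
  have h : ∀ y : Fin m → ℝ, ‖WithLp.toLp 2 y‖ ^ 2 = y ⬝ᵥ y := by
    intro y
    rw [EuclideanSpace.norm_sq_eq]
    simp [dotProduct, sq]
  have h1 : g.transpose * g = 1 := by
    have := (Matrix.mem_orthogonalGroup_iff' (Fin m) ℝ).1 hg
    exact this
  have h2 : ‖WithLp.toLp 2 (g.mulVec x)‖ ^ 2 = ‖WithLp.toLp 2 x‖ ^ 2 := by
    rw [h, h, Matrix.dotProduct_mulVec, Matrix.vecMul_mulVec, h1, Matrix.vecMul_one]
  exact (pow_left_inj₀ (norm_nonneg _) (norm_nonneg _) two_ne_zero).1 h2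

/-- The subgroup with given carrier. -/
def grp {m : ℕ} (K : Set (Matrix (Fin m) (Fin m) ℝ))
    (hKO : ∀ g ∈ K, g ∈ Matrix.orthogonalGroup (Fin m) ℝ)
    (hK1 : (1 : Matrix (Fin m) (Fin m) ℝ) ∈ K)
    (hKmul : ∀ g ∈ K, ∀ h ∈ K, g * h ∈ K)
    (hKinv : ∀ g ∈ K, g⁻¹ ∈ K) : Subgroup (Matrix.orthogonalGroup (Fin m) ℝ) where
  carrier := {u | (u : Matrix (Fin m) (Fin m) ℝ) ∈ K}
  mul_mem' := fun {a b} ha hb => hKmul _ ha _ hb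
  one_mem' := hK1
  inv_mem' := fun {a} ha => by
    have h1 := hKinv _ ha
    have h2 : (a : Matrix (Fin m) (Fin m) ℝ)⁻¹ = ((a⁻¹ : Matrix.orthogonalGroup (Fin m) ℝ) :
        Matrix (Fin m) (Fin m) ℝ) :=
      Matrix.inv_eq_right_inv (by
        have := congrArg (fun u : Matrix.orthogonalGroup (Fin m) ℝ =>
          (u : Matrix (Fin m) (Fin m) ℝ)) (mul_inv_cancel a)
        exact this)
    rw [h2] at h1
    exact h1

/-- The matrix representation. -/
noncomputable def matRep {m : ℕ} (L : Subgroup (Matrix.orthogonalGroup (Fin m) ℝ)) :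
    L →* (EuclideanSpace ℝ (Fin m) →ₗᵢ[ℝ] EuclideanSpace ℝ (Fin m)) where
  toFun g :=
    { toFun := fun x => WithLp.toLp 2 ((g.1.1).mulVec x.ofLp)
      map_add' := fun x y => by
        rw [WithLp.ofLp_add, Matrix.mulVec_add, WithLp.toLp_add]
      map_smul' := fun c x => by
        rw [WithLp.ofLp_smul, Matrix.mulVec_smul, WithLp.toLp_smul]; rfl
      norm_map' := fun x => mulVec_norm g.1.2 x.ofLp }
  map_one' := by
    ext x i
    show ((1 : Matrix (Fin m) (Fin m) ℝ).mulVec x.ofLp) i = x.ofLp i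
    rw [Matrix.one_mulVec]
  map_mul' a b := by
    ext x i
    show ((a.1.1 * b.1.1).mulVec x.ofLp) i = (a.1.1.mulVec (b.1.1.mulVec x.ofLp)) i
    rw [Matrix.mulVec_mulVec]

theorem matRep_apply {m : ℕ} (L : Subgroup (Matrix.orthogonalGroup (Fin m) ℝ)) (g : L)
    (x : EuclideanSpace ℝ (Fin m)) : matRep L g x = WithLp.toLp 2 ((g.1.1).mulVec x.ofLp) := rfl

theorem matRep_cts {m : ℕ} (L : Subgroup (Matrix.orthogonalGroup (Fin m) ℝ)) :
    CtsRep (matRep L) := by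
  refine (PiLp.continuous_toLp 2 _).comp ?_
  refine Continuous.matrix_mulVec ?_ ?_
  · exact continuous_subtype_val.comp (continuous_subtype_val.comp continuous_fst)
  · exact (PiLp.continuous_ofLp 2 _).comp continuous_snd

end Schwarz

/-- **Schwarz's theorem** (Theorem 2.4(2)): if `K` is a compact subgroup of the orthogonal
group `O(m,ℝ)` and `σ₁, …, σ_N` are `K`-invariant polynomials generating the algebra of
all `K`-invariant polynomials on `ℝ^m`, then every `K`-invariant smooth function
`f : ℝ^m → ℝ` factors as `f = F ∘ σ` for some smooth `F : ℝ^N → ℝ`. -/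
theorem schwarz_smooth_invariant_functions
    (m N : ℕ)
    (K : Set (Matrix (Fin m) (Fin m) ℝ))
    (hKO : ∀ g ∈ K, g ∈ Matrix.orthogonalGroup (Fin m) ℝ)
    (hK1 : (1 : Matrix (Fin m) (Fin m) ℝ) ∈ K)
    (hKmul : ∀ g ∈ K, ∀ h ∈ K, g * h ∈ K)
    (hKinv : ∀ g ∈ K, g⁻¹ ∈ K)
    (hKcpt : IsCompact K)
    (σ : Fin N → MvPolynomial (Fin m) ℝ)
    (hσinv : ∀ i, ∀ g ∈ K, ∀ x : Fin m → ℝ,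
      MvPolynomial.eval (g.mulVec x) (σ i) = MvPolynomial.eval x (σ i))
    (hσgen : ∀ p : MvPolynomial (Fin m) ℝ,
      (∀ g ∈ K, ∀ x : Fin m → ℝ,
        MvPolynomial.eval (g.mulVec x) p = MvPolynomial.eval x p) →
      p ∈ Algebra.adjoin ℝ (Set.range σ))
    (f : (Fin m → ℝ) → ℝ)
    (hf : ContDiff ℝ (⊤ : ℕ∞) f)
    (hfinv : ∀ g ∈ K, ∀ x : Fin m → ℝ, f (g.mulVec x) = f x) :
    ∃ F : (Fin N → ℝ) → ℝ, ContDiff ℝ (⊤ : ℕ∞) F ∧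
      ∀ x : Fin m → ℝ, f x = F (fun i => MvPolynomial.eval x (σ i)) := by
  classical
  let L := Schwarz.grp K hKO hK1 hKmul hKinv
  have : CompactSpace L := by
    refine isCompact_iff_compactSpace.1 ?_
    refine (Topology.IsInducing.subtypeVal.isCompact_preimage_iff (K := K) ?_).2 hKcpt
    intro g hg
    exact ⟨⟨g, hKO g hg⟩, rfl⟩
  have hgood := Schwarz.good_main _ L _ (Schwarz.matRep L) (Schwarz.matRep_cts L) rfl
  have hσ0 : ∀ i, (fun x : EuclideanSpace ℝ (Fin m) => MvPolynomial.eval x.ofLp (σ i)) ∈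
      Schwarz.Poly (EuclideanSpace ℝ (Fin m)) := fun i =>
    Schwarz.poly_eval (σ := fun k (x : EuclideanSpace ℝ (Fin m)) => x.ofLp k)
      (fun k => Schwarz.poly_clm (EuclideanSpace.proj (𝕜 := ℝ) k)) (σ i)
  obtain ⟨F, hF, hFx⟩ := hgood (Fin 0 → ℝ) (fun z => f z.2.ofLp)
    (hf.comp ((PiLp.contDiff_ofLp).comp contDiff_snd))
    (fun p g x => hfinv g.1.1 g.2 x.ofLp) (Fin N)
    (fun i x => MvPolynomial.eval x.ofLp (σ i)) hσ0
    (by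
      intro p hp hi
      obtain ⟨B, hB⟩ := Schwarz.poly_euclidean hp
      have hBK : B ∈ Algebra.adjoin ℝ (Set.range σ) := by
        refine hσgen B fun g hg x => ?_
        rw [← hB, ← hB]
        exact hi ⟨⟨g, hKO g hg⟩, hg⟩ (WithLp.toLp 2 x)
      rw [Algebra.adjoin_range_eq_range_aeval] at hBK
      obtain ⟨B', hB'⟩ := hBK
      refine ⟨B', fun x => ?_⟩
      have h1 := hB x.ofLp
      rw [WithLp.toLp_ofLp] at h1
      rw [h1, ← hB']
      show MvPolynomial.eval x.ofLp (MvPolynomial.aeval σ B') = _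
      rw [MvPolynomial.aeval_def, MvPolynomial.eval₂_eq', map_sum, MvPolynomial.eval_eq' _ B']
      refine Finset.sum_congr rfl fun s _ => ?_
      simp [map_prod])
  refine ⟨fun y => F (0, y), hF.comp (contDiff_const.prodMk contDiff_id), fun x => ?_⟩
  exact hFx 0 (WithLp.toLp 2 x)
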